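/- arXiv:1211.0986 — 2 statements merged into one kernel-verified Lean document; each statement's English description precedes it below -/
import Mathlib

section
/- Let ε ∈ (0,1) and let 𝒜 be the partial circulant ensemble on mB × d matrices (with mB ≤ d). Suppose B ≥ log² m · log² k · log² d and k ≥ log² m. Then there exist absolute constants such that for some m = O(ε^{-2} k log d · log²(k log d)), provided m < d/B, the matrix Φ of the hashed construction applied to A ∼ 𝒜 satisfies sup_{x∈T_k} |(1/(mB))‖Φx‖₂² − ‖x‖₂²| ≤ ε with probability at least 3/4. -/
open MeasureTheory Finset

noncomputable section

/-- Euclidean norm of a complex vector. -/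
def l2norm {n : ℕ} (x : Fin n → ℂ) : ℝ := Real.sqrt (∑ i, ‖x i‖ ^ 2)

/-- Matrix-vector multiplication. -/
def mvec {n d : ℕ} (A : Fin n → Fin d → ℂ) (x : Fin d → ℂ) : Fin n → ℂ :=
  fun r => ∑ j, A r j * x j

/-- `Tset d k` : set of `k`-sparse complex vectors of Euclidean norm at most 1. -/
def Tset (d k : ℕ) : Set (Fin d → ℂ) :=
  {x | (Finset.univ.filter fun i => x i ≠ 0).card ≤ k ∧ l2norm x ≤ 1}

/-- The bijection h(b,i) = B(b-1)+i (0-indexed: b*B+i). -/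
def hIdx (m B : ℕ) (b : Fin m) (i : Fin B) : Fin (m * B) :=
  ⟨b.1 * B + i.1, by
    have hb := b.isLt
    have hi := i.isLt
    calc b.1 * B + i.1 < b.1 * B + B := by omega
      _ = (b.1 + 1) * B := by ring
      _ ≤ m * B := Nat.mul_le_mul hb le_rfl⟩

/-- A sign in {±1} from a boolean. -/
def sgn (s : Bool) : ℝ := if s then 1 else -1

/-- The hashed construction: row b of Φ is ∑_i σ_{b,i} a_{h(b,i)}. -/
def Phi (m B d : ℕ) (A : Fin (m * B) → Fin d → ℂ) (σ : Fin m → Fin B → Bool) :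
    Fin m → Fin d → ℂ :=
  fun b j => ∑ i : Fin B, (sgn (σ b i) : ℂ) * A (hIdx m B b i) j

/-- A draw from the partial circulant ensemble: the rows of the circulant matrix `H_ε`
(whose (i,j) entry is `ε_{i-j}`, indices mod d) indexed by `Ω`, where `ε ∈ {±1}^d`. -/
def pcMatrix (M d : ℕ) (Ω : Fin M ↪ Fin d) (ε : Fin d → Bool) :
    Fin M → Fin d → ℂ :=
  fun r j => ((sgn (ε (Ω r - j)) : ℝ) : ℂ)

open scoped Matrix BigOperators

/-- Squared Euclidean norm of a real vector. -/
def nsq {ι : Type*} [Fintype ι] (v : ι → ℝ) : ℝ := ∑ i, v i ^ 2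

/-- The real vector of signs attached to a Boolean vector. -/
def sv {ι : Type*} (s : ι → Bool) : ι → ℝ := fun i => sgn (s i)

section Basic

variable {ι κ : Type*} [Fintype ι] [Fintype κ]

lemma nsq_nonneg (v : ι → ℝ) : 0 ≤ nsq v := sum_nonneg fun _ _ => sq_nonneg _

lemma nsq_eq_dotProduct (v : ι → ℝ) : nsq v = v ⬝ᵥ v := by
  simp [nsq, dotProduct, sq]

@[simp] lemma nsq_zero : nsq (0 : ι → ℝ) = 0 := by simp [nsq]

lemma nsq_neg (v : ι → ℝ) : nsq (-v) = nsq v := by simp [nsq]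

lemma nsq_smul (c : ℝ) (v : ι → ℝ) : nsq (c • v) = c ^ 2 * nsq v := by
  simp [nsq, mul_pow, mul_sum]

lemma dotProduct_sq_le (u v : ι → ℝ) : (u ⬝ᵥ v) ^ 2 ≤ nsq u * nsq v :=
  sum_mul_sq_le_sq_mul_sq _ _ _

lemma abs_dotProduct_le (u v : ι → ℝ) : |u ⬝ᵥ v| ≤ √(nsq u) * √(nsq v) := by
  rw [← Real.sqrt_mul (nsq_nonneg u)]
  exact Real.abs_le_sqrt (dotProduct_sq_le u v)

lemma nsq_add (u v : ι → ℝ) : nsq (u + v) = nsq u + 2 * (u ⬝ᵥ v) + nsq v := by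
  simp only [nsq_eq_dotProduct, dotProduct_add, add_dotProduct, dotProduct_comm v u]; ring

lemma nsq_add_le (u v : ι → ℝ) {β : ℝ} (hβ : 0 < β) :
    nsq (u + v) ≤ (1 + β) * nsq u + (1 + 1 / β) * nsq v := by
  simp only [nsq, mul_sum, ← sum_add_distrib]
  refine sum_le_sum fun i _ => ?_
  have h : 0 ≤ (β * u i - v i) ^ 2 / β := by positivity
  have h2 : (β * u i - v i) ^ 2 / β = β * u i ^ 2 - 2 * (u i * v i) + 1 / β * v i ^ 2 := by
    field_simp; ring
  simp only [Pi.add_apply]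
  nlinarith

lemma sqrt_nsq_add_le (u v : ι → ℝ) : √(nsq (u + v)) ≤ √(nsq u) + √(nsq v) := by
  rw [Real.sqrt_le_left (by positivity), nsq_add, add_sq, Real.sq_sqrt (nsq_nonneg u),
    Real.sq_sqrt (nsq_nonneg v)]
  have := (le_abs_self _).trans (abs_dotProduct_le u v)
  linarith

lemma sqrt_nsq_smul (c : ℝ) (v : ι → ℝ) : √(nsq (c • v)) = |c| * √(nsq v) := by
  rw [nsq_smul, Real.sqrt_mul (sq_nonneg c), Real.sqrt_sq_eq_abs]

lemma nsq_transpose_mulVec_le (W : Matrix κ ι ℝ) {r : ℝ}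
    (h : ∀ u, nsq (W *ᵥ u) ≤ r ^ 2 * nsq u) (w : κ → ℝ) :
    nsq (Wᵀ *ᵥ w) ≤ r ^ 2 * nsq w := by
  have h1 : nsq (Wᵀ *ᵥ w) = w ⬝ᵥ (W *ᵥ (Wᵀ *ᵥ w)) := by
    rw [Matrix.dotProduct_mulVec, ← Matrix.mulVec_transpose, nsq_eq_dotProduct]
  have h2 := dotProduct_sq_le w (W *ᵥ (Wᵀ *ᵥ w))
  rw [← h1] at h2
  have h3 := h2.trans (mul_le_mul_of_nonneg_left (h _) (nsq_nonneg w))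
  rcases (nsq_nonneg (Wᵀ *ᵥ w)).eq_or_lt with h0 | h0
  · rw [← h0]; have := nsq_nonneg w; positivity
  · nlinarith

/-- Frobenius bound on the action of a matrix. -/
lemma nsq_mulVec_le_frob (W : Matrix κ ι ℝ) (u : ι → ℝ) :
    nsq (W *ᵥ u) ≤ (∑ i, nsq (W i)) * nsq u := by
  rw [sum_mul]
  exact sum_le_sum fun i _ => dotProduct_sq_le _ _

end Basic

section Signs

variable {ι κ : Type*} [Fintype ι] [Fintype κ]

lemma sgn_sq (b : Bool) : sgn b ^ 2 = 1 := by cases b <;> simp [sgn]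

lemma sgn_not (b : Bool) : sgn (!b) = - sgn b := by cases b <;> simp [sgn]

variable [DecidableEq ι]

lemma expect_sgn_mul_sgn (i j : ι) :
    𝔼 s : ι → Bool, sgn (s i) * sgn (s j) = if i = j then 1 else 0 := by
  split_ifs with h
  · subst h
    simp [← sq, sgn_sq]
  · have key : 𝔼 s : ι → Bool, sgn (s i) * sgn (s j) =
        𝔼 s : ι → Bool, -(sgn (s i) * sgn (s j)) := by
      refine Fintype.expect_bijective (fun s => Function.update s i (!s i)) ?_ _ _ ?_
      · refine Function.Involutive.bijective fun s => ?_
        ext a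
        by_cases ha : a = i
        · subst ha; simp
        · simp [ha]
      · intro s
        simp [Function.update_of_ne (Ne.symm h), sgn_not]
    rw [expect_neg_distrib] at key
    linarith

lemma expect_nsq_mulVec_sv (W : Matrix κ ι ℝ) :
    𝔼 s : ι → Bool, nsq (W *ᵥ sv s) = ∑ i, nsq (W i) := by
  simp only [nsq]
  rw [expect_sum_comm]
  refine sum_congr rfl fun i _ => ?_
  have : ∀ s : ι → Bool, (W *ᵥ sv s) i ^ 2 =
      ∑ a, ∑ b, W i a * W i b * (sgn (s a) * sgn (s b)) := by
    intro s
    simp only [Matrix.mulVec, dotProduct, sq, sum_mul_sum, sv]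
    exact sum_congr rfl fun a _ => sum_congr rfl fun b _ => by ring
  simp only [this]
  rw [expect_sum_comm]
  simp only [expect_sum_comm, ← mul_expect, expect_sgn_mul_sgn]
  simp [sq]

lemma expect_exp_dotProduct_sv_le (a : ι → ℝ) :
    𝔼 s : ι → Bool, Real.exp (a ⬝ᵥ sv s) ≤ Real.exp (nsq a / 2) := by
  have h1 : ∑ s : ι → Bool, Real.exp (a ⬝ᵥ sv s) = ∏ i, (2 * Real.cosh (a i)) := by
    have h := prod_univ_sum (fun _ : ι => (univ : Finset Bool))
      (fun i b => Real.exp (a i * sgn b))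
    rw [Fintype.piFinset_univ] at h
    simp only [dotProduct, sv, Real.exp_sum]
    rw [← h]
    refine prod_congr rfl fun i _ => ?_
    simp [sgn, Real.cosh_eq]; ring
  rw [Fintype.expect_eq_sum_div_card, h1, prod_mul_distrib]
  have h2 : ∏ i, Real.cosh (a i) ≤ Real.exp (nsq a / 2) := by
    rw [nsq, sum_div, Real.exp_sum]
    exact prod_le_prod (fun i _ => (Real.cosh_pos _).le) fun i _ => Real.cosh_le_exp_half_sq _
  have h3 : (Fintype.card (ι → Bool) : ℝ) = ∏ _i : ι, (2 : ℝ) := by simp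
  rw [h3, mul_div_cancel_left₀ _ (by positivity)]
  exact h2

/-- Massart's finite class lemma, for a random choice of a linear form from a finite family. -/
lemma expect_abs_dotProduct_sv_le {τ : Type*} (L : Finset τ) (a : τ → ι → ℝ) {ρ e : ℝ}
    (hρ : 0 ≤ ρ) (ha : ∀ l ∈ L, nsq (a l) ≤ ρ ^ 2) (he : Real.log (2 * #L) ≤ e)
    (t : (ι → Bool) → τ) (ht : ∀ s, t s ∈ L) :
    𝔼 s : ι → Bool, |a (t s) ⬝ᵥ sv s| ≤ √(2 * e) * ρ := by
  have hL : (1 : ℝ) ≤ #L := by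
    exact_mod_cast card_pos.2 ⟨t fun _ => true, ht _⟩
  have he0 : 0 < e := lt_of_lt_of_le (Real.log_pos (by linarith)) he
  set μ := 𝔼 s : ι → Bool, |a (t s) ⬝ᵥ sv s| with hμ
  have key : ∀ c : ℝ, 0 < c → c * μ ≤ e + c ^ 2 * ρ ^ 2 / 2 := by
    intro c hc
    have hJ : Real.exp (c * μ) ≤ 𝔼 s : ι → Bool, Real.exp (c * |a (t s) ⬝ᵥ sv s|) := by
      have h1 : 𝔼 s : ι → Bool, Real.exp (c * μ) * (1 + c * |a (t s) ⬝ᵥ sv s| - c * μ) =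
          Real.exp (c * μ) := by
        rw [← mul_expect, expect_sub_distrib, expect_add_distrib, ← mul_expect, ← hμ]
        simp
      rw [← h1]
      refine expect_le_expect fun s _ => ?_
      have h2 := Real.add_one_le_exp (c * |a (t s) ⬝ᵥ sv s| - c * μ)
      calc _ ≤ Real.exp (c * μ) * Real.exp (c * |a (t s) ⬝ᵥ sv s| - c * μ) := by
            gcongr; linarith
        _ = _ := by rw [← Real.exp_add]; ring_nf
    have hU : 𝔼 s : ι → Bool, Real.exp (c * |a (t s) ⬝ᵥ sv s|) ≤
        (2 * #L) * Real.exp (c ^ 2 * ρ ^ 2 / 2) := by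
      calc _ ≤ 𝔼 s : ι → Bool, ∑ l ∈ L,
            (Real.exp ((c • a l) ⬝ᵥ sv s) + Real.exp ((-c • a l) ⬝ᵥ sv s)) := by
            refine expect_le_expect fun s _ => ?_
            refine le_trans ?_ (single_le_sum (f := fun l =>
              Real.exp ((c • a l) ⬝ᵥ sv s) + Real.exp ((-c • a l) ⬝ᵥ sv s))
              (fun l _ => by positivity) (ht s))
            simp only [smul_dotProduct, smul_eq_mul]
            rcases abs_cases (a (t s) ⬝ᵥ sv s) with ⟨h, _⟩ | ⟨h, _⟩ <;> rw [h]
            · linarith [Real.exp_pos (-c * a (t s) ⬝ᵥ sv s)]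
            · rw [mul_neg, ← neg_mul]
              linarith [Real.exp_pos (c * a (t s) ⬝ᵥ sv s)]
        _ ≤ ∑ l ∈ L, (Real.exp (c ^ 2 * ρ ^ 2 / 2) + Real.exp (c ^ 2 * ρ ^ 2 / 2)) := by
            rw [expect_sum_comm]
            refine sum_le_sum fun l hl => ?_
            rw [expect_add_distrib]
            have hl' := ha l hl
            refine add_le_add ((expect_exp_dotProduct_sv_le _).trans ?_)
              ((expect_exp_dotProduct_sv_le _).trans ?_)
            · rw [nsq_smul]; gcongr
            · rw [nsq_smul, neg_sq]; gcongr
        _ = _ := by rw [sum_const, nsmul_eq_mul]; ring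
    have := Real.log_le_log (Real.exp_pos _) (hJ.trans hU)
    rw [Real.log_exp, Real.log_mul (by positivity) (Real.exp_pos _).ne', Real.log_exp] at this
    linarith
  rcases hρ.eq_or_lt with h0 | h0
  · subst h0
    have hz : ∀ l ∈ L, a l = 0 := by
      intro l hl
      have := ha l hl
      have h1 : nsq (a l) = 0 := le_antisymm (by simpa using this) (nsq_nonneg _)
      rw [nsq, sum_eq_zero_iff_of_nonneg fun _ _ => sq_nonneg _] at h1
      ext i
      simpa using h1 i (mem_univ i)
    rw [hμ]
    simp [hz _ (ht _)]
  · have hs : 0 < √(2 * e) := Real.sqrt_pos.2 (by linarith)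
    have h := key (√(2 * e) / ρ) (by positivity)
    rw [div_pow, Real.sq_sqrt (by linarith), div_mul_cancel₀ _ (by positivity)] at h
    have h2 : √(2 * e) / ρ * μ ≤ √(2 * e) * √(2 * e) := by
      rw [Real.mul_self_sqrt (by linarith)]; linarith
    rw [div_mul_eq_mul_div, mul_div_assoc] at h2
    have h3 := le_of_mul_le_mul_left h2 hs
    rwa [div_le_iff₀ h0] at h3

end Signs

section Chaos

variable {ι κ T : Type*}

/-- The sign vector of `s` restricted to the coordinates selected by `I`. -/
def msk (I s : ι → Bool) : ι → ℝ := fun j => if I j then sgn (s j) else 0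

/-- Complementary selection. -/
def compl' (I : ι → Bool) : ι → Bool := fun j => !I j

/-- The sign pattern equal to `s` on `I` and to `s'` off `I`. -/
def mix (I s s' : ι → Bool) : ι → Bool := fun j => if I j then s j else s' j

lemma mix_compl (I s s' : ι → Bool) : mix (compl' I) s' s = mix I s s' := by
  ext j; by_cases h : I j <;> simp [mix, compl', h]

lemma sv_mix (I s s' : ι → Bool) : sv (mix I s s') = msk I s + msk (compl' I) s' := by
  ext j; by_cases h : I j <;> simp [mix, compl', sv, msk, h]

lemma sv_mix_not (I s : ι → Bool) :
    sv (mix I s fun j => !s j) = msk I s - msk (compl' I) s := by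
  ext j; by_cases h : I j <;> simp [mix, compl', sv, msk, h, sgn_not]

lemma msk_not (I s : ι → Bool) : msk I (fun j => !s j) = -msk I s := by
  ext j; simp only [msk, Pi.neg_apply]; cases I j <;> simp [sgn_not]

variable [Fintype ι] [Fintype κ]

lemma nsq_polar (W : Matrix κ ι ℝ) (a b : ι → ℝ) :
    nsq (W *ᵥ (a + b)) - nsq (W *ᵥ (a - b)) = 4 * ((W *ᵥ a) ⬝ᵥ (W *ᵥ b)) := by
  rw [Matrix.mulVec_add, Matrix.mulVec_sub, sub_eq_add_neg (W *ᵥ a) (W *ᵥ b),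
    nsq_add, nsq_add, nsq_neg, dotProduct_neg]
  ring

variable [DecidableEq ι]

lemma expect_mix (I : ι → Bool) (f : (ι → Bool) → ℝ) :
    𝔼 s' : ι → Bool, 𝔼 s : ι → Bool, f (mix I s s') = 𝔼 s : ι → Bool, f s := by
  have h1 : 𝔼 p : (ι → Bool) × (ι → Bool), f (mix I p.2 p.1) =
      𝔼 p : (ι → Bool) × (ι → Bool), f p.2 := by
    refine Fintype.expect_bijective (fun p => (mix I p.1 p.2, mix I p.2 p.1)) ?_ _ _
      fun _ => rfl
    refine Function.Involutive.bijective fun p => ?_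
    ext j <;> simp only [mix] <;> cases I j <;> simp
  have h2 := expect_product (univ : Finset (ι → Bool)) (univ : Finset (ι → Bool))
    (fun p => f (mix I p.2 p.1))
  have h3 := expect_product (univ : Finset (ι → Bool)) (univ : Finset (ι → Bool))
    (fun p => f p.2)
  rw [univ_product_univ] at h2 h3
  rw [← h2, h1, h3]
  simp

lemma expect_comp_not (f : (ι → Bool) → ℝ) :
    𝔼 s : ι → Bool, f (fun j => !s j) = 𝔼 s : ι → Bool, f s := by
  refine Fintype.expect_bijective (fun s j => !s j) ?_ _ _ fun _ => rfl
  exact Function.Involutive.bijective fun s => by ext; simp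

lemma expect_mix_not (W : Matrix κ ι ℝ) (s : ι → Bool) :
    𝔼 I : ι → Bool, nsq (W *ᵥ sv (mix I s fun j => !s j)) = ∑ i, nsq (W i) := by
  rw [← expect_nsq_mulVec_sv]
  refine Fintype.expect_bijective (fun I => mix I s fun j => !s j) ?_ _ _ fun _ => rfl
  refine Function.Involutive.bijective fun I => ?_
  ext j
  simp only [mix]
  cases I j <;> cases s j <;> simp

lemma nsq_msk_le_expect (W : Matrix κ ι ℝ) (I s' : ι → Bool) :
    nsq (W *ᵥ msk (compl' I) s') ≤ 𝔼 s : ι → Bool, nsq (W *ᵥ sv (mix I s s')) := by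
  have h1 := expect_comp_not fun s => nsq (W *ᵥ sv (mix I s s'))
  have h2 : 𝔼 _s : ι → Bool, 2 * nsq (W *ᵥ msk (compl' I) s') ≤ 𝔼 s : ι → Bool,
      (nsq (W *ᵥ sv (mix I (fun j => !s j) s')) + nsq (W *ᵥ sv (mix I s s'))) := by
    refine expect_le_expect fun s _ => ?_
    rw [sv_mix, sv_mix, msk_not, Matrix.mulVec_add, Matrix.mulVec_add, Matrix.mulVec_neg,
      nsq_add, nsq_add, nsq_neg, neg_dotProduct]
    linarith [nsq_nonneg (W *ᵥ msk I s)]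
  rw [expect_add_distrib, h1, Fintype.expect_const] at h2
  linarith

lemma expect_bilinear_le {τ : Type*} (L : Finset τ) (W U : τ → Matrix κ ι ℝ) {r M e : ℝ}
    (hr : 0 ≤ r) (hW : ∀ l ∈ L, ∀ u, nsq (W l *ᵥ u) ≤ r ^ 2 * nsq u) (b : ι → ℝ)
    (hU : ∀ l ∈ L, nsq (U l *ᵥ b) ≤ M) (hM : 0 ≤ M) (he : Real.log (2 * #L) ≤ e)
    (I : ι → Bool) (t : (ι → Bool) → τ) (ht : ∀ s, t s ∈ L) :
    𝔼 s : ι → Bool, |(W (t s) *ᵥ msk I s) ⬝ᵥ (U (t s) *ᵥ b)| ≤ √(2 * e) * (r * √M) := by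
  let a : τ → ι → ℝ := fun l j => if I j then ((W l)ᵀ *ᵥ (U l *ᵥ b)) j else 0
  have h := expect_abs_dotProduct_sv_le L a (mul_nonneg hr (Real.sqrt_nonneg M))
    (fun l hl => ?_) he t ht
  · refine le_trans (le_of_eq ?_) h
    refine expect_congr rfl fun s _ => ?_
    rw [dotProduct_comm, Matrix.dotProduct_mulVec, ← Matrix.mulVec_transpose]
    congr 1
    refine sum_congr rfl fun j _ => ?_
    simp only [a, msk, sv]
    split_ifs <;> simp
  · rw [mul_pow, Real.sq_sqrt hM]
    calc nsq (a l) ≤ nsq ((W l)ᵀ *ᵥ (U l *ᵥ b)) := by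
          refine sum_le_sum fun j _ => ?_
          simp only [a]
          split_ifs
          · exact le_rfl
          · simpa using sq_nonneg _
      _ ≤ r ^ 2 * nsq (U l *ᵥ b) := nsq_transpose_mulVec_le _ (hW l hl) _
      _ ≤ r ^ 2 * M := by gcongr; exact hU l hl

lemma expect_sqrt_le {α : Type*} [Fintype α] [Nonempty α] (f : α → ℝ) (hf : ∀ x, 0 ≤ f x) :
    𝔼 x, √(f x) ≤ √(𝔼 x, f x) := by
  refine Real.le_sqrt_of_sq_le ?_
  have h := expect_mul_sq_le_sq_mul_sq (univ : Finset α) (fun x => √(f x)) (fun _ => (1 : ℝ))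
  simpa [Real.sq_sqrt (hf _)] using h

variable [Fintype T] [DecidableEq T]

lemma expect_link_le (V : T → Matrix κ ι ℝ) (N : (ι → Bool) → ℝ)
    (hN : ∀ x s, nsq (V x *ᵥ sv s) ≤ N s) (f : T → T × T) (c : T × T → T)
    {r e : ℝ} (hr : 0 ≤ r)
    (hW : ∀ x u, nsq ((V (f x).1 - V (f x).2) *ᵥ u) ≤ r ^ 2 * nsq u)
    (he : Real.log (2 * #(univ.image f)) ≤ e)
    (I : ι → Bool) (t : (ι → Bool) → T) :
    𝔼 s' : ι → Bool, 𝔼 s : ι → Bool,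
      |((V (f (t (mix I s s'))).1 - V (f (t (mix I s s'))).2) *ᵥ msk I s) ⬝ᵥ
        (V (c (f (t (mix I s s')))) *ᵥ msk (compl' I) s')| ≤
      √(2 * e) * r * √(𝔼 s, N s) := by
  set M : (ι → Bool) → ℝ := fun s' => 𝔼 s : ι → Bool, N (mix I s s') with hMdef
  have hN0 : ∀ s, 0 ≤ N s := fun s => (nsq_nonneg _).trans (hN (t s) s)
  have hM0 : ∀ s', 0 ≤ M s' := fun s' => expect_nonneg fun _ _ => hN0 _
  have hM : ∀ x s', nsq (V x *ᵥ msk (compl' I) s') ≤ M s' := fun x s' =>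
    (nsq_msk_le_expect _ _ _).trans (expect_le_expect fun _ _ => hN _ _)
  calc _ ≤ 𝔼 s' : ι → Bool, √(2 * e) * (r * √(M s')) := by
        refine expect_le_expect fun s' _ => ?_
        refine expect_bilinear_le (univ.image f) (fun l => V l.1 - V l.2) (fun l => V (c l)) hr
          ?_ (msk (compl' I) s') (fun l _ => hM _ _) (hM0 s') he I
          (fun s => f (t (mix I s s'))) fun s => mem_image_of_mem _ (mem_univ _)
        intro l hl u
        obtain ⟨x, -, rfl⟩ := mem_image.1 hl
        exact hW x u
    _ = √(2 * e) * r * 𝔼 s', √(M s') := by rw [← mul_expect, ← mul_expect]; ring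
    _ ≤ √(2 * e) * r * √(𝔼 s', M s') := by
        gcongr
        exact expect_sqrt_le _ hM0
    _ = _ := by rw [hMdef, expect_mix]

lemma expect_decoupled_le (V : T → Matrix κ ι ℝ) (N : (ι → Bool) → ℝ)
    (hN : ∀ x s, nsq (V x *ᵥ sv s) ≤ N s) (π : ℕ → T → T) (L : ℕ) (hL : ∀ x, π L x = x)
    (h0 : ∀ x, V (π 0 x) = 0) (e r : ℕ → ℝ) (hr : ∀ n, 0 ≤ r n)
    (he : ∀ n < L, Real.log (2 * #(univ.image fun x => (π (n + 1) x, π n x))) ≤ e n)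
    (hV : ∀ n < L, ∀ x u, nsq ((V (π (n + 1) x) - V (π n x)) *ᵥ u) ≤ r n ^ 2 * nsq u)
    (I : ι → Bool) (t : (ι → Bool) → T) :
    𝔼 s : ι → Bool, |(V (t s) *ᵥ msk I s) ⬝ᵥ (V (t s) *ᵥ msk (compl' I) s)| ≤
      2 * (∑ n ∈ range L, √(2 * e n) * r n) * √(𝔼 s, N s) := by
  have hmI : ∀ s s' : ι → Bool, msk I (mix I s s') = msk I s := by
    intro s s'; ext j; simp only [msk, mix]; cases I j <;> simp
  have hmI' : ∀ s s' : ι → Bool, msk (compl' I) (mix I s s') = msk (compl' I) s' := by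
    intro s s'; ext j; by_cases h : I j <;> simp [msk, mix, compl', h]
  rw [← expect_mix I]
  simp only [hmI, hmI']
  have htel : ∀ (x : T) (a b : ι → ℝ), |(V x *ᵥ a) ⬝ᵥ (V x *ᵥ b)| ≤
      ∑ n ∈ range L, (|((V (π (n + 1) x) - V (π n x)) *ᵥ a) ⬝ᵥ (V (π (n + 1) x) *ᵥ b)| +
        |((V (π (n + 1) x) - V (π n x)) *ᵥ b) ⬝ᵥ (V (π n x) *ᵥ a)|) := by
    intro x a b
    have h := sum_range_sub (fun n => (V (π n x) *ᵥ a) ⬝ᵥ (V (π n x) *ᵥ b)) L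
    simp only [h0, hL, Matrix.zero_mulVec, zero_dotProduct, sub_zero] at h
    rw [← h]
    refine (abs_sum_le_sum_abs _ _).trans (sum_le_sum fun n _ => ?_)
    refine le_trans (le_of_eq ?_) (abs_add_le _ _)
    congr 1
    simp only [Matrix.sub_mulVec, sub_dotProduct]
    rw [dotProduct_comm (V (π (n + 1) x) *ᵥ b) (V (π n x) *ᵥ a),
      dotProduct_comm (V (π n x) *ᵥ b) (V (π n x) *ᵥ a)]
    ring
  calc _ ≤ 𝔼 s' : ι → Bool, 𝔼 s : ι → Bool, ∑ n ∈ range L,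
        (|((V (π (n + 1) (t (mix I s s'))) - V (π n (t (mix I s s')))) *ᵥ msk I s) ⬝ᵥ
            (V (π (n + 1) (t (mix I s s'))) *ᵥ msk (compl' I) s')| +
        |((V (π (n + 1) (t (mix I s s'))) - V (π n (t (mix I s s')))) *ᵥ msk (compl' I) s') ⬝ᵥ
            (V (π n (t (mix I s s'))) *ᵥ msk I s)|) :=
        expect_le_expect fun s' _ => expect_le_expect fun s _ => htel _ _ _
    _ ≤ ∑ n ∈ range L, (√(2 * e n) * r n * √(𝔼 s, N s) + √(2 * e n) * r n * √(𝔼 s, N s)) := by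
        simp only [expect_sum_comm, expect_add_distrib]
        refine sum_le_sum fun n hn => ?_
        have hn' := mem_range.1 hn
        refine add_le_add ?_ ?_
        · exact expect_link_le V N hN (fun x => (π (n + 1) x, π n x)) Prod.fst (hr n)
            (hV n hn') (he n hn') I t
        · rw [expect_comm]
          have := expect_link_le V N hN (fun x => (π (n + 1) x, π n x)) Prod.snd (hr n)
            (hV n hn') (he n hn') (compl' I) t
          have hcc : compl' (compl' I) = I := by ext; simp [compl']
          simpa only [mix_compl, hcc] using this
    _ = _ := by rw [mul_sum, sum_mul]; exact sum_congr rfl fun n _ => by ring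

/-- Chaining bound for the suprema of a second-order Rademacher chaos `‖V_x s‖²`. -/
theorem expect_chaos_le (V : T → Matrix κ ι ℝ) {F : ℝ} (hF : ∀ x, ∑ i, nsq (V x i) ≤ F)
    (π : ℕ → T → T) (L : ℕ) (hL : ∀ x, π L x = x)
    (h0 : ∀ x, V (π 0 x) = 0) (e r : ℕ → ℝ) (hr : ∀ n, 0 ≤ r n)
    (he : ∀ n < L, Real.log (2 * #(univ.image fun x => (π (n + 1) x, π n x))) ≤ e n)
    (hV : ∀ n < L, ∀ x u, nsq ((V (π (n + 1) x) - V (π n x)) *ᵥ u) ≤ r n ^ 2 * nsq u)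
    {γ : ℝ} (hγ : ∑ n ∈ range L, √(2 * e n) * r n ≤ γ) (t : (ι → Bool) → T) :
    𝔼 s : ι → Bool, |nsq (V (t s) *ᵥ sv s) - ∑ i, nsq (V (t s) i)| ≤
        8 * γ * √(2 * F + 64 * γ ^ 2) ∧
      𝔼 s : ι → Bool, nsq (V (t s) *ᵥ sv s) ≤ 2 * F + 64 * γ ^ 2 := by
  have hT : Nonempty T := ⟨t fun _ => true⟩
  have hmax : ∀ s : ι → Bool, ∃ x, ∀ y, nsq (V y *ᵥ sv s) ≤ nsq (V x *ᵥ sv s) := fun s =>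
    Finite.exists_max _
  choose tm htm using hmax
  set N : (ι → Bool) → ℝ := fun s => nsq (V (tm s) *ᵥ sv s) with hNdef
  set X := 𝔼 s, N s with hX
  have hX0 : 0 ≤ X := expect_nonneg fun _ _ => nsq_nonneg _
  have hγ0 : 0 ≤ γ := le_trans
    (sum_nonneg fun n _ => mul_nonneg (Real.sqrt_nonneg _) (hr n)) hγ
  have key : ∀ t : (ι → Bool) → T,
      𝔼 s : ι → Bool, |nsq (V (t s) *ᵥ sv s) - ∑ i, nsq (V (t s) i)| ≤ 8 * γ * √X := by
    intro t
    calc _ ≤ 𝔼 s : ι → Bool, 𝔼 I : ι → Bool,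
          4 * |(V (t s) *ᵥ msk I s) ⬝ᵥ (V (t s) *ᵥ msk (compl' I) s)| := by
          refine expect_le_expect fun s _ => ?_
          have h1 : nsq (V (t s) *ᵥ sv s) - ∑ i, nsq (V (t s) i) = 𝔼 I : ι → Bool,
              4 * ((V (t s) *ᵥ msk I s) ⬝ᵥ (V (t s) *ᵥ msk (compl' I) s)) := by
            rw [← expect_mix_not (V (t s)) s]
            have h2 : nsq (V (t s) *ᵥ sv s) = 𝔼 _I : ι → Bool, nsq (V (t s) *ᵥ sv s) := by
              simp
            rw [h2, ← expect_sub_distrib]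
            refine expect_congr rfl fun I _ => ?_
            rw [← nsq_polar, ← sv_mix_not, ← sv_mix]
            congr 4
            ext j; simp [mix]
          rw [h1]
          refine (abs_expect_le _ _).trans (le_of_eq ?_)
          exact expect_congr rfl fun I _ => by rw [abs_mul]; simp
      _ ≤ 𝔼 _I : ι → Bool, 4 * (2 * γ * √X) := by
          rw [expect_comm]
          refine expect_le_expect fun I _ => ?_
          rw [← mul_expect]
          have h := expect_decoupled_le V N (fun x s => htm s x) π L hL h0 e r hr he hV I t
          have : 2 * (∑ n ∈ range L, √(2 * e n) * r n) * √X ≤ 2 * γ * √X := by gcongr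
          linarith
      _ = _ := by rw [Fintype.expect_const]; ring
  have hXle : X ≤ 2 * F + 64 * γ ^ 2 := by
    have h1 : X ≤ 𝔼 s : ι → Bool,
        (|nsq (V (tm s) *ᵥ sv s) - ∑ i, nsq (V (tm s) i)| + F) := by
      refine expect_le_expect fun s _ => ?_
      have := le_abs_self (nsq (V (tm s) *ᵥ sv s) - ∑ i, nsq (V (tm s) i))
      have := hF (tm s)
      simp only [hNdef]
      linarith
    rw [expect_add_distrib, Fintype.expect_const] at h1
    have h2 := key tm
    have h3 := Real.sq_sqrt hX0
    nlinarith [sq_nonneg (√X - 8 * γ)]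
  refine ⟨(key t).trans ?_, le_trans (expect_le_expect fun s _ => htm s (t s)) hXle⟩
  gcongr

end Chaos

section Family

variable {ι κ T : Type*} [Fintype ι] [Fintype κ] [DecidableEq ι] [Fintype T]

/-- The single-scale case: a finite family of matrices of bounded operator norm. -/
theorem expect_family_le (V : T → Matrix κ ι ℝ) {F r : ℝ} (hF : ∀ x, ∑ i, nsq (V x i) ≤ F)
    (hF0 : 0 ≤ F) (hr : 0 ≤ r) (hV : ∀ x u, nsq (V x *ᵥ u) ≤ r ^ 2 * nsq u)
    (t : (ι → Bool) → T) :
    𝔼 s : ι → Bool, nsq (V (t s) *ᵥ sv s) ≤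
      2 * F + 128 * Real.log (2 * (Fintype.card T + 1)) * r ^ 2 := by
  classical
  let V' : Option T → Matrix κ ι ℝ := fun x => x.elim 0 V
  let π : ℕ → Option T → Option T := fun n x => if n = 0 then none else x
  have hlog : 0 ≤ Real.log (2 * (Fintype.card T + 1)) :=
    Real.log_nonneg (by have : (0 : ℝ) ≤ Fintype.card T := by positivity
                        linarith)
  have h := (expect_chaos_le V' (F := F) ?_ π 1 (fun x => by simp [π]) (fun x => by simp [π, V'])
    (fun _ => Real.log (2 * (Fintype.card T + 1))) (fun _ => r) (fun _ => hr) ?_ ?_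
    (γ := √(2 * Real.log (2 * (Fintype.card T + 1))) * r) (by simp) (fun s => some (t s))).2
  · rw [mul_pow, Real.sq_sqrt (by positivity)] at h
    simp only [V', Option.elim] at h
    linarith
  · intro x
    cases x with
    | none => simpa [V', nsq] using hF0
    | some x => exact hF x
  · intro n hn
    obtain rfl : n = 0 := by omega
    have h1 : #(univ.image fun x => (π (0 + 1) x, π 0 x)) ≤ Fintype.card (Option T) :=
      card_image_le
    rw [Fintype.card_option] at h1
    have h2 : (0 : ℝ) < #(univ.image fun x => (π (0 + 1) x, π 0 x)) := by
      exact_mod_cast card_pos.2 ⟨_, mem_image_of_mem _ (mem_univ none)⟩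
    refine Real.log_le_log (by positivity) ?_
    have : (#(univ.image fun x => (π (0 + 1) x, π 0 x)) : ℝ) ≤ Fintype.card T + 1 := by
      exact_mod_cast h1
    linarith
  · intro n hn x u
    obtain rfl : n = 0 := by omega
    cases x with
    | none => simpa [V', π] using mul_nonneg (sq_nonneg r) (nsq_nonneg u)
    | some x => simpa [V', π] using hV x u

/-- Markov's inequality for the uniform average. -/
lemma card_mul_le_of_expect_le {α : Type*} [Fintype α] [Nonempty α] (f : α → ℝ)
    (hf : ∀ x, 0 ≤ f x) {E c : ℝ} (hE : 0 < E) (h : 𝔼 x, f x ≤ E) (P : α → Prop)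
    [DecidablePred P] (hP : ∀ x, P x → c * E ≤ f x) :
    c * #(univ.filter P) ≤ Fintype.card α := by
  rw [Fintype.expect_eq_sum_div_card, div_le_iff₀ (by positivity)] at h
  have h1 : ∑ x ∈ univ.filter P, c * E ≤ ∑ x, f x :=
    (sum_le_sum fun x hx => hP x (mem_filter.1 hx).2).trans
      (sum_le_sum_of_subset_of_nonneg (filter_subset _ _) fun x _ _ => hf x)
  rw [sum_const, nsmul_eq_mul] at h1
  have h2 : E * (c * #(univ.filter P)) ≤ E * Fintype.card α := by linarith
  exact le_of_mul_le_mul_left h2 hE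

end Family

section Rounding

variable {ι κ J : Type*} [Fintype ι] [Fintype κ]

lemma sqrt_nsq_mulVec_le_sum (W : Matrix κ ι ℝ) {c : ℝ} (hc : 0 ≤ c) (u : ι → ℝ)
    (hu : ∀ j, |u j| ≤ c) :
    √(nsq (W *ᵥ u)) ≤ c * √((∑ i, nsq (W i)) * Fintype.card ι) := by
  have hf := nsq_mulVec_le_frob W u
  obtain ⟨f, hf0, hfe⟩ : ∃ f, 0 ≤ f ∧ f = ∑ i, nsq (W i) :=
    ⟨_, sum_nonneg fun _ _ => nsq_nonneg _, rfl⟩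
  rw [← hfe] at hf ⊢
  rw [Real.sqrt_le_left (by positivity), mul_pow, Real.sq_sqrt (by positivity)]
  have h1 : nsq u ≤ Fintype.card ι * c ^ 2 := by
    calc nsq u ≤ ∑ _j : ι, c ^ 2 := sum_le_sum fun j _ => by
          rw [← sq_abs]; exact pow_le_pow_left₀ (abs_nonneg _) (hu j) 2
      _ = _ := by simp
  calc _ ≤ f * nsq u := hf
    _ ≤ f * (Fintype.card ι * c ^ 2) := by gcongr
    _ = _ := by ring

variable [DecidableEq ι]

/-- A sign vector restricted to a finite set of coordinates. -/
def signOn (O : Finset ι) (s : ι → Bool) : ι → ℝ := fun j => if j ∈ O then sgn (s j) else 0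

lemma exists_even_perturbation (A : J → Matrix κ ι ℝ) {k : ℕ} {Y : ℝ} (w : ι → ℤ)
    (hA : ∃ s : ι → Bool, ∀ b, nsq (A b *ᵥ signOn (univ.filter fun j => Odd (w j)) s) ≤ Y)
    (hk : #(univ.filter fun j => w j ≠ 0) ≤ k) :
    ∃ v : ι → ℤ, 2 * ∑ j, |v j| ≤ ∑ j, |w j| ∧ #(univ.filter fun j => v j ≠ 0) ≤ k ∧
      ∀ b, nsq (A b *ᵥ fun j => 2 * (v j : ℝ) - w j) ≤ Y := by
  set O := univ.filter fun j => Odd (w j) with hO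
  obtain ⟨s, hs⟩ := hA
  let si : Bool → ℤ := fun b => if b then 1 else -1
  have hsi : ∀ b, (si b : ℝ) = sgn b := by intro b; cases b <;> simp [si, sgn]
  obtain ⟨c, hc, hsum⟩ : ∃ c : ℤ, (c = 1 ∨ c = -1) ∧
      ∑ j ∈ O, c * si (s j) * (w j).sign ≤ 0 := by
    rcases le_total (∑ j ∈ O, si (s j) * (w j).sign) 0 with h | h
    · exact ⟨1, Or.inl rfl, by simpa using h⟩
    · exact ⟨-1, Or.inr rfl, by simpa using h⟩
  let w' : ι → ℤ := fun j => w j + if j ∈ O then c * si (s j) else 0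
  have hsi1 : ∀ b, si b = 1 ∨ si b = -1 := by intro b; cases b <;> simp [si]
  have heven : ∀ j, ∃ v, w' j = 2 * v := by
    intro j
    have : Even (w' j) := by
      simp only [w']
      by_cases hj : j ∈ O
      · rw [if_pos hj]
        refine Odd.add_odd (mem_filter.1 hj).2 ?_
        rcases hc with h | h <;> rcases hsi1 (s j) with h' | h' <;> rw [h, h'] <;> decide
      · rw [if_neg hj, add_zero]
        simpa [hO] using hj
    exact this.two_dvd
  choose v hv using heven
  have habs : ∀ j, |w' j| = |w j| + if j ∈ O then c * si (s j) * (w j).sign else 0 := by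
    intro j
    simp only [w']
    by_cases hj : j ∈ O
    · rw [if_pos hj, if_pos hj]
      have hodd := (mem_filter.1 hj).2
      have hne : w j ≠ 0 := by rintro h; rw [h] at hodd; exact absurd hodd (by decide)
      have hx : c * si (s j) = 1 ∨ c * si (s j) = -1 := by
        rcases hc with h | h <;> rcases hsi1 (s j) with h' | h' <;> rw [h, h'] <;> simp
      rcases lt_or_gt_of_ne hne with h | h
      · rw [Int.sign_eq_neg_one_of_neg h, abs_of_neg h]
        rcases hx with h' | h' <;> rw [h'] <;> rw [abs_of_nonpos (by omega)] <;> ring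
      · rw [Int.sign_eq_one_of_pos h, abs_of_pos h]
        rcases hx with h' | h' <;> rw [h'] <;> rw [abs_of_nonneg (by omega)] <;> ring
    · rw [if_neg hj, if_neg hj]; simp
  refine ⟨v, ?_, ?_, ?_⟩
  · have h1 : ∑ j, |w' j| = 2 * ∑ j, |v j| := by
      rw [mul_sum]; exact sum_congr rfl fun j _ => by rw [hv, abs_mul]; simp
    rw [← h1]
    simp only [habs, sum_add_distrib]
    rw [sum_ite_mem, univ_inter]
    linarith
  · refine (card_le_card fun j hj => ?_).trans hk
    rw [mem_filter] at hj ⊢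
    refine ⟨mem_univ _, fun h0 => hj.2 ?_⟩
    have h2 := habs j
    have hjO : j ∉ O := by
      intro hjO
      have hodd := (mem_filter.1 hjO).2
      rw [h0] at hodd
      exact absurd hodd (by decide)
    rw [if_neg hjO, h0, hv] at h2
    simpa using h2
  · intro b
    have h1 : (fun j => 2 * (v j : ℝ) - w j) = (c : ℝ) • signOn O s := by
      ext j
      have : (w' j : ℝ) = 2 * v j := by rw [hv]; push_cast; ring
      rw [← this]
      simp only [w', signOn, Pi.smul_apply, smul_eq_mul]
      split_ifs <;> push_cast <;> simp [hsi]
    rw [h1, Matrix.mulVec_smul, nsq_smul]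
    have : (c : ℝ) ^ 2 = 1 := by rcases hc with h | h <;> rw [h] <;> norm_num
    rw [this, one_mul]
    exact hs b

lemma exists_round_dyadic (A : J → Matrix κ ι ℝ) {K : ℝ} (hK : 0 ≤ K) (k p l : ℕ)
    (hp : p ≤ min k l)
    (hA : ∀ O : Finset ι, #O ≤ k → ∃ s : ι → Bool, ∀ b,
      nsq (A b *ᵥ signOn O s) ≤ K ^ 2 * (#O + p)) (Q : ℕ) :
    ∀ w : ι → ℤ, ∑ j, |w j| ≤ l * 2 ^ Q → #(univ.filter fun j => w j ≠ 0) ≤ k →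
      ∃ z : ι → ℤ, ∑ j, |z j| ≤ l ∧ ∀ b,
        √(nsq (A b *ᵥ fun j => (z j : ℝ) - w j / 2 ^ Q)) ≤
          3 * (√2 * K * √(min k l : ℕ)) * (1 - (3 / 4) ^ Q) := by
  induction Q with
  | zero =>
    intro w hw _
    refine ⟨w, by simpa using hw, fun b => ?_⟩
    have : (fun j => (w j : ℝ) - w j / 2 ^ 0) = 0 := by ext; simp
    rw [this]
    simp
  | succ Q ih =>
    intro w hw hk
    set O := univ.filter fun j => Odd (w j) with hO
    have hOw : O ⊆ univ.filter fun j => w j ≠ 0 := by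
      intro j hj
      rw [mem_filter] at hj ⊢
      refine ⟨mem_univ _, fun h0 => ?_⟩
      rw [h0] at hj
      exact absurd hj.2 (by decide)
    have hOk : #O ≤ k := (card_le_card hOw).trans hk
    have hOl : #O ≤ l * 2 ^ (Q + 1) := by
      have h1 : (#O : ℤ) ≤ ∑ j, |w j| := by
        calc (#O : ℤ) = ∑ j ∈ O, 1 := by simp
          _ ≤ ∑ j ∈ O, |w j| := sum_le_sum fun j hj =>
              Int.one_le_abs (mem_filter.1 (hOw hj)).2
          _ ≤ _ := sum_le_sum_of_subset_of_nonneg (subset_univ _) fun _ _ _ => abs_nonneg _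
      exact_mod_cast h1.trans hw
    obtain ⟨v, hv1, hv2, hv3⟩ := exists_even_perturbation A w (hA O hOk) hk
    obtain ⟨z, hz1, hz2⟩ := ih v (by
      have : (l : ℤ) * 2 ^ (Q + 1) = 2 * (l * 2 ^ Q) := by ring
      omega) hv2
    refine ⟨z, hz1, fun b => ?_⟩
    set G := √2 * K * √(min k l : ℕ) with hG
    have hG0 : 0 ≤ G := by positivity
    have h1 : (fun j => (z j : ℝ) - w j / 2 ^ (Q + 1)) =
        (fun j => (z j : ℝ) - v j / 2 ^ Q) +
          ((1 / 2 : ℝ) ^ (Q + 1)) • fun j => 2 * (v j : ℝ) - w j := by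
      ext j
      simp only [Pi.add_apply, Pi.smul_apply, smul_eq_mul, pow_succ, one_div, inv_pow]
      field_simp
      ring
    rw [h1, Matrix.mulVec_add, Matrix.mulVec_smul]
    refine (sqrt_nsq_add_le _ _).trans ?_
    rw [sqrt_nsq_smul, abs_of_nonneg (by positivity)]
    have hOm : #O ≤ min k l * 2 ^ (Q + 1) := by
      rcases min_cases k l with ⟨h, _⟩ | ⟨h, _⟩ <;> rw [h]
      · exact hOk.trans (Nat.le_mul_of_pos_right _ (by positivity))
      · exact hOl
    have hpm : p ≤ min k l * 2 ^ (Q + 1) :=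
      hp.trans (Nat.le_mul_of_pos_right _ (by positivity))
    have h2 : √(nsq (A b *ᵥ fun j => 2 * (v j : ℝ) - w j)) ≤ G * (3 / 2) ^ (Q + 1) := by
      rw [Real.sqrt_le_left (by positivity)]
      refine (hv3 b).trans ?_
      rw [hG, mul_pow, mul_pow, mul_pow, Real.sq_sqrt (by norm_num), Real.sq_sqrt (by positivity)]
      have h3 : ((#O : ℝ) + p) ≤ 2 * ((min k l : ℕ) * 2 ^ (Q + 1)) := by
        exact_mod_cast (by omega : #O + p ≤ 2 * (min k l * 2 ^ (Q + 1)))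
      have h4 : (2 : ℝ) ^ (Q + 1) ≤ ((3 / 2) ^ (Q + 1)) ^ 2 := by
        rw [← pow_mul, mul_comm, pow_mul]
        gcongr; norm_num
      calc K ^ 2 * ((#O : ℝ) + p) ≤ K ^ 2 * (2 * ((min k l : ℕ) * 2 ^ (Q + 1))) := by gcongr
        _ ≤ K ^ 2 * (2 * ((min k l : ℕ) * ((3 / 2) ^ (Q + 1)) ^ 2)) := by gcongr
        _ = _ := by ring
    have h5 : (1 / 2 : ℝ) ^ (Q + 1) * (G * (3 / 2) ^ (Q + 1)) = G * (3 / 4) ^ (Q + 1) := by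
      rw [mul_left_comm, ← mul_pow]; norm_num
    calc _ ≤ 3 * G * (1 - (3 / 4) ^ Q) + (1 / 2 : ℝ) ^ (Q + 1) * (G * (3 / 2) ^ (Q + 1)) := by
          gcongr; exact hz2 b
      _ = _ := by rw [h5, pow_succ]; ring

lemma exists_trunc (y : ℝ) : ∃ w : ℤ, |(w : ℝ)| ≤ |y| ∧ |y - w| ≤ 1 := by
  rcases le_total 0 y with h | h
  · refine ⟨⌊y⌋, ?_, ?_⟩
    · have h0 : (0 : ℝ) ≤ ⌊y⌋ := by exact_mod_cast Int.floor_nonneg.2 h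
      rw [abs_of_nonneg h0, abs_of_nonneg h]
      exact Int.floor_le y
    · rw [abs_le]
      constructor <;> linarith [Int.floor_le y, Int.lt_floor_add_one y]
  · refine ⟨⌈y⌉, ?_, ?_⟩
    · have h0 : (⌈y⌉ : ℝ) ≤ 0 := by exact_mod_cast Int.ceil_le.2 (by simpa using h)
      rw [abs_of_nonpos h0, abs_of_nonpos h]
      linarith [Int.le_ceil y]
    · rw [abs_le]
      constructor <;> linarith [Int.le_ceil y, Int.ceil_lt_add_one y]

/-- Discrepancy rounding: a real vector of small `ℓ¹` norm is close to an integer vector of small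
`ℓ¹` norm in all the seminorms `‖A b ·‖`. -/
lemma exists_round [Finite J] (A : J → Matrix κ ι ℝ) {K : ℝ} (hK : 0 < K) (k p l : ℕ)
    (hp : p ≤ min k l) (hp0 : 0 < p)
    (hA : ∀ O : Finset ι, #O ≤ k → ∃ s : ι → Bool, ∀ b,
      nsq (A b *ᵥ signOn O s) ≤ K ^ 2 * (#O + p))
    (y : ι → ℝ) (hy : ∑ j, |y j| ≤ l) (hk : #(univ.filter fun j => y j ≠ 0) ≤ k) :
    ∃ z : ι → ℤ, ∑ j, |z j| ≤ l ∧ ∀ b,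
      √(nsq (A b *ᵥ (y - fun j => (z j : ℝ)))) ≤ 4 * (√2 * K * √(min k l : ℕ)) := by
  set G := √2 * K * √(min k l : ℕ) with hG
  have hm : 0 < min k l := hp0.trans_le hp
  have hG0 : 0 < G := by positivity
  have := Fintype.ofFinite J
  set S := ∑ b, √((∑ i, nsq (A b i)) * Fintype.card ι) with hS
  have hS0 : 0 ≤ S := sum_nonneg fun _ _ => Real.sqrt_nonneg _
  obtain ⟨Q, hQ⟩ := exists_pow_lt_of_lt_one (show 0 < G / (S + 1) by positivity)
    (show (1 / 2 : ℝ) < 1 by norm_num)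
  choose w hw1 hw2 using fun j => exists_trunc (2 ^ Q * y j)
  have hwy : ∀ j, |(w j : ℝ)| ≤ 2 ^ Q * |y j| := fun j => by
    have := hw1 j
    rwa [abs_mul, abs_of_nonneg (by positivity : (0 : ℝ) ≤ 2 ^ Q)] at this
  obtain ⟨z, hz1, hz2⟩ := exists_round_dyadic A hK.le k p l hp hA Q w (by
      have : ∑ j, |(w j : ℝ)| ≤ l * 2 ^ Q := by
        calc _ ≤ ∑ j, 2 ^ Q * |y j| := sum_le_sum fun j _ => hwy j
          _ = 2 ^ Q * ∑ j, |y j| := by rw [mul_sum]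
          _ ≤ _ := by rw [mul_comm]; gcongr
      exact_mod_cast this) ((card_le_card fun j hj => by
        rw [mem_filter] at hj ⊢
        refine ⟨mem_univ _, fun h0 => hj.2 ?_⟩
        have := hwy j
        rw [h0] at this
        have h1 : |(w j : ℝ)| ≤ 0 := by simpa using this
        exact_mod_cast abs_nonpos_iff.1 h1).trans hk)
  refine ⟨z, hz1, fun b => ?_⟩
  have h1 : (y - fun j => (z j : ℝ)) = (fun j => y j - w j / 2 ^ Q) +
      (-1 : ℝ) • fun j => (z j : ℝ) - w j / 2 ^ Q := by
    ext j; simp only [Pi.sub_apply, Pi.add_apply, Pi.smul_apply, smul_eq_mul]; ring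
  rw [h1, Matrix.mulVec_add, Matrix.mulVec_smul]
  refine (sqrt_nsq_add_le _ _).trans ?_
  rw [sqrt_nsq_smul]
  have h2 : √(nsq (A b *ᵥ fun j => y j - w j / 2 ^ Q)) ≤ G := by
    refine (sqrt_nsq_mulVec_le_sum (A b) (c := (1 / 2) ^ Q) (by positivity) _ fun j => ?_).trans ?_
    · have h3 : y j - w j / 2 ^ Q = (1 / 2 : ℝ) ^ Q * (2 ^ Q * y j - w j) := by
        rw [one_div, inv_pow]; field_simp
      rw [h3, abs_mul, abs_of_nonneg (by positivity)]
      exact mul_le_of_le_one_right (by positivity) (hw2 j)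
    · have h4 : √((∑ i, nsq (A b i)) * Fintype.card ι) ≤ S + 1 := by
        exact (single_le_sum (f := fun b => √((∑ i, nsq (A b i)) * Fintype.card ι))
          (fun _ _ => Real.sqrt_nonneg _) (mem_univ b)).trans (le_add_of_nonneg_right zero_le_one)
      calc _ ≤ G / (S + 1) * (S + 1) := by gcongr
        _ = G := by field_simp
  have h5 := hz2 b
  have h6 : 0 ≤ G * (3 / 4 : ℝ) ^ Q := by positivity
  have h7 : |(-1 : ℝ)| = 1 := by norm_num
  rw [h7, one_mul]
  linarith

/-- The number of integer vectors of `ℓ¹` norm at most `n` is at most `(2d+1)^n`. -/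
lemma exists_int_ball (n : ℕ) : ∃ S : Finset (ι → ℤ), #S ≤ (2 * Fintype.card ι + 1) ^ n ∧
    ∀ z : ι → ℤ, ∑ j, |z j| ≤ n → z ∈ S := by
  classical
  induction n with
  | zero =>
    refine ⟨{0}, by simp, fun z hz => ?_⟩
    have h := (sum_eq_zero_iff_of_nonneg fun j _ => abs_nonneg (z j)).1
      (le_antisymm (by simpa using hz) (sum_nonneg fun _ _ => abs_nonneg _))
    rw [mem_singleton]
    ext j
    simpa using h j (mem_univ j)
  | succ n ih =>
    obtain ⟨S, hS, hmem⟩ := ih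
    let E : Finset (ι → ℤ) := univ.image fun o : Option (ι × Bool) =>
      o.elim 0 fun q => Pi.single q.1 (if q.2 then 1 else -1)
    have hE : #E ≤ 2 * Fintype.card ι + 1 := by
      refine card_image_le.trans ?_
      simp [mul_comm]
    refine ⟨image₂ (· + ·) S E, ?_, fun z hz => ?_⟩
    · rw [pow_succ]
      exact (card_image₂_le _ _ _).trans (Nat.mul_le_mul hS hE)
    · rw [mem_image₂]
      by_cases h : ∃ j, z j ≠ 0
      · obtain ⟨j, hj⟩ := h
        refine ⟨z - Pi.single j (z j).sign, hmem _ ?_, Pi.single j (z j).sign, ?_, by simp⟩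
        · have h1 : ∀ i, |(z - (Pi.single j (z j).sign : ι → ℤ)) i| = |z i| - if i = j then 1 else 0 := by
            intro i
            by_cases hi : i = j
            · subst hi
              simp only [Pi.sub_apply, Pi.single_eq_same, if_true]
              rcases lt_or_gt_of_ne hj with h | h
              · rw [Int.sign_eq_neg_one_of_neg h, abs_of_neg h, abs_of_nonpos (by omega)]; ring
              · rw [Int.sign_eq_one_of_pos h, abs_of_pos h, abs_of_nonneg (by omega)]
            · simp [hi]
          simp only [h1, sum_sub_distrib, sum_ite_eq', mem_univ, if_true]
          push_cast at hz
          linarith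
        · refine mem_image.2 ⟨some (j, decide (0 < z j)), mem_univ _, ?_⟩
          rcases lt_or_gt_of_ne hj with h | h
          · simp [Int.sign_eq_neg_one_of_neg h, not_lt.2 h.le]
          · simp [Int.sign_eq_one_of_pos h, h]
      · push Not at h
        refine ⟨0, hmem 0 (by simp), 0, mem_image.2 ⟨none, mem_univ _, rfl⟩, ?_⟩
        ext j; simp [h j]

end Rounding

section Chain

lemma sum_min_le (q : ℕ) : ∀ (m : ℕ) (c : ℝ), 0 ≤ c → c ≤ 2 ^ q →
    ∑ n ∈ range m, min (c / 2 ^ n) 1 ≤ q + 2 := by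
  induction q with
  | zero =>
    intro m c hc hcq
    have h : ∀ m : ℕ, ∑ n ∈ range m, c / 2 ^ n = 2 * c - 2 * c / 2 ^ m := by
      intro m
      induction m with
      | zero => simp
      | succ m ih => rw [sum_range_succ, ih, pow_succ]; field_simp; ring
    calc ∑ n ∈ range m, min (c / 2 ^ n) 1 ≤ ∑ n ∈ range m, c / 2 ^ n :=
          sum_le_sum fun n _ => min_le_left _ _
      _ = 2 * c - 2 * c / 2 ^ m := h m
      _ ≤ 2 * c := sub_le_self _ (by positivity)
      _ ≤ _ := by simp at hcq ⊢; linarith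
  | succ q ih =>
    intro m c hc hcq
    cases m with
    | zero => simp; positivity
    | succ m =>
      rw [sum_range_succ']
      have h1 := ih m (c / 2) (by positivity) (by rw [pow_succ] at hcq; linarith)
      have h2 : ∑ n ∈ range m, min (c / 2 ^ (n + 1)) 1 = ∑ n ∈ range m, min (c / 2 / 2 ^ n) 1 :=
        sum_congr rfl fun n _ => by rw [pow_succ, mul_comm, div_mul_eq_div_div]
      rw [h2]
      have h3 : min (c / 2 ^ 0) 1 ≤ (1 : ℝ) := min_le_right _ _
      push_cast
      linarith

variable {ι κ J T : Type*} [Fintype ι] [Fintype κ]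

lemma sum_abs_le_sqrt (x : ι → ℝ) (k : ℕ) (hx : #(univ.filter fun j => x j ≠ 0) ≤ k)
    (hn : nsq x ≤ 1) : ∑ j, |x j| ≤ √k := by
  apply Real.le_sqrt_of_sq_le
  have h1 : ∑ j, |x j| = ∑ j ∈ univ.filter (fun j => x j ≠ 0), |x j| := by
    rw [sum_filter]
    exact sum_congr rfl fun j _ => by by_cases h : x j = 0 <;> simp [h]
  rw [h1]
  refine sq_sum_le_card_mul_sum_sq.trans ?_
  have h2 : ∑ j ∈ univ.filter (fun j => x j ≠ 0), |x j| ^ 2 ≤ 1 :=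
    (sum_le_sum_of_subset_of_nonneg (filter_subset _ _) fun _ _ _ => by positivity).trans
      (by simpa [sq_abs, nsq] using hn)
  have h3 : ((#(univ.filter fun j => x j ≠ 0) : ℕ) : ℝ) ≤ k := by exact_mod_cast hx
  calc _ ≤ (k : ℝ) * 1 := by
        refine mul_le_mul h3 h2 (sum_nonneg fun _ _ => by positivity) (by positivity)
    _ = k := mul_one _

variable [DecidableEq ι]

/-- A net for a finite family of sparse vectors in the seminorms `‖A b ·‖`. -/
lemma exists_net [Finite J] [Fintype T] [DecidableEq T] [Nonempty T] (A : J → Matrix κ ι ℝ)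
    {K : ℝ} (hK : 0 < K) (k p l : ℕ) (hp0 : 0 < p) (hpk : p ≤ k) (hpl : p ≤ l)
    (hA : ∀ O : Finset ι, #O ≤ k → ∃ s : ι → Bool, ∀ b,
      nsq (A b *ᵥ signOn O s) ≤ K ^ 2 * (#O + p))
    (X : T → ι → ℝ) (hX : ∀ x, #(univ.filter fun j => X x j ≠ 0) ≤ k) (hX1 : ∀ x, nsq (X x) ≤ 1) :
    ∃ R : T → T, #(univ.image R) ≤ (2 * Fintype.card ι + 1) ^ l ∧ ∀ x b,
      √(nsq (A b *ᵥ (X (R x) - X x))) ≤ 12 * K * (√k / √l * min (√k / √l) 1) := by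
  have hk0 : (0 : ℝ) < k := by exact_mod_cast hp0.trans_le hpk
  have hl0 : (0 : ℝ) < l := by exact_mod_cast hp0.trans_le hpl
  have hk1 : 0 < √(k : ℝ) := Real.sqrt_pos.2 hk0
  have hl1 : 0 < √(l : ℝ) := Real.sqrt_pos.2 hl0
  have hr : ∀ x, ∃ z : ι → ℤ, ∑ j, |z j| ≤ l ∧ ∀ b,
      √(nsq (A b *ᵥ ((l / √k) • X x - fun j => (z j : ℝ)))) ≤
        4 * (√2 * K * √(min k l : ℕ)) := by
    intro x
    refine exists_round A hK k p l (le_min hpk hpl) hp0 hA _ ?_ ?_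
    · have := sum_abs_le_sqrt (X x) k (hX x) (hX1 x)
      have h2 : ∑ j, |((l / √k) • X x) j| = (l / √k) * ∑ j, |X x j| := by
        rw [mul_sum]
        refine sum_congr rfl fun j _ => ?_
        rw [Pi.smul_apply, smul_eq_mul, abs_mul, abs_of_pos (by positivity : 0 < (l / √k : ℝ))]
      rw [h2]
      calc _ ≤ (l / √k) * √k := by gcongr
        _ = _ := by field_simp
    · refine (card_le_card fun j hj => ?_).trans (hX x)
      rw [mem_filter] at hj ⊢
      exact ⟨hj.1, fun h => hj.2 (by simp [h])⟩
  choose ρ hρ1 hρ2 using hr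
  obtain ⟨S, hS, hmem⟩ := exists_int_ball (ι := ι) l
  refine ⟨fun x => Function.invFun ρ (ρ x), ?_, fun x b => ?_⟩
  · refine (card_le_card (t := S.image (Function.invFun ρ)) fun y hy => ?_).trans
      (card_image_le.trans hS)
    obtain ⟨x, -, rfl⟩ := mem_image.1 hy
    exact mem_image_of_mem _ (hmem _ (hρ1 x))
  · set x' := Function.invFun ρ (ρ x) with hx'
    have he : ρ x' = ρ x := Function.invFun_eq ⟨x, rfl⟩
    have h1 := hρ2 x b
    have h2 := hρ2 x' b
    rw [he] at h2
    have h3 : X x' - X x = (√k / l) • ((l / √k) • X x' - fun j => (ρ x j : ℝ)) +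
        (-(√k / l)) • ((l / √k) • X x - fun j => (ρ x j : ℝ)) := by
      ext j
      simp only [Pi.sub_apply, Pi.add_apply, Pi.smul_apply, smul_eq_mul]
      field_simp
      ring
    rw [h3, Matrix.mulVec_add, Matrix.mulVec_smul, Matrix.mulVec_smul]
    refine (sqrt_nsq_add_le _ _).trans ?_
    rw [sqrt_nsq_smul, sqrt_nsq_smul, abs_neg, abs_of_pos (by positivity : 0 < √k / (l : ℝ))]
    have h4 : √k / l * √(min k l : ℕ) ≤ √k / √l * min (√k / √l) 1 := by
      have h5 : (l : ℝ) = √l * √l := (Real.mul_self_sqrt hl0.le).symm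
      rw [mul_min_of_nonneg _ _ (by positivity)]
      refine le_min ?_ ?_
      · calc √k / l * √(min k l : ℕ) ≤ √k / l * √k := by
              gcongr; exact min_le_left _ _
          _ = √k / (√l * √l) * √k := by rw [← h5]
          _ = _ := by field_simp
      · calc √k / l * √(min k l : ℕ) ≤ √k / l * √l := by
              gcongr; exact min_le_right _ _
          _ = √k / (√l * √l) * √l := by rw [← h5]
          _ = _ := by field_simp
    have h6 : √2 ≤ (3 / 2 : ℝ) := by rw [Real.sqrt_le_left (by norm_num)]; norm_num
    calc _ ≤ √k / l * (4 * (√2 * K * √(min k l : ℕ))) +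
          √k / l * (4 * (√2 * K * √(min k l : ℕ))) := by gcongr
      _ = 8 * √2 * K * (√k / l * √(min k l : ℕ)) := by ring
      _ ≤ 8 * (3 / 2) * K * (√k / √l * min (√k / √l) 1) := by gcongr
      _ = _ := by ring

end Chain

section SparseChaos

variable {ι κ J T ι' κ' : Type*} [Fintype ι] [Fintype κ] [DecidableEq ι] [Fintype ι']
  [DecidableEq ι'] [Fintype κ']

/-- Chaos bound for a family of matrices indexed by sparse vectors, in terms of the existence of
good sign patterns for the associated seminorms. -/
lemma sparse_chaos [Finite J] [Fintype T] [DecidableEq T] (A : J → Matrix κ ι ℝ)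
    {K : ℝ} (hK : 0 < K) (k p q : ℕ) (hp0 : 0 < p) (hpk : p ≤ k) (hq : k ≤ 2 ^ q)
    (hA : ∀ O : Finset ι, #O ≤ k → ∃ s : ι → Bool, ∀ b,
      nsq (A b *ᵥ signOn O s) ≤ K ^ 2 * (#O + p))
    (hι : 0 < Fintype.card ι)
    (X : T → ι → ℝ) (hX : ∀ x, #(univ.filter fun j => X x j ≠ 0) ≤ k) (hX1 : ∀ x, nsq (X x) ≤ 1)
    (t₀ : T) (hX0 : X t₀ = 0)
    (hR : ∀ x b, nsq (A b *ᵥ X x) ≤ 2 * K ^ 2 * (k / p))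
    (V : T → Matrix κ' ι' ℝ) (hV0 : V t₀ = 0)
    (hV : ∀ x y c, 0 ≤ c → (∀ b, nsq (A b *ᵥ (X x - X y)) ≤ c ^ 2) →
      ∀ u, nsq ((V x - V y) *ᵥ u) ≤ c ^ 2 * nsq u)
    {F : ℝ} (hF : ∀ x, ∑ i, nsq (V x i) ≤ F) {γ : ℝ}
    (hγ : 120 * K * √(k * Real.log (2 * Fintype.card ι + 1)) * (q + 3) ≤ γ)
    (t : (ι' → Bool) → T) :
    𝔼 s, |nsq (V (t s) *ᵥ sv s) - ∑ i, nsq (V (t s) i)| ≤ 8 * γ * √(2 * F + 64 * γ ^ 2) := by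
  have : Nonempty T := ⟨t₀⟩
  set d := Fintype.card ι with hd
  set Λ := Real.log (2 * d + 1) with hΛ
  have hd1 : (1 : ℝ) ≤ d := by exact_mod_cast hι
  have hΛ2 : Real.log 2 ≤ Λ := Real.log_le_log (by norm_num) (by linarith)
  have hl2 : 0 < Real.log 2 := Real.log_pos (by norm_num)
  have hΛ0 : 0 < Λ := hl2.trans_le hΛ2
  have hp : (0 : ℝ) < p := by exact_mod_cast hp0
  have hp1 : (1 : ℝ) ≤ p := by exact_mod_cast hp0
  have hk : (0 : ℝ) < k := by exact_mod_cast hp0.trans_le hpk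
  set a := √k / √p with ha
  have ha0 : 0 < a := div_pos (Real.sqrt_pos.2 hk) (Real.sqrt_pos.2 hp)
  have haq : a ≤ 2 ^ q := by
    have h1 : (1 : ℝ) ≤ √p := Real.one_le_sqrt.2 hp1
    calc a ≤ √k := div_le_self (Real.sqrt_nonneg _) h1
      _ ≤ k := by
        rw [Real.sqrt_le_left hk.le]
        have : (1 : ℝ) ≤ k := by exact_mod_cast hp0.trans_le hpk
        nlinarith
      _ ≤ 2 ^ q := by exact_mod_cast hq
  set P := √(k * Λ) with hP
  have hP0 : 0 < P := Real.sqrt_pos.2 (by positivity)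
  -- the nets
  let D : ℕ → ℝ := fun n => 12 * K * (a / 2 ^ n * min (a / 2 ^ n) 1)
  have hD0 : ∀ n, 0 ≤ D n := fun n => by positivity
  have hDanti : ∀ n, D (n + 1) ≤ D n := by
    intro n
    have : a / 2 ^ (n + 1) ≤ a / 2 ^ n := by gcongr <;> norm_num
    simp only [D]
    gcongr
  have hsq4 : ∀ n : ℕ, √((p * 4 ^ n : ℕ) : ℝ) = √p * 2 ^ n := by
    intro n
    rw [Nat.cast_mul, Real.sqrt_mul hp.le, Nat.cast_pow]
    congr 1
    rw [show ((4 : ℕ) : ℝ) ^ n = (2 ^ n) ^ 2 by rw [← pow_mul, mul_comm, pow_mul]; norm_num]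
    exact Real.sqrt_sq (by positivity)
  have hnet : ∀ n : ℕ, ∃ R : T → T, #(univ.image R) ≤ (2 * d + 1) ^ (p * 4 ^ n) ∧ ∀ x b,
      √(nsq (A b *ᵥ (X (R x) - X x))) ≤ D n := by
    intro n
    obtain ⟨R, h1, h2⟩ := exists_net A hK k p (p * 4 ^ n) hp0 hpk
      (Nat.le_mul_of_pos_right _ (by positivity)) hA X hX hX1
    refine ⟨R, h1, fun x b => (h2 x b).trans (le_of_eq ?_)⟩
    rw [hsq4, ← div_div]
  choose R hR1 hR2 using hnet
  -- the number of steps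
  set E := Real.log (2 * (Fintype.card T * Fintype.card T)) with hE
  have hE0 : 0 ≤ √(2 * E) := Real.sqrt_nonneg _
  obtain ⟨m, hm⟩ : ∃ m, √(2 * E) * (2 * D m) ≤ K * P := by
    obtain ⟨m, hm⟩ := exists_pow_lt_of_lt_one
      (show 0 < K * P / (24 * K * a * √(2 * E) + 1) by positivity)
      (show (1 / 2 : ℝ) < 1 by norm_num)
    refine ⟨m, ?_⟩
    have h1 : D m ≤ 12 * K * (a / 2 ^ m * 1) := by
      simp only [D]; gcongr; exact min_le_right _ _
    calc √(2 * E) * (2 * D m) ≤ √(2 * E) * (2 * (12 * K * (a / 2 ^ m * 1))) := by gcongr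
      _ = (24 * K * a * √(2 * E)) * (1 / 2) ^ m := by rw [one_div, inv_pow]; field_simp; ring
      _ ≤ (24 * K * a * √(2 * E) + 1) * (1 / 2) ^ m := by gcongr; linarith
      _ ≤ (24 * K * a * √(2 * E) + 1) * (K * P / (24 * K * a * √(2 * E) + 1)) := by gcongr
      _ = K * P := by field_simp
  let π : ℕ → T → T := fun n => match n with
    | 0 => fun _ => t₀
    | n + 1 => if n ≤ m then R n else id
  let r : ℕ → ℝ := fun n => match n with
    | 0 => 2 * K * a
    | n + 1 => 2 * D n
  let e : ℕ → ℝ := fun n => if n ≤ m then 3 * (p * 4 ^ n) * Λ else E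
  have hcard : ∀ n ≤ m + 1, #(univ.image (π n)) ≤ (2 * d + 1) ^ (p * 4 ^ n) := by
    intro n hn
    cases n with
    | zero =>
      refine (card_le_card (t := {t₀}) fun y hy => ?_).trans ?_
      · obtain ⟨x, -, rfl⟩ := mem_image.1 hy
        simp [π]
      · rw [card_singleton]; exact Nat.one_le_pow _ _ (by omega)
    | succ n =>
      have h1 : π (n + 1) = R n := by simp only [π]; rw [if_pos (by omega)]
      rw [h1]
      refine (hR1 n).trans (Nat.pow_le_pow_right (by omega) ?_)
      gcongr <;> omega
  have hstep : ∀ n ≤ m, ∀ x b, √(nsq (A b *ᵥ (X (π (n + 1) x) - X x))) ≤ D n := by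
    intro n hn x b
    have h1 : π (n + 1) = R n := by simp only [π]; rw [if_pos hn]
    rw [h1]
    exact hR2 n x b
  have main := expect_chaos_le V hF π (m + 2) (fun x => by simp [π]) (fun x => hV0) e r
    (fun n => by
      cases n with
      | zero => simp only [r]; positivity
      | succ n => exact mul_nonneg zero_le_two (hD0 n))
    (fun n hn => ?_) (fun n hn x => ?_) (γ := γ) ?_ t
  · exact main.1
  · by_cases hnm : n ≤ m
    · have h1 : #(univ.image fun x => (π (n + 1) x, π n x)) ≤
          (2 * d + 1) ^ (p * 4 ^ n) * (2 * d + 1) ^ (p * 4 ^ n) := by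
        have hsub : (univ.image fun x => (π (n + 1) x, π n x)) ⊆
            univ.image (π (n + 1)) ×ˢ univ.image (π n) := by
          intro y hy
          obtain ⟨x, -, rfl⟩ := mem_image.1 hy
          exact mem_product.2 ⟨mem_image_of_mem _ (mem_univ _), mem_image_of_mem _ (mem_univ _)⟩
        refine (card_le_card hsub).trans ?_
        rw [card_product]
        refine Nat.mul_le_mul ?_ (hcard n (by omega))
        have h2 : π (n + 1) = R n := by simp only [π]; rw [if_pos hnm]
        rw [h2]
        exact hR1 n
      have h0 : 0 < #(univ.image fun x => (π (n + 1) x, π n x)) :=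
        card_pos.2 ⟨_, mem_image_of_mem _ (mem_univ t₀)⟩
      simp only [e]
      rw [if_pos hnm]
      have h4 : (1 : ℝ) ≤ p * 4 ^ n := one_le_mul_of_one_le_of_one_le hp1 (one_le_pow₀ (by norm_num))
      calc Real.log (2 * #(univ.image fun x => (π (n + 1) x, π n x)))
          ≤ Real.log (2 * ((2 * d + 1) ^ (p * 4 ^ n) * (2 * d + 1) ^ (p * 4 ^ n))) := by
            apply Real.log_le_log (by positivity)
            gcongr
            exact_mod_cast h1
        _ = Real.log 2 + 2 * (p * 4 ^ n) * Λ := by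
            rw [Real.log_mul (by norm_num) (by positivity),
              Real.log_mul (by positivity) (by positivity), Real.log_pow]
            push_cast
            ring
        _ ≤ 3 * (p * 4 ^ n) * Λ := by nlinarith
    · simp only [e]
      rw [if_neg hnm]
      have h0 : 0 < #(univ.image fun x => (π (n + 1) x, π n x)) :=
        card_pos.2 ⟨_, mem_image_of_mem _ (mem_univ t₀)⟩
      apply Real.log_le_log (by positivity)
      have h1 := card_le_univ (univ.image fun x => (π (n + 1) x, π n x))
      rw [Fintype.card_prod] at h1
      gcongr
      exact_mod_cast h1
  · refine hV _ _ _ ?_ fun b => ?_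
    · cases n with
      | zero => simp only [r]; positivity
      | succ n => exact mul_nonneg zero_le_two (hD0 n)
    · cases n with
      | zero =>
        have h1 : X (π 0 x) = 0 := hX0
        rw [h1, sub_zero]
        refine (hR _ b).trans ?_
        have h2 : a ^ 2 = k / p := by rw [ha, div_pow, Real.sq_sqrt hk.le, Real.sq_sqrt hp.le]
        simp only [r]
        rw [mul_pow, h2]
        have : (0 : ℝ) ≤ k / p := by positivity
        nlinarith [mul_nonneg (sq_nonneg K) this]
      | succ n =>
        have h1 : X (π (n + 1 + 1) x) - X (π (n + 1) x) =
            (X (π (n + 1 + 1) x) - X x) + (-1 : ℝ) • (X (π (n + 1) x) - X x) := by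
          ext j; simp
        have h2 := hstep n (by omega) x b
        have h3 : √(nsq (A b *ᵥ (X (π (n + 1 + 1) x) - X x))) ≤ D n := by
          by_cases hnm : n + 1 ≤ m
          · exact (hstep (n + 1) hnm x b).trans (hDanti n)
          · have : π (n + 1 + 1) x = x := by simp only [π]; rw [if_neg hnm]; rfl
            rw [this, sub_self, Matrix.mulVec_zero, nsq_zero, Real.sqrt_zero]
            exact hD0 n
        have h4 : √(nsq (A b *ᵥ (X (π (n + 1 + 1) x) - X (π (n + 1) x)))) ≤ 2 * D n := by
          rw [h1, Matrix.mulVec_add, Matrix.mulVec_smul]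
          refine (sqrt_nsq_add_le _ _).trans ?_
          rw [sqrt_nsq_smul]
          norm_num
          linarith
        exact (Real.sqrt_le_left (mul_nonneg zero_le_two (hD0 n))).1 h4
  · refine le_trans ?_ hγ
    have hs6 : √6 ≤ (49 / 20 : ℝ) := by rw [Real.sqrt_le_left (by norm_num)]; norm_num
    have he : ∀ n ≤ m, √(2 * e n) = √6 * √p * √Λ * 2 ^ n := by
      intro n hn
      simp only [e]
      rw [if_pos hn, show 2 * (3 * ((p : ℝ) * 4 ^ n) * Λ) = 6 * (p * 4 ^ n : ℕ) * Λ by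
        push_cast; ring, Real.sqrt_mul (by positivity), Real.sqrt_mul (by positivity), hsq4]
      ring
    have hPe : P = √p * a * √Λ := by
      rw [hP, Real.sqrt_mul hk.le, ha]
      have := Real.sqrt_pos.2 hp
      field_simp
    rw [sum_range_succ, sum_range_succ']
    have hlast : √(2 * e (m + 1)) * r (m + 1) ≤ K * P := by
      simp only [e, r]
      rw [if_neg (by omega)]
      exact hm
    have hfirst : √(2 * e 0) * r 0 ≤ 5 * (K * P) := by
      rw [he 0 (Nat.zero_le _)]
      simp only [r]
      calc _ = 2 * √6 * (K * P) := by rw [hPe]; ring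
        _ ≤ 2 * (49 / 20) * (K * P) := by gcongr
        _ ≤ _ := by nlinarith [mul_pos hK hP0]
    have hmid : ∑ n ∈ range m, √(2 * e (n + 1)) * r (n + 1) ≤ 118 * (K * P) * (q + 2) := by
      calc _ = ∑ n ∈ range m, 48 * √6 * (K * P) * min (a / 2 ^ n) 1 := by
            refine sum_congr rfl fun n hn => ?_
            rw [he (n + 1) (by have := mem_range.1 hn; omega)]
            simp only [r, D]
            rw [hPe, pow_succ]
            field_simp
            ring
        _ = 48 * √6 * (K * P) * ∑ n ∈ range m, min (a / 2 ^ n) 1 := by rw [mul_sum]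
        _ ≤ 48 * (49 / 20) * (K * P) * (q + 2) := by
            gcongr
            exact sum_min_le q m a ha0.le haq
        _ ≤ _ := by gcongr; norm_num
    have : 0 < K * P := by positivity
    have hq0 : (0 : ℝ) ≤ q := Nat.cast_nonneg _
    nlinarith [mul_nonneg this.le hq0]

end SparseChaos

section Signs

variable {ι κ J : Type*} [Fintype ι] [Fintype κ] [DecidableEq ι] [Fintype J]

lemma exists_sign_of_expect (A : J → Matrix κ ι ℝ) (O : Finset ι) {F r : ℝ} (hF0 : 0 ≤ F)
    (hr : 0 ≤ r) (hF : ∀ b, ∑ i, ∑ j ∈ O, A b i j ^ 2 ≤ F)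
    (hA : ∀ b u, (∀ j ∉ O, u j = 0) → nsq (A b *ᵥ u) ≤ r ^ 2 * nsq u) :
    ∃ s : ι → Bool, ∀ b, nsq (A b *ᵥ signOn O s) ≤
      2 * F + 128 * Real.log (2 * (Fintype.card J + 1)) * r ^ 2 := by
  cases isEmpty_or_nonempty J with
  | inl h => exact ⟨fun _ => true, fun b => h.elim b⟩
  | inr h =>
    let V : J → Matrix κ ι ℝ := fun b i j => if j ∈ O then A b i j else 0
    have hVu : ∀ b u, V b *ᵥ u = A b *ᵥ fun j => if j ∈ O then u j else 0 := by
      intro b u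
      ext i
      simp only [V, Matrix.mulVec, dotProduct]
      exact sum_congr rfl fun j _ => by split_ifs <;> simp
    choose t ht using fun s : ι → Bool => Finite.exists_max fun b => nsq (V b *ᵥ sv s)
    have hV1 : ∀ b, ∑ i, nsq (V b i) ≤ F := by
      intro b
      refine le_trans (le_of_eq ?_) (hF b)
      refine sum_congr rfl fun i _ => ?_
      simp only [V, nsq, ite_pow]
      simp
    have hV2 : ∀ b u, nsq (V b *ᵥ u) ≤ r ^ 2 * nsq u := by
      intro b u
      rw [hVu]
      refine (hA b _ fun j hj => if_neg hj).trans ?_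
      refine mul_le_mul_of_nonneg_left (sum_le_sum fun j _ => ?_) (sq_nonneg r)
      dsimp only
      split_ifs
      · exact le_rfl
      · simpa using sq_nonneg (u j)
    obtain ⟨s, -, hs⟩ := exists_le_of_expect_le univ_nonempty
      (expect_family_le V hV1 hF0 hr hV2 t)
    refine ⟨s, fun b => ?_⟩
    have h1 := (ht s b).trans hs
    rw [hVu] at h1
    exact h1

end Signs

section Chunks

variable {ι κ : Type*} [Fintype ι] [Fintype κ]

lemma nsq_filter_add_filter (S : ι → Prop) [DecidablePred S] (x : ι → ℝ) :
    nsq (fun j => if S j then x j else 0) + nsq (fun j => if S j then 0 else x j) = nsq x := by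
  rw [nsq, nsq, nsq, ← sum_add_distrib]
  exact sum_congr rfl fun j _ => by split_ifs <;> simp

/-- A bound on `p`-sparse vectors extends to `n`-sparse vectors. -/
lemma nsq_mulVec_le_of_sparse (A : Matrix κ ι ℝ) {p : ℕ} (hp : 0 < p) {C : ℝ} (hC : 0 ≤ C)
    (h : ∀ x : ι → ℝ, #(univ.filter fun j => x j ≠ 0) ≤ p → nsq (A *ᵥ x) ≤ C * nsq x) (n : ℕ) :
    ∀ x : ι → ℝ, #(univ.filter fun j => x j ≠ 0) ≤ n →
      nsq (A *ᵥ x) ≤ ((n : ℝ) / p + 1) * C * nsq x := by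
  classical
  have hp' : (0 : ℝ) < p := by exact_mod_cast hp
  induction n using Nat.strong_induction_on with
  | _ n ih =>
    intro x hx
    by_cases hxp : #(univ.filter fun j => x j ≠ 0) ≤ p
    · refine (h x hxp).trans ?_
      have h1 : (0 : ℝ) ≤ (n : ℝ) / p := by positivity
      have h2 := mul_nonneg hC (nsq_nonneg x)
      nlinarith [mul_nonneg h1 h2]
    · push Not at hxp
      have hn : p < n := hxp.trans_le hx
      obtain ⟨S, hS, hSc⟩ := exists_subset_card_eq hxp.le
      set y : ι → ℝ := fun j => if j ∈ S then x j else 0 with hy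
      set z : ι → ℝ := fun j => if j ∈ S then 0 else x j with hz
      have hyz : x = y + z := by
        ext j; simp only [hy, hz, Pi.add_apply]; split_ifs <;> simp
      have h1 : nsq (A *ᵥ y) ≤ C * nsq y := h y ((card_le_card fun j hj => by
        by_contra hjS
        exact (mem_filter.1 hj).2 (if_neg hjS)).trans hSc.le)
      have h2 : nsq (A *ᵥ z) ≤ (((n - p : ℕ) : ℝ) / p + 1) * C * nsq z := by
        refine ih (n - p) (by omega) z ?_
        have h3 : (univ.filter fun j => z j ≠ 0) ⊆ (univ.filter fun j => x j ≠ 0) \ S := by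
          intro j hj
          have hzj := (mem_filter.1 hj).2
          simp only [hz] at hzj
          split_ifs at hzj with hjS
          · exact absurd rfl hzj
          · exact mem_sdiff.2 ⟨mem_filter.2 ⟨mem_univ _, hzj⟩, hjS⟩
        refine (card_le_card h3).trans ?_
        rw [card_sdiff_of_subset hS, hSc]
        omega
      have h4 : nsq x = nsq y + nsq z := (nsq_filter_add_filter (· ∈ S) x).symm
      have hn' : (0 : ℝ) < n := by exact_mod_cast hp.trans hn
      have h5 : ((n - p : ℕ) : ℝ) / p + 1 = n / p := by
        rw [Nat.cast_sub hn.le]; field_simp; ring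
      rw [h5] at h2
      rw [h4]
      nth_rewrite 1 [hyz]
      rw [Matrix.mulVec_add]
      refine (nsq_add_le _ _ (show (0 : ℝ) < n / p by positivity)).trans ?_
      calc _ ≤ (1 + (n : ℝ) / p) * (C * nsq y) + (1 + 1 / ((n : ℝ) / p)) * (n / p * C * nsq z) := by
            gcongr
        _ = _ := by field_simp; ring

end Chunks

section Fourier

/-- The rows of the circulant matrix of `x` indexed by `ω`. -/
def circ {G R : Type*} [AddCommGroup G] (ω : R → G) (x : G → ℝ) : Matrix R G ℝ := fun r t => x (ω r - t)

lemma circ_sub {G R : Type*} [AddCommGroup G] (ω : R → G) (x y : G → ℝ) : circ ω x - circ ω y = circ ω (x - y) := rfl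

lemma circ_zero {G R : Type*} [AddCommGroup G] (ω : R → G) : circ ω (0 : G → ℝ) = 0 := rfl

variable {G : Type*} [AddCommGroup G] [Fintype G]

/-- The Fourier coefficient of `x` at `ψ`, as a matrix acting on `x`. -/
def charMat (ψ : AddChar G ℂ) : Matrix Bool G ℝ :=
  fun b t => if b then (ψ t).re else (ψ t).im

lemma nsq_charMat_mulVec (ψ : AddChar G ℂ) (x : G → ℝ) :
    nsq (charMat ψ *ᵥ x) = ‖∑ t, (x t : ℂ) * ψ t‖ ^ 2 := by
  rw [← Complex.normSq_eq_norm_sq, Complex.normSq_apply, nsq, Fintype.sum_bool]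
  simp only [charMat, Matrix.mulVec, dotProduct, Complex.re_sum, Complex.im_sum,
    Complex.re_ofReal_mul, Complex.im_ofReal_mul, if_true, Bool.false_eq_true, if_false]
  simp only [sq, mul_comm]

lemma sum_charMat_sq (ψ : AddChar G ℂ) (t : G) : ∑ b, charMat ψ b t ^ 2 = 1 := by
  have h := ψ.norm_apply t
  rw [Fintype.sum_bool]
  simp only [charMat, if_true, Bool.false_eq_true, if_false]
  have h1 := Complex.normSq_eq_norm_sq (ψ t)
  rw [h, Complex.normSq_apply] at h1
  linarith

lemma nsq_charMat_mulVec_le (ψ : AddChar G ℂ) (x : G → ℝ) :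
    nsq (charMat ψ *ᵥ x) ≤ (∑ t, |x t|) ^ 2 := by
  rw [nsq_charMat_mulVec]
  refine pow_le_pow_left₀ (norm_nonneg _) ((norm_sum_le _ _).trans (le_of_eq ?_)) 2
  exact sum_congr rfl fun t _ => by simp [ψ.norm_apply]

lemma sum_norm_sq_fourier (f : G → ℂ) :
    ∑ ψ : AddChar G ℂ, ‖∑ t, f t * ψ t‖ ^ 2 = Fintype.card G * ∑ t, ‖f t‖ ^ 2 := by
  classical
  have h : ((∑ ψ : AddChar G ℂ, ‖∑ t, f t * ψ t‖ ^ 2 : ℝ) : ℂ) =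
      ((Fintype.card G * ∑ t, ‖f t‖ ^ 2 : ℝ) : ℂ) := by
    push_cast
    calc ∑ ψ : AddChar G ℂ, (‖∑ t, f t * ψ t‖ : ℂ) ^ 2
        = ∑ ψ : AddChar G ℂ, ∑ t, ∑ u, f t * (starRingEnd ℂ) (f u) * ψ (t - u) := by
          refine sum_congr rfl fun ψ _ => ?_
          rw [← Complex.mul_conj', map_sum, sum_mul_sum]
          refine sum_congr rfl fun t _ => sum_congr rfl fun u _ => ?_
          rw [map_mul, sub_eq_add_neg, AddChar.map_add_eq_mul, AddChar.map_neg_eq_conj]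
          ring
      _ = ∑ t, ∑ u, f t * (starRingEnd ℂ) (f u) * ∑ ψ : AddChar G ℂ, ψ (t - u) := by
          rw [sum_comm]
          refine sum_congr rfl fun t _ => ?_
          rw [sum_comm]
          exact sum_congr rfl fun u _ => by rw [mul_sum]
      _ = ∑ t, f t * (starRingEnd ℂ) (f t) * Fintype.card G := by
          refine sum_congr rfl fun t _ => ?_
          rw [sum_eq_single t]
          · rw [AddChar.sum_apply_eq_ite, sub_self, if_pos rfl]
          · intro u _ hu
            rw [AddChar.sum_apply_eq_ite, if_neg (sub_ne_zero.2 hu.symm), mul_zero]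
          · simp
      _ = _ := by
          rw [mul_sum]
          exact sum_congr rfl fun t _ => by rw [Complex.mul_conj', mul_comm]
  exact_mod_cast h

/-- The convolution operator has norm at most the supremum of the Fourier transform. -/
lemma sum_conv_sq_le (x u : G → ℝ) {c : ℝ} (hx : ∀ ψ : AddChar G ℂ, nsq (charMat ψ *ᵥ x) ≤ c) :
    ∑ g, (∑ t, x (g - t) * u t) ^ 2 ≤ c * nsq u := by
  set f : G → ℝ := fun g => ∑ t, x (g - t) * u t with hf
  have hconv : ∀ ψ : AddChar G ℂ,
      ∑ g, (f g : ℂ) * ψ g = (∑ t, (x t : ℂ) * ψ t) * ∑ t, (u t : ℂ) * ψ t := by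
    intro ψ
    calc ∑ g, (f g : ℂ) * ψ g = ∑ g, ∑ t, (x (g - t) : ℂ) * u t * ψ g := by
          refine sum_congr rfl fun g _ => ?_
          simp only [hf]
          push_cast
          rw [sum_mul]
      _ = ∑ t, ∑ g, (x (g - t) : ℂ) * u t * ψ g := sum_comm
      _ = ∑ t, ∑ g, (x g : ℂ) * u t * ψ (g + t) := by
          refine sum_congr rfl fun t _ => ?_
          exact (Fintype.sum_equiv (Equiv.addRight t) _ _ fun g => by simp).symm
      _ = _ := by
          rw [sum_mul_sum, sum_comm]
          refine sum_congr rfl fun t _ => sum_congr rfl fun g _ => ?_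
          rw [AddChar.map_add_eq_mul]; ring
  have hc : (0 : ℝ) < Fintype.card G := by exact_mod_cast Fintype.card_pos
  have h1 := sum_norm_sq_fourier fun g => (f g : ℂ)
  have h2 := sum_norm_sq_fourier fun g => (u g : ℂ)
  simp only [Complex.norm_real, Real.norm_eq_abs, sq_abs] at h1 h2
  refine le_of_mul_le_mul_left ?_ hc
  calc (Fintype.card G : ℝ) * ∑ g, f g ^ 2
      = ∑ ψ : AddChar G ℂ, ‖∑ t, (f t : ℂ) * ψ t‖ ^ 2 := h1.symm
    _ ≤ ∑ ψ : AddChar G ℂ, c * ‖∑ t, (u t : ℂ) * ψ t‖ ^ 2 := by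
        refine sum_le_sum fun ψ _ => ?_
        rw [hconv, norm_mul, mul_pow, ← nsq_charMat_mulVec ψ x]
        exact mul_le_mul_of_nonneg_right (hx ψ) (sq_nonneg _)
    _ = _ := by rw [← mul_sum, h2, nsq]; ring

lemma circ_mulVec_comm {R : Type*} (ω : R → G) (x u : G → ℝ) : circ ω x *ᵥ u = circ ω u *ᵥ x := by
  ext r
  simp only [circ, Matrix.mulVec, dotProduct]
  exact Fintype.sum_equiv (Equiv.subLeft (ω r)) _ _ fun t => by simp [mul_comm]

lemma nsq_circ_row {R : Type*} (ω : R → G) (x : G → ℝ) (r : R) : nsq (circ ω x r) = nsq x :=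
  Fintype.sum_equiv (Equiv.subLeft (ω r)) _ _ fun t => by simp [circ]

variable {R : Type*} [Fintype R]

lemma sum_nsq_circ (ω : R → G) (x : G → ℝ) :
    ∑ r, nsq (circ ω x r) = Fintype.card R * nsq x := by
  simp only [nsq_circ_row, sum_const, card_univ, nsmul_eq_mul]

lemma nsq_circ_mulVec_le {ω : R → G} (hω : Function.Injective ω) (x u : G → ℝ) {c : ℝ}
    (hx : ∀ ψ : AddChar G ℂ, nsq (charMat ψ *ᵥ x) ≤ c) :
    nsq (circ ω x *ᵥ u) ≤ c * nsq u := by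
  classical
  calc nsq (circ ω x *ᵥ u) = ∑ r, (∑ t, x (ω r - t) * u t) ^ 2 := rfl
    _ = ∑ g ∈ univ.image ω, (∑ t, x (g - t) * u t) ^ 2 :=
        (sum_image (f := fun g => (∑ t, x (g - t) * u t) ^ 2) fun a _ b _ h => hω h).symm
    _ ≤ ∑ g, (∑ t, x (g - t) * u t) ^ 2 :=
        sum_le_sum_of_subset_of_nonneg (subset_univ _) fun _ _ _ => sq_nonneg _
    _ ≤ c * nsq u := sum_conv_sq_le x u hx

end Fourier

/-- Real vectors in the unit ball with at most `k` nonzero entries. -/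
def SparseUnit {ι : Type*} [Fintype ι] (k : ℕ) (x : ι → ℝ) : Prop :=
  #(univ.filter fun j => x j ≠ 0) ≤ k ∧ nsq x ≤ 1

lemma sparseUnit_zero {ι : Type*} [Fintype ι] (k : ℕ) : SparseUnit k (0 : ι → ℝ) := by
  refine ⟨by simp, ?_⟩
  rw [nsq_zero]
  exact zero_le_one

section Tail

variable {ι κ J ι' κ' : Type*} [Fintype ι] [Fintype κ] [DecidableEq ι] [Fintype ι']
  [DecidableEq ι'] [Fintype κ']

open scoped Classical in
/-- Tail bound for the chaos process indexed by sparse vectors. -/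
lemma sparse_chaos_tail [Finite J] (A : J → Matrix κ ι ℝ)
    {K : ℝ} (hK : 0 < K) (k p q : ℕ) (hp0 : 0 < p) (hpk : p ≤ k) (hq : k ≤ 2 ^ q)
    (hA : ∀ O : Finset ι, #O ≤ k → ∃ s : ι → Bool, ∀ b,
      nsq (A b *ᵥ signOn O s) ≤ K ^ 2 * (#O + p))
    (hι : 0 < Fintype.card ι)
    (hR : ∀ x, SparseUnit k x → ∀ b, nsq (A b *ᵥ x) ≤ 2 * K ^ 2 * (k / p))
    (W : (ι → ℝ) → Matrix κ' ι' ℝ) (hW0 : W 0 = 0)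
    (hW : ∀ x y c, 0 ≤ c → (∀ b, nsq (A b *ᵥ (x - y)) ≤ c ^ 2) →
      ∀ u, nsq ((W x - W y) *ᵥ u) ≤ c ^ 2 * nsq u)
    {F : ℝ} (hF : ∀ x, SparseUnit k x → ∑ i, nsq (W x i) ≤ F) {γ θ : ℝ}
    (hγ : 120 * K * √(k * Real.log (2 * Fintype.card ι + 1)) * (q + 3) ≤ γ) (hθ0 : 0 < θ)
    (hθ : 128 * γ * √(2 * F + 64 * γ ^ 2) ≤ θ) :
    (16 : ℝ) * #(univ.filter fun s : ι' → Bool => ∃ x, SparseUnit k x ∧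
      θ < |nsq (W x *ᵥ sv s) - ∑ i, nsq (W x i)|) ≤ Fintype.card (ι' → Bool) := by
  set P : (ι' → Bool) → (ι → ℝ) → Prop := fun s x => SparseUnit k x ∧
      θ < |nsq (W x *ᵥ sv s) - ∑ i, nsq (W x i)| with hP
  let X : Option (ι' → Bool) → ι → ℝ := fun t => t.elim 0 fun s =>
    if h : ∃ x, P s x then h.choose else 0
  have hX : ∀ t, SparseUnit k (X t) := by
    intro t
    cases t with
    | none => exact sparseUnit_zero k
    | some s =>
      simp only [X, Option.elim]
      split_ifs with h
      · exact h.choose_spec.1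
      · exact sparseUnit_zero k
  have hmain := sparse_chaos A hK k p q hp0 hpk hq hA hι X (fun t => (hX t).1) (fun t => (hX t).2)
    none rfl (fun t b => hR _ (hX t) b) (fun t => W (X t)) hW0 (fun x y => hW (X x) (X y))
    (fun t => hF _ (hX t)) hγ (fun s => some s)
  refine card_mul_le_of_expect_le (α := ι' → Bool) _ (fun s => abs_nonneg _)
    (show (0 : ℝ) < θ / 16 by positivity) (hmain.trans (by linarith)) _ fun s hs => ?_
  have h1 : X (some s) = hs.choose := by
    simp only [X, Option.elim]
    exact dif_pos hs
  have h2 := hs.choose_spec.2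
  rw [← h1] at h2
  linarith

end Tail

lemma one_lt_log_three : 1 < Real.log 3 := by
  rw [Real.lt_log_iff_exp_lt (by norm_num)]
  exact Real.exp_one_lt_d9.trans (by norm_num)

lemma one_le_log_two_mul_add_one {d : ℕ} (hd : 0 < d) : 1 ≤ Real.log (2 * d + 1) := by
  have h : (1 : ℝ) ≤ d := by exact_mod_cast hd
  exact one_lt_log_three.le.trans (Real.log_le_log (by norm_num) (by linarith))

section Circulant

lemma sq_sum_abs_le {G : Type*} [Fintype G] (O : Finset G) (u : G → ℝ) (hu : ∀ j ∉ O, u j = 0) :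
    (∑ t, |u t|) ^ 2 ≤ #O * nsq u := by
  have h1 : ∑ t, |u t| = ∑ t ∈ O, |u t| :=
    (sum_subset (subset_univ O) fun t _ ht => by rw [hu t ht, abs_zero]).symm
  rw [h1]
  refine sq_sum_le_card_mul_sum_sq.trans ?_
  refine mul_le_mul_of_nonneg_left ?_ (Nat.cast_nonneg _)
  simp only [sq_abs]
  exact sum_le_sum_of_subset_of_nonneg (subset_univ _) fun _ _ _ => sq_nonneg _

lemma SparseUnit.sq_sum_abs_le {G : Type*} [Fintype G] {k : ℕ} {x : G → ℝ} (hx : SparseUnit k x) :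
    (∑ t, |x t|) ^ 2 ≤ k := by
  refine (_root_.sq_sum_abs_le (univ.filter fun j => x j ≠ 0) x fun j hj => ?_).trans ?_
  · by_contra h
    exact hj (mem_filter.2 ⟨mem_univ _, h⟩)
  · have h1 : ((#(univ.filter fun j => x j ≠ 0) : ℕ) : ℝ) ≤ k := by exact_mod_cast hx.1
    calc _ ≤ (k : ℝ) * 1 := mul_le_mul h1 hx.2 (nsq_nonneg x) (Nat.cast_nonneg _)
      _ = k := mul_one _

variable {G : Type*} [AddCommGroup G] [Fintype G] [DecidableEq G]

open scoped Classical in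
/-- Restricted isometry tail bound for partial circulant matrices. -/
lemma circ_tail {R : Type*} [Fintype R] {ω : R → G} (hω : Function.Injective ω) (k q : ℕ)
    (hk : 0 < k) (hq : k ≤ 2 ^ q) {γ θ : ℝ}
    (hγ : 120 * √(300 * Real.log (2 * Fintype.card G + 1)) *
      √(k * Real.log (2 * Fintype.card G + 1)) * (q + 3) ≤ γ) (hθ0 : 0 < θ)
    (hθ : 128 * γ * √(2 * Fintype.card R + 64 * γ ^ 2) ≤ θ) :
    (16 : ℝ) * #(univ.filter fun s : G → Bool => ∃ x, SparseUnit k x ∧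
      θ < |nsq (circ ω x *ᵥ sv s) - Fintype.card R * nsq x|) ≤ Fintype.card (G → Bool) := by
  have hd : 0 < Fintype.card G := Fintype.card_pos
  set Λ := Real.log (2 * Fintype.card G + 1) with hΛ
  have hΛ1 : 1 ≤ Λ := one_le_log_two_mul_add_one hd
  have hd1 : (1 : ℝ) ≤ Fintype.card G := by exact_mod_cast hd
  have hlog : Real.log (2 * (Fintype.card (AddChar G ℂ) + 1)) ≤ 2 * Λ := by
    rw [AddChar.card_eq, hΛ, show (2 : ℝ) * Real.log (2 * Fintype.card G + 1) =
      Real.log ((2 * Fintype.card G + 1) ^ 2) by rw [Real.log_pow]; norm_num]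
    exact Real.log_le_log (by positivity) (by nlinarith)
  have hK2 : √(300 * Λ) ^ 2 = 300 * Λ := Real.sq_sqrt (by positivity)
  have h := sparse_chaos_tail (J := AddChar G ℂ) charMat (K := √(300 * Λ))
    (Real.sqrt_pos.2 (by positivity)) k 1 q one_pos hk hq ?_ hd ?_ (circ ω) (circ_zero ω) ?_
    (F := Fintype.card R) ?_ hγ hθ0 hθ
  · simpa only [sum_nsq_circ] using h
  · intro O _
    obtain ⟨s, hs⟩ := exists_sign_of_expect (J := AddChar G ℂ) charMat O (F := #O) (r := √(#O))
      (Nat.cast_nonneg _) (Real.sqrt_nonneg _) (fun b => by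
        rw [sum_comm]
        simp only [sum_charMat_sq, sum_const, nsmul_eq_mul, mul_one, le_refl]) (fun b u hu => by
        rw [Real.sq_sqrt (Nat.cast_nonneg _)]
        exact (nsq_charMat_mulVec_le b u).trans (sq_sum_abs_le O u hu))
    refine ⟨s, fun b => (hs b).trans ?_⟩
    rw [Real.sq_sqrt (Nat.cast_nonneg _), hK2]
    have hO : (0 : ℝ) ≤ #O := Nat.cast_nonneg _
    push_cast
    nlinarith [mul_le_mul_of_nonneg_right hlog hO, mul_nonneg hO (by linarith : 0 ≤ Λ),
      mul_le_mul_of_nonneg_right hΛ1 hO]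
  · intro x hx b
    refine (nsq_charMat_mulVec_le b x).trans (hx.sq_sum_abs_le.trans ?_)
    rw [hK2]
    push_cast
    rw [div_one]
    have : (0 : ℝ) ≤ k := Nat.cast_nonneg _
    nlinarith [mul_le_mul_of_nonneg_right hΛ1 this]
  · intro x y c _ hxy u
    rw [circ_sub]
    exact nsq_circ_mulVec_le hω _ u hxy
  · intro x hx
    rw [sum_nsq_circ]
    exact mul_le_of_le_one_right (Nat.cast_nonneg _) hx.2

end Circulant

section Hashed

variable {ι α β : Type*} [Fintype ι] [DecidableEq β]

/-- The matrix with `b`-th row the vector `A b *ᵥ x` placed in the `b`-th block. -/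
def blockDiag (A : β → Matrix α ι ℝ) (x : ι → ℝ) : Matrix β (β × α) ℝ :=
  fun b r => if r.1 = b then (A b *ᵥ x) r.2 else 0

lemma blockDiag_sub (A : β → Matrix α ι ℝ) (x y : ι → ℝ) :
    blockDiag A x - blockDiag A y = blockDiag A (x - y) := by
  ext b r
  simp only [blockDiag, Matrix.sub_apply, Matrix.mulVec_sub]
  split_ifs <;> simp

lemma blockDiag_zero (A : β → Matrix α ι ℝ) : blockDiag A 0 = 0 := by
  ext b r; simp [blockDiag]

variable [Fintype α] [Fintype β]

lemma blockDiag_mulVec (A : β → Matrix α ι ℝ) (x : ι → ℝ) (u : β × α → ℝ) (b : β) :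
    (blockDiag A x *ᵥ u) b = ∑ i, (A b *ᵥ x) i * u (b, i) := by
  simp only [Matrix.mulVec, dotProduct, blockDiag]
  rw [Fintype.sum_prod_type, sum_eq_single b]
  · simp
  · intro b' _ hb; simp [hb]
  · simp

lemma nsq_blockDiag_row (A : β → Matrix α ι ℝ) (x : ι → ℝ) (b : β) :
    nsq (blockDiag A x b) = nsq (A b *ᵥ x) := by
  simp only [nsq, blockDiag]
  rw [Fintype.sum_prod_type, sum_eq_single b]
  · simp
  · intro b' _ hb; simp [hb]
  · simp

variable [DecidableEq ι] [DecidableEq α]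

open scoped Classical in
/-- Tail bound for the hashing signs, given that all blocks are bounded on `p`-sparse vectors. -/
lemma hash_tail (A : β → Matrix α ι ℝ) (hA1 : ∀ b i j, A b i j ^ 2 = 1) (k p q : ℕ) (hp0 : 0 < p)
    (hpk : p ≤ k) (hq : k ≤ 2 ^ q) (hι : 0 < Fintype.card ι) (hβ : 0 < Fintype.card β)
    (hα : 0 < Fintype.card α)
    (hpβ : Real.log (Fintype.card β) ≤ p) {C : ℝ} (hC : 0 ≤ C)
    (hblk : ∀ b (x : ι → ℝ), #(univ.filter fun j => x j ≠ 0) ≤ p →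
      nsq (A b *ᵥ x) ≤ C * Fintype.card α * nsq x)
    {F : ℝ} (hF : ∀ x, SparseUnit k x → ∑ b, nsq (A b *ᵥ x) ≤ F) {γ θ : ℝ}
    (hγ : 120 * √((2 + 384 * C) * Fintype.card α) *
      √(k * Real.log (2 * Fintype.card ι + 1)) * (q + 3) ≤ γ) (hθ0 : 0 < θ)
    (hθ : 128 * γ * √(2 * F + 64 * γ ^ 2) ≤ θ) :
    (16 : ℝ) * #(univ.filter fun s : β × α → Bool => ∃ x, SparseUnit k x ∧
      θ < |nsq (blockDiag A x *ᵥ sv s) - ∑ b, nsq (A b *ᵥ x)|) ≤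
        Fintype.card (β × α → Bool) := by
  have hα' : (0 : ℝ) < Fintype.card α := by exact_mod_cast hα
  have hβ' : (1 : ℝ) ≤ Fintype.card β := by exact_mod_cast hβ
  have hp : (1 : ℝ) ≤ p := by exact_mod_cast hp0
  have hkp : (1 : ℝ) ≤ (k : ℝ) / p := by
    rw [one_le_div (by linarith)]; exact_mod_cast hpk
  have hCB : 0 ≤ C * Fintype.card α := by positivity
  have hK2 : √((2 + 384 * C) * Fintype.card α) ^ 2 = (2 + 384 * C) * Fintype.card α :=
    Real.sq_sqrt (by positivity)
  have hlog : Real.log (2 * (Fintype.card β + 1)) ≤ 3 * p := by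
    have h1 : Real.log (2 * (Fintype.card β + 1)) ≤ Real.log (2 * 2 * Fintype.card β) :=
      Real.log_le_log (by positivity) (by linarith)
    rw [Real.log_mul (x := 2 * 2) (by norm_num) (zero_lt_one.trans_le hβ').ne',
      Real.log_mul (x := 2) (y := 2) (by norm_num) (by norm_num)] at h1
    have := Real.log_two_lt_d9
    linarith
  have h := sparse_chaos_tail (J := β) A (K := √((2 + 384 * C) * Fintype.card α))
    (Real.sqrt_pos.2 (by positivity)) k p q hp0 hpk hq ?_ hι ?_ (blockDiag A) (blockDiag_zero A) ?_
    (F := F) ?_ hγ hθ0 hθ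
  · simpa only [nsq_blockDiag_row] using h
  · intro O _
    have hr0 : 0 ≤ ((#O : ℝ) / p + 1) * (C * Fintype.card α) := by positivity
    obtain ⟨s, hs⟩ := exists_sign_of_expect (J := β) A O (F := Fintype.card α * #O)
      (r := √(((#O : ℝ) / p + 1) * (C * Fintype.card α))) (by positivity) (Real.sqrt_nonneg _)
      (fun b => by simp [hA1]) (fun b u hu => by
        rw [Real.sq_sqrt hr0]
        refine nsq_mulVec_le_of_sparse (A b) hp0 hCB (hblk b) #O u (card_le_card fun j hj => ?_)
        by_contra hjO
        exact (mem_filter.1 hj).2 (hu j hjO))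
    refine ⟨s, fun b => (hs b).trans ?_⟩
    rw [Real.sq_sqrt hr0, hK2]
    calc _ ≤ 2 * (Fintype.card α * #O) +
          128 * (3 * p) * (((#O : ℝ) / p + 1) * (C * Fintype.card α)) := by gcongr
      _ = 2 * (Fintype.card α * #O) + 384 * C * Fintype.card α * (#O + p) := by field_simp; ring
      _ ≤ 2 * (Fintype.card α * (#O + p)) + 384 * C * Fintype.card α * (#O + p) := by
          gcongr; linarith
      _ = _ := by ring
  · intro x hx b
    refine (nsq_mulVec_le_of_sparse (A b) hp0 hCB (hblk b) k x hx.1).trans ?_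
    rw [hK2]
    calc _ ≤ ((k : ℝ) / p + 1) * (C * Fintype.card α) * 1 := by gcongr; exact hx.2
      _ ≤ ((k : ℝ) / p + k / p) * ((2 + 384 * C) * Fintype.card α) * 1 := by
          gcongr; linarith
      _ = _ := by ring
  · intro x y c _ hxy u
    rw [blockDiag_sub]
    have h1 : nsq u = ∑ b, ∑ i, u (b, i) ^ 2 := by rw [nsq, Fintype.sum_prod_type]
    rw [h1, mul_sum]
    refine sum_le_sum fun b _ => ?_
    rw [blockDiag_mulVec]
    refine (dotProduct_sq_le (A b *ᵥ (x - y)) fun i => u (b, i)).trans ?_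
    exact mul_le_mul_of_nonneg_right (hxy b) (nsq_nonneg _)
  · intro x hx
    simpa only [nsq_blockDiag_row] using hF x hx

end Hashed

section Net

variable {ι κ : Type*} [Fintype ι] [Fintype κ]

/-- A bound on a discrete net of sparse vectors extends to all sparse vectors. -/
lemma sqrt_nsq_mulVec_le_of_net (A : Matrix κ ι ℝ) {p : ℕ} (hp : 0 < p) {M : ℝ} (hM : 0 ≤ M)
    (h : ∀ z : ι → ℤ, ∑ j, |z j| ≤ (2 * p : ℕ) → nsq (fun j => (z j : ℝ)) ≤ 4 * p →
      √(nsq (A *ᵥ ((1 / (2 * √p)) • fun j => (z j : ℝ)))) ≤ M)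
    (x : ι → ℝ) (hx : SparseUnit p x) : √(nsq (A *ᵥ x)) ≤ 2 * M := by
  have hp' : (0 : ℝ) < p := by exact_mod_cast hp
  have hsp : 0 < √(p : ℝ) := Real.sqrt_pos.2 hp'
  have hspp : √(p : ℝ) * √p = p := Real.mul_self_sqrt hp'.le
  obtain ⟨c, hc⟩ : ∃ c : ℝ, c = √(∑ i, nsq (A i)) := ⟨_, rfl⟩
  have hc0 : 0 ≤ c := hc ▸ Real.sqrt_nonneg _
  have key : ∀ n : ℕ, ∀ x : ι → ℝ, SparseUnit p x → √(nsq (A *ᵥ x)) ≤ 2 * M + (1 / 2) ^ n * c := by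
    intro n
    induction n with
    | zero =>
      intro x hx
      have h1 : √(nsq (A *ᵥ x)) ≤ c := by
        rw [hc]
        apply Real.sqrt_le_sqrt
        refine (nsq_mulVec_le_frob A x).trans ?_
        exact mul_le_of_le_one_right (sum_nonneg fun _ _ => nsq_nonneg _) hx.2
      simp only [pow_zero, one_mul]
      linarith
    | succ n ih =>
      intro x hx
      choose z hz1 hz2 using fun j => exists_trunc (2 * √p * x j)
      have hz1' : ∀ j, |(z j : ℝ)| ≤ 2 * √p * |x j| := fun j => by
        have := hz1 j
        rwa [abs_mul, abs_of_nonneg (show (0 : ℝ) ≤ 2 * √p by positivity)] at this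
      have hz0 : ∀ j, x j = 0 → (z j : ℝ) = 0 := fun j hj => by
        have := hz1' j
        rw [hj, abs_zero, mul_zero] at this
        exact abs_nonpos_iff.1 this
      have hsum : ∑ j, |z j| ≤ (2 * p : ℕ) := by
        have h1 := sum_abs_le_sqrt x p hx.1 hx.2
        have h2 : ∑ j, |(z j : ℝ)| ≤ 2 * p := by
          calc _ ≤ ∑ j, 2 * √p * |x j| := sum_le_sum fun j _ => hz1' j
            _ = 2 * √p * ∑ j, |x j| := by rw [mul_sum]
            _ ≤ 2 * √p * √p := by gcongr
            _ = 2 * p := by rw [mul_assoc, hspp]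
        exact_mod_cast h2
      have hnsq : nsq (fun j => (z j : ℝ)) ≤ 4 * p := by
        calc nsq (fun j => (z j : ℝ)) ≤ ∑ j, (2 * √p * |x j|) ^ 2 :=
              sum_le_sum fun j _ => by
                rw [← sq_abs]; exact pow_le_pow_left₀ (abs_nonneg _) (hz1' j) 2
          _ = 4 * p * nsq x := by
              rw [nsq, mul_sum]
              refine sum_congr rfl fun j _ => ?_
              rw [mul_pow, mul_pow, Real.sq_sqrt hp'.le, sq_abs]; norm_num
          _ ≤ 4 * p * 1 := by gcongr; exact hx.2
          _ = _ := mul_one _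
      have hN := h z hsum hnsq
      set y : ι → ℝ := (1 / (2 * √p)) • fun j => (z j : ℝ) with hy
      set e : ι → ℝ := (2 : ℝ) • (x - y) with he
      have hye : ∀ j, x j = 0 → y j = 0 := fun j hj => by
        rw [hy, Pi.smul_apply, hz0 j hj, smul_zero]
      have heu : SparseUnit p e := by
        constructor
        · refine (card_le_card fun j hj => ?_).trans hx.1
          rw [mem_filter] at hj ⊢
          refine ⟨hj.1, fun h0 => hj.2 ?_⟩
          rw [he, Pi.smul_apply, Pi.sub_apply, h0, hye j h0, sub_zero, smul_zero]
        · have h1 : ∀ j, e j ^ 2 ≤ if x j ≠ 0 then (1 : ℝ) / p else 0 := by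
            intro j
            split_ifs with hj
            · have h2 : e j = 1 / √p * (2 * √p * x j - z j) := by
                rw [he, hy]
                simp only [Pi.smul_apply, Pi.sub_apply, smul_eq_mul]
                field_simp
              rw [h2, mul_pow, div_pow, Real.sq_sqrt hp'.le, one_pow]
              refine mul_le_of_le_one_right (by positivity) ?_
              exact (sq_le_one_iff_abs_le_one _).2 (hz2 j)
            · push Not at hj
              rw [he, Pi.smul_apply, Pi.sub_apply, hj, hye j hj]
              simp
          calc nsq e ≤ ∑ j, if x j ≠ 0 then (1 : ℝ) / p else 0 := sum_le_sum fun j _ => h1 j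
            _ = #(univ.filter fun j => x j ≠ 0) * (1 / p : ℝ) := by
                rw [← sum_filter, sum_const, nsmul_eq_mul]
            _ ≤ p * (1 / p : ℝ) := by
                gcongr
                exact hx.1
            _ = 1 := by field_simp
      have h3 : x = y + (1 / 2 : ℝ) • e := by
        ext j
        rw [he]
        simp only [Pi.add_apply, Pi.smul_apply, Pi.sub_apply, smul_eq_mul]
        ring
      have h4 := ih e heu
      rw [h3, Matrix.mulVec_add, Matrix.mulVec_smul A (1 / 2 : ℝ) e]
      refine (sqrt_nsq_add_le _ _).trans ?_
      rw [sqrt_nsq_smul (1 / 2 : ℝ) (A *ᵥ e), abs_of_nonneg (by norm_num), pow_succ]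
      linarith
  refine le_of_forall_pos_le_add fun δ hδ => ?_
  obtain ⟨n, hn⟩ := exists_pow_lt_of_lt_one (show 0 < δ / (c + 1) by positivity)
    (show (1 / 2 : ℝ) < 1 by norm_num)
  refine (key n x hx).trans ?_
  have : (1 / 2 : ℝ) ^ n * c ≤ δ := by
    calc _ ≤ δ / (c + 1) * (c + 1) := by gcongr; linarith
      _ = δ := by field_simp
  linarith

end Net

section Blocks

variable {G α β : Type*} [AddCommGroup G] [Fintype G] [DecidableEq G] [Fintype α] [Fintype β]

open scoped Classical in
/-- With high probability all blocks of the partial circulant matrix are bounded on `p`-sparse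
vectors. -/
lemma block_tail {ω : β × α → G} (hω : Function.Injective ω) (p : ℕ) (hp : 0 < p)
    (hα : 0 < Fintype.card α)
    (hpβ : Real.log (Fintype.card β) ≤ p)
    (hB : p ^ 2 * Real.log (2 * Fintype.card G + 1) ≤ 8 * Fintype.card α) :
    (16 : ℝ) * #(univ.filter fun s : G → Bool => ¬ ∀ b (x : G → ℝ),
      #(univ.filter fun j => x j ≠ 0) ≤ p →
        nsq (circ (fun i => ω (b, i)) (sv s) *ᵥ x) ≤ 327808 * Fintype.card α * nsq x) ≤
      Fintype.card (G → Bool) := by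
  cases isEmpty_or_nonempty β with
  | inl hβ =>
    have : (univ.filter fun s : G → Bool => ¬ ∀ b (x : G → ℝ),
      #(univ.filter fun j => x j ≠ 0) ≤ p →
        nsq (circ (fun i => ω (b, i)) (sv s) *ᵥ x) ≤ 327808 * Fintype.card α * nsq x) = ∅ :=
      filter_eq_empty_iff.2 fun s _ => not_not.2 fun b => hβ.elim b
    rw [this]
    simp
  | inr hβ =>
    have hα' : (0 : ℝ) < Fintype.card α := by exact_mod_cast hα
    have hp' : (1 : ℝ) ≤ p := by exact_mod_cast hp
    have hsp : 0 < √(p : ℝ) := Real.sqrt_pos.2 (by linarith)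
    set Λ := Real.log (2 * Fintype.card G + 1) with hΛ
    have hΛ1 : 1 ≤ Λ := one_le_log_two_mul_add_one Fintype.card_pos
    obtain ⟨S, hS, hmem⟩ := exists_int_ball (ι := G) (2 * p)
    set S' := S.filter fun z : G → ℤ => ∑ j, |z j| ≤ ((2 * p : ℕ) : ℤ) ∧
      nsq (fun j => (z j : ℝ)) ≤ 4 * p with hS'
    let y : S' → G → ℝ := fun z => (1 / (2 * √p)) • fun j => (z.1 j : ℝ)
    have hy1 : ∀ z, nsq (y z) ≤ 1 := by
      intro z
      have h1 := (mem_filter.1 z.2).2.2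
      simp only [y]
      rw [nsq_smul, div_pow, mul_pow, Real.sq_sqrt (by linarith)]
      rw [one_pow, one_div, inv_mul_le_iff₀ (by positivity)]
      linarith
    have hy2 : ∀ z, ∑ t, |y z t| ≤ √p := by
      intro z
      have h1 := (mem_filter.1 z.2).2.1
      have h2 : ∑ j, |(z.1 j : ℝ)| ≤ 2 * p := by exact_mod_cast h1
      have h3 : ∑ t, |y z t| = 1 / (2 * √p) * ∑ j, |(z.1 j : ℝ)| := by
        rw [mul_sum]
        refine sum_congr rfl fun j _ => ?_
        simp only [y]
        rw [Pi.smul_apply, smul_eq_mul, abs_mul, abs_of_nonneg (by positivity)]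
      rw [h3]
      calc _ ≤ 1 / (2 * √p) * (2 * (√p * √p)) := by
            rw [Real.mul_self_sqrt (by linarith)]; gcongr
        _ = √p := by field_simp
    let V : β × S' → Matrix α G ℝ := fun x => circ (fun i => ω (x.1, i)) (y x.2)
    have hzmem : (0 : G → ℤ) ∈ S' := by
      refine mem_filter.2 ⟨hmem _ (by simp), by simp, ?_⟩
      simp [nsq]
    have : Nonempty S' := ⟨⟨_, hzmem⟩⟩
    choose t ht using fun s : G → Bool => Finite.exists_max fun x => nsq (V x *ᵥ sv s)
    have hV : ∀ x u, nsq (V x *ᵥ u) ≤ √p ^ 2 * nsq u := by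
      intro x u
      refine nsq_circ_mulVec_le (fun i j hij => ?_) _ _ fun ψ => ?_
      · exact (Prod.mk.inj (hω hij)).2
      · refine (nsq_charMat_mulVec_le ψ _).trans ?_
        exact pow_le_pow_left₀ (sum_nonneg fun _ _ => abs_nonneg _) (hy2 _) 2
    have hE := expect_family_le V (F := Fintype.card α) (r := √p) (fun x => by
      rw [sum_nsq_circ]
      exact mul_le_of_le_one_right (Nat.cast_nonneg _) (hy1 _)) (Nat.cast_nonneg _)
      (Real.sqrt_nonneg _) hV t
    have hlog : Real.log (2 * (Fintype.card (β × S') + 1)) ≤ 5 * p * Λ := by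
      have hβ' : (1 : ℝ) ≤ Fintype.card β := by exact_mod_cast Fintype.card_pos
      have h1 : (Fintype.card (β × S') : ℝ) ≤
          Fintype.card β * (2 * Fintype.card G + 1) ^ (2 * p) := by
        rw [Fintype.card_prod, Fintype.card_coe]
        push_cast
        gcongr
        exact_mod_cast (card_filter_le _ _).trans hS
      have h2 : (1 : ℝ) ≤ Fintype.card β * (2 * Fintype.card G + 1) ^ (2 * p) :=
        one_le_mul_of_one_le_of_one_le hβ' (one_le_pow₀ (by
          have : (0 : ℝ) ≤ Fintype.card G := Nat.cast_nonneg _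
          linarith))
      have h3 : Real.log (2 * (Fintype.card (β × S') + 1)) ≤
          Real.log (4 * (Fintype.card β * (2 * Fintype.card G + 1) ^ (2 * p))) :=
        Real.log_le_log (by positivity) (by linarith)
      rw [Real.log_mul (x := 4) (by norm_num) (by positivity),
        Real.log_mul (x := (Fintype.card β : ℝ)) (zero_lt_one.trans_le hβ').ne' (by positivity),
        Real.log_pow, ← hΛ,
        show (4 : ℝ) = 2 ^ 2 by norm_num, Real.log_pow] at h3
      push_cast at h3
      have := Real.log_two_lt_d9
      nlinarith [mul_le_mul_of_nonneg_left hΛ1 (by linarith : (0 : ℝ) ≤ p)]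
    have hE' : 𝔼 s, nsq (V (t s) *ᵥ sv s) ≤ 5122 * Fintype.card α := by
      refine hE.trans ?_
      rw [Real.sq_sqrt (by linarith)]
      calc _ ≤ 2 * (Fintype.card α : ℝ) + 128 * (5 * p * Λ) * p := by gcongr
        _ = 2 * (Fintype.card α : ℝ) + 640 * (p ^ 2 * Λ) := by ring
        _ ≤ 2 * (Fintype.card α : ℝ) + 640 * (8 * Fintype.card α) := by gcongr
        _ = _ := by ring
    refine card_mul_le_of_expect_le (α := G → Bool) _ (fun s => nsq_nonneg _)
      (show (0 : ℝ) < 5122 * Fintype.card α by positivity) hE' _ fun s hs => ?_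
    by_contra hlt
    push Not at hlt
    refine hs fun b x hx => ?_
    set Q := √(16 * (5122 * Fintype.card α) : ℝ) with hQ
    have hQ2 : Q ^ 2 = 16 * (5122 * Fintype.card α) := Real.sq_sqrt (by positivity)
    have hnet := sqrt_nsq_mulVec_le_of_net (circ (fun i => ω (b, i)) (sv s)) hp
      (Real.sqrt_nonneg _ : 0 ≤ Q) (fun z hz1 hz2 => by
        rw [circ_mulVec_comm]
        apply Real.sqrt_le_sqrt
        exact (ht s (b, ⟨z, mem_filter.2 ⟨hmem z hz1, hz1, hz2⟩⟩)).trans hlt.le)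
    by_cases hx0 : nsq x = 0
    · have hz : x = 0 := by
        ext j
        have := (sum_eq_zero_iff_of_nonneg fun j _ => sq_nonneg (x j)).1 hx0 j (mem_univ j)
        simpa using this
      rw [hz, Matrix.mulVec_zero, nsq_zero, nsq_zero, mul_zero]
    · have hx1 : 0 < nsq x := lt_of_le_of_ne (nsq_nonneg x) (Ne.symm hx0)
      have hsx : 0 < √(nsq x) := Real.sqrt_pos.2 hx1
      have h1 := hnet ((1 / √(nsq x)) • x) ⟨(card_le_card fun j hj => by
        rw [mem_filter] at hj ⊢
        exact ⟨hj.1, fun h0 => hj.2 (by rw [Pi.smul_apply, h0, smul_zero])⟩).trans hx, by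
        rw [nsq_smul, div_pow, Real.sq_sqrt hx1.le, one_pow, one_div_mul_cancel hx0]⟩
      rw [Matrix.mulVec_smul, Real.sqrt_le_left (by positivity), nsq_smul, div_pow,
        Real.sq_sqrt hx1.le, one_pow, mul_pow, hQ2, one_div, inv_mul_le_iff₀ hx1] at h1
      linarith

end Blocks

section Combine

/-- A union bound over a product of finite probability spaces. -/
lemma card_filter_prod_le {S T : Type*} [Fintype S] [Fintype T] (P : S × T → Prop)
    (Q₁ Q₂ : S → Prop) [DecidablePred P] [DecidablePred Q₁] [DecidablePred Q₂]
    {c : ℝ} (h₁ : c * #(univ.filter Q₁) ≤ Fintype.card S)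
    (h₂ : c * #(univ.filter Q₂) ≤ Fintype.card S) (hc : 0 ≤ c)
    (h₃ : ∀ s, ¬ Q₁ s → ¬ Q₂ s → c * #(univ.filter fun t => P (s, t)) ≤ Fintype.card T) :
    c * #(univ.filter P) ≤ 3 * Fintype.card (S × T) := by
  have h : (#(univ.filter P) : ℝ) = ∑ s, (#(univ.filter fun t => P (s, t)) : ℝ) := by
    rw [card_filter, Fintype.sum_prod_type]
    push_cast
    refine sum_congr rfl fun s _ => ?_
    rw [card_filter]
    push_cast
    rfl
  have hT : (0 : ℝ) ≤ Fintype.card T := Nat.cast_nonneg _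
  have hs : ∀ s, c * (#(univ.filter fun t => P (s, t)) : ℝ) ≤
      c * Fintype.card T * (if Q₁ s then 1 else 0) +
        c * Fintype.card T * (if Q₂ s then 1 else 0) + Fintype.card T := by
    intro s
    have hle : (#(univ.filter fun t => P (s, t)) : ℝ) ≤ Fintype.card T := by
      exact_mod_cast card_le_univ _
    have hle' := mul_le_mul_of_nonneg_left hle hc
    have hcT := mul_nonneg hc hT
    by_cases q₁ : Q₁ s
    · rw [if_pos q₁]
      split_ifs <;> linarith
    · by_cases q₂ : Q₂ s
      · rw [if_pos q₂, if_neg q₁]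
        linarith
      · rw [if_neg q₁, if_neg q₂]
        linarith [h₃ s q₁ q₂]
  have hQ : ∀ (Q : S → Prop) [DecidablePred Q], ∑ s, (if Q s then (1 : ℝ) else 0) = #(univ.filter Q) := fun Q _ => by
    rw [card_filter]
    push_cast
    rfl
  calc c * (#(univ.filter P) : ℝ) = ∑ s, c * (#(univ.filter fun t => P (s, t)) : ℝ) := by
        rw [h, mul_sum]
    _ ≤ ∑ s, (c * Fintype.card T * (if Q₁ s then 1 else 0) +
        c * Fintype.card T * (if Q₂ s then 1 else 0) + Fintype.card T) :=
        sum_le_sum fun s _ => hs s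
    _ = Fintype.card T * (c * #(univ.filter Q₁)) + Fintype.card T * (c * #(univ.filter Q₂)) +
        Fintype.card S * Fintype.card T := by
        rw [sum_add_distrib, sum_add_distrib, ← mul_sum, ← mul_sum, hQ, hQ, sum_const, card_univ,
          nsmul_eq_mul]
        ring
    _ ≤ Fintype.card T * Fintype.card S + Fintype.card T * Fintype.card S +
        Fintype.card S * Fintype.card T := by gcongr
    _ = _ := by
        rw [Fintype.card_prod]
        push_cast
        ring

variable {G α β : Type*} [AddCommGroup G] [Fintype G] [Fintype α] [Fintype β]

lemma sum_nsq_circ_blocks (ω : β × α → G) (u x : G → ℝ) :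
    ∑ b, nsq (circ (fun i => ω (b, i)) u *ᵥ x) = nsq (circ ω x *ᵥ u) := by
  rw [nsq, Fintype.sum_prod_type]
  refine sum_congr rfl fun b => ?_
  intro _
  rw [circ_mulVec_comm]
  rfl

variable [DecidableEq G] [DecidableEq β]

open scoped Classical in
/-- Tail bound for the hashed partial circulant matrix on real sparse vectors. -/
lemma hashed_circ_tail {ω : β × α → G} (hω : Function.Injective ω) (k p q : ℕ) (hp : 0 < p)
    (hpk : p ≤ k) (hq : k ≤ 2 ^ q) (hα : 0 < Fintype.card α) (hβ : 0 < Fintype.card β)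
    (hpβ : Real.log (Fintype.card β) ≤ p)
    (hB : p ^ 2 * Real.log (2 * Fintype.card G + 1) ≤ 8 * Fintype.card α) {γ θ : ℝ}
    (hγ₁ : 120 * √(300 * Real.log (2 * Fintype.card G + 1)) *
      √(k * Real.log (2 * Fintype.card G + 1)) * (q + 3) ≤ γ)
    (hγ₂ : 120 * √((2 + 384 * 327808) * Fintype.card α) *
      √(k * Real.log (2 * Fintype.card G + 1)) * (q + 3) ≤ γ)
    (hθ0 : 0 < θ) (hθM : θ ≤ Fintype.card (β × α))
    (hθ : 128 * γ * √(2 * (2 * Fintype.card (β × α)) + 64 * γ ^ 2) ≤ θ) :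
    (16 : ℝ) * #(univ.filter fun s : (G → Bool) × (β × α → Bool) => ¬ ∀ x, SparseUnit k x →
      |nsq (blockDiag (fun b => circ (fun i => ω (b, i)) (sv s.1)) x *ᵥ sv s.2) -
        Fintype.card (β × α) * nsq x| ≤ 2 * θ) ≤
      3 * Fintype.card ((G → Bool) × (β × α → Bool)) := by
  have hγ0 : 0 ≤ γ := le_trans (by positivity) hγ₁
  have hM : (0 : ℝ) ≤ Fintype.card (β × α) := Nat.cast_nonneg _
  have hθ' : 128 * γ * √(2 * Fintype.card (β × α) + 64 * γ ^ 2) ≤ θ := by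
    refine le_trans ?_ hθ
    gcongr
    linarith
  have h₁ := circ_tail hω k q (hp.trans_le hpk) hq hγ₁ hθ0 hθ'
  have h₂ := block_tail hω p hp hα hpβ hB
  refine card_filter_prod_le _ _ _ h₁ h₂ (by norm_num) ?_
  clear h₁ h₂
  intro s h₁ h₂
  push Not at h₁
  rw [not_not] at h₂
  have hF : ∀ x, SparseUnit k x → ∑ b, nsq (circ (fun i => ω (b, i)) (sv s) *ᵥ x) ≤
      2 * Fintype.card (β × α) := by
    intro x hx
    have h := (abs_le.1 (h₁ x hx)).2
    rw [sum_nsq_circ_blocks]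
    have := mul_le_of_le_one_right hM hx.2
    linarith
  have h₃ := hash_tail (fun b => circ (fun i => ω (b, i)) (sv s))
    (fun b i j => sgn_sq _) k p q hp hpk hq Fintype.card_pos hβ hα hpβ (by norm_num) h₂ hF hγ₂
    hθ0 hθ
  refine le_trans ?_ h₃
  gcongr with t
  intro ht
  push Not at ht
  obtain ⟨x, hx, hlt⟩ := ht
  refine ⟨x, hx, ?_⟩
  by_contra hle
  push Not at hle
  have h₃ := h₁ x hx
  rw [← sum_nsq_circ_blocks] at h₃
  have := abs_sub_le (nsq (blockDiag (fun b => circ (fun i => ω (b, i)) (sv s)) x *ᵥ sv t))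
    (∑ b, nsq (circ (fun i => ω (b, i)) (sv s) *ᵥ x)) (Fintype.card (β × α) * nsq x)
  linarith

end Combine

section Parameters

lemma exists_pos_le_mul_log_sq :
    ∃ c : ℝ, 0 < c ∧ c ≤ 1 ∧ ∀ k d : ℕ, 0 < k → 2 ≤ d →
      c ≤ k * Real.log d * Real.log (k * Real.log d) ^ 2 := by
  have h2 : (0 : ℝ) < Real.log 2 := Real.log_pos (by norm_num)
  have h2' : Real.log 2 < 1 := by linarith [Real.log_two_lt_d9]
  have h22 : (1 : ℝ) < 2 * Real.log 2 := by linarith [Real.log_two_gt_d9]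
  have hlarge : ∀ t₀ t : ℝ, 1 < t₀ → t₀ ≤ t → Real.log t₀ ^ 2 ≤ t * Real.log t ^ 2 := by
    intro t₀ t h₀ h
    have h3 := Real.log_pos h₀
    have h4 : Real.log t₀ ≤ Real.log t := Real.log_le_log (by linarith) h
    calc Real.log t₀ ^ 2 ≤ Real.log t ^ 2 := by gcongr
      _ ≤ t * Real.log t ^ 2 := le_mul_of_one_le_left (sq_nonneg _) (by linarith)
  have ha : 0 < Real.log 2 * Real.log (Real.log 2) ^ 2 :=
    mul_pos h2 (sq_pos_iff.2 (Real.log_neg h2 h2').ne)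
  have hb : 0 < Real.log (Real.log 3) ^ 2 := pow_pos (Real.log_pos one_lt_log_three) 2
  have hc : 0 < Real.log (2 * Real.log 2) ^ 2 := pow_pos (Real.log_pos h22) 2
  refine ⟨min (Real.log 2 * Real.log (Real.log 2) ^ 2)
    (min (Real.log (Real.log 3) ^ 2) (min (Real.log (2 * Real.log 2) ^ 2) 1)),
    by positivity, by simp, fun k d hk hd => ?_⟩
  rcases Nat.eq_or_lt_of_le hk with hk1 | hk1
  · rcases Nat.eq_or_lt_of_le hd with hd1 | hd1
    · rw [← hk1, ← hd1]
      refine (min_le_left _ _).trans ?_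
      norm_num
    · refine ((min_le_right _ _).trans (min_le_left _ _)).trans
        (hlarge _ _ one_lt_log_three ?_)
      rw [← hk1]
      have : Real.log 3 ≤ Real.log d := Real.log_le_log (by norm_num) (by exact_mod_cast hd1)
      simpa using this
  · refine (((min_le_right _ _).trans (min_le_right _ _)).trans (min_le_left _ _)).trans
      (hlarge _ _ h22 ?_)
    have h5 : Real.log 2 ≤ Real.log d := Real.log_le_log (by norm_num) (by exact_mod_cast hd)
    have h6 : (2 : ℝ) ≤ k := by exact_mod_cast hk1
    gcongr

/-- Choice of the sparsity level of the blocks, of the chaining depth and of the radius. -/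
lemma exists_parameters :
    ∃ C : ℝ, 0 < C ∧ ∀ (ε : ℝ) (m B k d : ℕ), 0 < ε → ε < 1 → 0 < m → 0 < B → 0 < k →
      (B : ℝ) ≥ (Real.log m) ^ 2 * (Real.log k) ^ 2 * (Real.log d) ^ 2 →
      (k : ℝ) ≥ (Real.log m) ^ 2 →
      (m : ℝ) ≥ C * ((k : ℝ) * Real.log d * (Real.log ((k : ℝ) * Real.log d)) ^ 2 / ε ^ 2) →
      m * B < d →
      ∃ (p q : ℕ) (γ : ℝ), 0 < p ∧ p ≤ k ∧ k ≤ 2 ^ q ∧ Real.log m ≤ p ∧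
        p ^ 2 * Real.log (2 * d + 1) ≤ 8 * B ∧
        120 * √(300 * Real.log (2 * d + 1)) * √(k * Real.log (2 * d + 1)) * (q + 3) ≤ γ ∧
        120 * √((2 + 384 * 327808) * B) * √(k * Real.log (2 * d + 1)) * (q + 3) ≤ γ ∧
        128 * γ * √(2 * (2 * (m * B)) + 64 * γ ^ 2) ≤ ε * (m * B) / 2 := by
  obtain ⟨c, hc0, hc1, hc⟩ := exists_pos_le_mul_log_sq
  refine ⟨10 ^ 20 / c, by positivity, fun ε m B k d hε0 hε1 hm hB hk hBl hkl hml hd => ?_⟩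
  have hm1 : (1 : ℝ) ≤ m := by exact_mod_cast hm
  have hB1 : (1 : ℝ) ≤ B := by exact_mod_cast hB
  have hk1 : (1 : ℝ) ≤ k := by exact_mod_cast hk
  have hmB : 0 < m * B := Nat.mul_pos hm hB
  have hcQ := hc k d hk (by omega)
  have hmd : (m : ℝ) ≤ d := by
    exact_mod_cast (Nat.le_mul_of_pos_right m hB).trans hd.le
  obtain ⟨L, hL⟩ : ∃ L, L = Real.log d := ⟨_, rfl⟩
  obtain ⟨K, hK⟩ : ∃ K, K = Real.log k := ⟨_, rfl⟩
  obtain ⟨ℓ, hℓ⟩ : ∃ ℓ, ℓ = Real.log m := ⟨_, rfl⟩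
  obtain ⟨Q, hQ⟩ : ∃ Q, Q = k * L * Real.log (k * L) ^ 2 := ⟨_, rfl⟩
  rw [← hL, ← hQ] at hcQ
  rw [← hL, ← hQ] at hml
  rw [← hL, ← hK, ← hℓ] at hBl
  rw [← hℓ] at hkl
  have hε2 : 0 < ε ^ 2 := by positivity
  have hε2' : ε ^ 2 ≤ 1 := pow_le_one₀ hε0.le hε1.le
  have hQ0 : 0 ≤ Q := hc0.le.trans hcQ
  have hQm : 10 ^ 20 * Q ≤ ε ^ 2 * m := by
    calc 10 ^ 20 * Q ≤ 10 ^ 20 / c * Q := by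
          gcongr
          rw [le_div_iff₀ hc0]
          linarith
      _ = ε ^ 2 * (10 ^ 20 / c * (Q / ε ^ 2)) := by field_simp
      _ ≤ ε ^ 2 * m := by gcongr
  have hm20 : (10 : ℝ) ^ 20 ≤ m := by
    calc (10 : ℝ) ^ 20 = 10 ^ 20 / c * (c / 1) := by field_simp
      _ ≤ 10 ^ 20 / c * (Q / ε ^ 2) := by gcongr
      _ ≤ m := hml
  have hℓ2 : 2 ≤ ℓ := by
    rw [hℓ, Real.le_log_iff_exp_le (by linarith)]
    have := Real.exp_one_lt_d9
    calc Real.exp 2 = Real.exp 1 ^ 2 := by rw [← Real.exp_nat_mul]; norm_num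
      _ ≤ 3 ^ 2 := by gcongr; linarith
      _ ≤ m := by linarith
  have hL2 : 2 ≤ L := hℓ2.trans (by
    rw [hℓ, hL]
    exact Real.log_le_log (by linarith) hmd)
  have hk4 : (4 : ℝ) ≤ k := by nlinarith only [hℓ2, hkl]
  have hK1 : 1 ≤ K := by
    rw [hK, Real.le_log_iff_exp_le (by linarith)]
    linarith [Real.exp_one_lt_d9]
  have hKQ : k * L * K ^ 2 ≤ Q := by
    rw [hQ]
    have : K ≤ Real.log (k * L) := by
      rw [hK]
      exact Real.log_le_log (by linarith) (le_mul_of_one_le_right (by linarith) (by linarith))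
    gcongr
  have hBL : L ≤ B := by
    calc L ≤ 1 * 1 * L ^ 2 := by nlinarith only [hL2]
      _ ≤ ℓ ^ 2 * K ^ 2 * L ^ 2 := by
        gcongr
        · exact one_le_pow₀ (by linarith)
        · exact one_le_pow₀ hK1
      _ ≤ B := hBl
  obtain ⟨Λ, hΛ⟩ : ∃ Λ, Λ = Real.log (2 * d + 1) := ⟨_, rfl⟩
  rw [← hΛ]
  have hΛ0 : 0 ≤ Λ := by
    rw [hΛ]
    exact Real.log_nonneg (by linarith)
  have hΛL : Λ ≤ 2 * L := by
    have h1 : Real.log (d ^ 2) = 2 * L := by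
      rw [Real.log_pow, hL]
      norm_num
    rw [hΛ, ← h1]
    exact Real.log_le_log (by linarith) (by nlinarith only [hm20, hmd])
  have hpu : (⌈ℓ⌉₊ : ℝ) ≤ ℓ + 1 := (Nat.ceil_lt_add_one (by linarith)).le
  have hqK : (Nat.clog 2 k : ℝ) + 3 ≤ 5.5 * K := by
    have h1 : 2 ^ (Nat.clog 2 k - 1) < k := by
      have := Nat.pow_pred_clog_lt_self (b := 2) (by norm_num) (x := k)
        (by have : 4 ≤ k := by exact_mod_cast hk4
            omega)
      simpa using this
    have h2 : ((Nat.clog 2 k - 1 : ℕ) : ℝ) * Real.log 2 ≤ K := by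
      rw [← Real.log_pow, hK]
      exact Real.log_le_log (by positivity) (by exact_mod_cast h1.le)
    have h3 : (Nat.clog 2 k : ℝ) ≤ ((Nat.clog 2 k - 1 : ℕ) : ℝ) + 1 := by
      have : Nat.clog 2 k ≤ Nat.clog 2 k - 1 + 1 := by omega
      exact_mod_cast this
    have h4 := Real.log_two_gt_d9
    have h5 : (0 : ℝ) ≤ ((Nat.clog 2 k - 1 : ℕ) : ℝ) := Nat.cast_nonneg _
    nlinarith only [h2, h3, h4, h5, hK1]
  have hM0 : (0 : ℝ) < m * B := by positivity
  obtain ⟨M, hM⟩ : ∃ M : ℝ, M = m * B := ⟨_, rfl⟩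
  rw [← hM] at hM0 ⊢
  have hγ : (1 / 600 * ε * √M) ^ 2 = ε ^ 2 * M / 360000 := by
    rw [mul_pow, mul_pow, Real.sq_sqrt hM0.le]
    ring
  have hcore : 10 ^ 20 * (k * L * K ^ 2 * B) ≤ ε ^ 2 * M := by
    calc _ = 10 ^ 20 * (k * L * K ^ 2) * B := by ring
      _ ≤ 10 ^ 20 * Q * B := by gcongr
      _ ≤ ε ^ 2 * m * B := by gcongr
      _ = ε ^ 2 * M := by rw [hM]; ring
  have hq0 : (0 : ℝ) ≤ (Nat.clog 2 k : ℝ) + 3 := by positivity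
  have hk0 : (0 : ℝ) ≤ k := by linarith
  have hbound : ∀ D : ℝ, 0 ≤ D → D ≤ (2 + 384 * 327808) * B →
      120 * √D * √(k * Λ) * ((Nat.clog 2 k : ℝ) + 3) ≤ 1 / 600 * ε * √M := by
    intro D hD0 hD
    refine le_of_sq_le_sq ?_ (by positivity)
    rw [hγ]
    calc (120 * √D * √(k * Λ) * ((Nat.clog 2 k : ℝ) + 3)) ^ 2 =
          14400 * D * (k * Λ) * ((Nat.clog 2 k : ℝ) + 3) ^ 2 := by
          rw [mul_pow, mul_pow, mul_pow, Real.sq_sqrt hD0, Real.sq_sqrt (by positivity)]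
          norm_num
      _ ≤ 14400 * ((2 + 384 * 327808) * B) * (k * (2 * L)) * (5.5 * K) ^ 2 := by gcongr
      _ = 14400 * (2 + 384 * 327808) * 60.5 * (k * L * K ^ 2 * B) := by ring
      _ ≤ 10 ^ 20 * (k * L * K ^ 2 * B) / 360000 := by
          have : 0 ≤ k * L * K ^ 2 * B := by positivity
          linarith
      _ ≤ ε ^ 2 * M / 360000 := by gcongr
  refine ⟨⌈ℓ⌉₊, Nat.clog 2 k, 1 / 600 * ε * √M, Nat.ceil_pos.2 (by linarith), ?_,
    Nat.le_pow_clog (by norm_num) k, hℓ ▸ Nat.le_ceil ℓ, ?_, hbound _ (by positivity) ?_,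
    hbound _ (by positivity) le_rfl, ?_⟩
  · have : (⌈ℓ⌉₊ : ℝ) ≤ k := by
      calc (⌈ℓ⌉₊ : ℝ) ≤ ℓ + 1 := hpu
        _ ≤ ℓ ^ 2 := by nlinarith only [hℓ2]
        _ ≤ k := hkl
    exact_mod_cast this
  · calc (⌈ℓ⌉₊ : ℝ) ^ 2 * Λ ≤ (2 * ℓ) ^ 2 * (2 * L) := by
          gcongr
          linarith
      _ = 8 * (ℓ ^ 2 * 1 * L) := by ring
      _ ≤ 8 * (ℓ ^ 2 * K ^ 2 * L ^ 2) := by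
          gcongr
          · exact one_le_pow₀ hK1
          · nlinarith only [hL2]
      _ ≤ 8 * B := by gcongr
  · linarith
  · have hs : √(2 * (2 * M) + 64 * (1 / 600 * ε * √M) ^ 2) ≤ 2.1 * √M := by
      rw [hγ, show (2.1 : ℝ) * √M = √(2.1 ^ 2 * M) by
        rw [Real.sqrt_mul (by norm_num), Real.sqrt_sq (by norm_num)]]
      apply Real.sqrt_le_sqrt
      have := mul_le_mul_of_nonneg_right hε2' hM0.le
      linarith
    calc _ ≤ 128 * (1 / 600 * ε * √M) * (2.1 * √M) := by gcongr
      _ = 128 / 600 * 2.1 * ε * (√M * √M) := by ring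
      _ = 128 / 600 * 2.1 * (ε * M) := by rw [Real.mul_self_sqrt hM0.le]; ring
      _ ≤ ε * M / 2 := by
          have : 0 < ε * M := by positivity
          linarith

end Parameters

section Complexification

lemma abs_nsq_mulVec_sub_le {ι κ : Type*} [Fintype ι] [Fintype κ] (R : Matrix κ ι ℝ) {k : ℕ}
    {M η : ℝ} (h : ∀ x, SparseUnit k x → |nsq (R *ᵥ x) - M * nsq x| ≤ η) (x : ι → ℝ)
    (hx : #(univ.filter fun j => x j ≠ 0) ≤ k) : |nsq (R *ᵥ x) - M * nsq x| ≤ η * nsq x := by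
  by_cases hx0 : nsq x = 0
  · have hz : x = 0 := by
      ext j
      have := (sum_eq_zero_iff_of_nonneg fun j _ => sq_nonneg (x j)).1 hx0 j (mem_univ j)
      simpa using this
    rw [hz, Matrix.mulVec_zero, nsq_zero, nsq_zero]
    simp
  · have hx1 : 0 < nsq x := lt_of_le_of_ne (nsq_nonneg x) (Ne.symm hx0)
    have h1 := h ((1 / √(nsq x)) • x) ⟨(card_le_card fun j hj => by
      rw [mem_filter] at hj ⊢
      exact ⟨hj.1, fun h0 => hj.2 (by rw [Pi.smul_apply, h0, smul_zero])⟩).trans hx, by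
      rw [nsq_smul, div_pow, Real.sq_sqrt hx1.le, one_pow, one_div_mul_cancel hx0]⟩
    rw [Matrix.mulVec_smul, nsq_smul, nsq_smul, div_pow, Real.sq_sqrt hx1.le, one_pow,
      mul_left_comm, ← mul_sub, abs_mul, abs_of_pos (by positivity), one_div,
      inv_mul_le_iff₀ hx1] at h1
    linarith

lemma l2norm_sq {n : ℕ} (x : Fin n → ℂ) :
    l2norm x ^ 2 = nsq (fun j => (x j).re) + nsq (fun j => (x j).im) := by
  rw [l2norm, Real.sq_sqrt (sum_nonneg fun _ _ => sq_nonneg _), nsq, nsq, ← sum_add_distrib]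
  refine sum_congr rfl fun j _ => ?_
  rw [Complex.sq_norm, Complex.normSq_apply]
  ring

lemma l2norm_mvec_ofReal_sq {n d : ℕ} (R : Matrix (Fin n) (Fin d) ℝ) (x : Fin d → ℂ) :
    l2norm (mvec (fun b j => (R b j : ℂ)) x) ^ 2 =
      nsq (R *ᵥ fun j => (x j).re) + nsq (R *ᵥ fun j => (x j).im) := by
  rw [l2norm_sq]
  congr 2 <;> ext b <;> simp [mvec, Matrix.mulVec, dotProduct]

/-- A restricted isometry bound for a real matrix extends to complex sparse vectors. -/
lemma abs_l2norm_mvec_sub_le {n d k : ℕ} (R : Matrix (Fin n) (Fin d) ℝ) {M ε : ℝ} (hM : 0 < M)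
    (hε : 0 ≤ ε) (h : ∀ x, SparseUnit k x → |nsq (R *ᵥ x) - M * nsq x| ≤ ε * M)
    (x : Fin d → ℂ) (hx : x ∈ Tset d k) :
    |1 / M * l2norm (mvec (fun b j => (R b j : ℂ)) x) ^ 2 - l2norm x ^ 2| ≤ ε := by
  have hx1 : l2norm x ^ 2 ≤ 1 := pow_le_one₀ (Real.sqrt_nonneg _) hx.2
  have hre := abs_nsq_mulVec_sub_le R h (fun j => (x j).re) ((card_le_card fun j hj => by
    rw [mem_filter] at hj ⊢
    exact ⟨hj.1, fun h0 => hj.2 (by rw [h0, Complex.zero_re])⟩).trans hx.1)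
  have him := abs_nsq_mulVec_sub_le R h (fun j => (x j).im) ((card_le_card fun j hj => by
    rw [mem_filter] at hj ⊢
    exact ⟨hj.1, fun h0 => hj.2 (by rw [h0, Complex.zero_im])⟩).trans hx.1)
  rw [l2norm_mvec_ofReal_sq]
  rw [l2norm_sq] at hx1 ⊢
  set a := nsq (R *ᵥ fun j => (x j).re)
  set b := nsq (R *ᵥ fun j => (x j).im)
  set u := nsq fun j => (x j).re
  set v := nsq fun j => (x j).im
  have h1 : 1 / M * (a + b) - (u + v) = ((a - M * u) + (b - M * v)) / M := by
    field_simp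
    ring
  rw [h1, abs_div, abs_of_pos hM, div_le_iff₀ hM]
  have h2 := abs_add_le (a - M * u) (b - M * v)
  have h3 : ε * M * (u + v) ≤ ε * M := mul_le_of_le_one_right (by positivity) hx1
  linarith

end Complexification

section Main

lemma hIdx_injective (m B : ℕ) : Function.Injective fun r : Fin m × Fin B => hIdx m B r.1 r.2 := by
  rintro ⟨b, i⟩ ⟨b', i'⟩ h
  have h1 : b.1 * B + i.1 = b'.1 * B + i'.1 := congrArg Fin.val h
  have hB : 0 < B := i.pos
  have h2 : ∀ x y : ℕ, y < B → (x * B + y) / B = x := fun x y hy => by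
    rw [mul_comm, Nat.mul_add_div hB, Nat.div_eq_of_lt hy, add_zero]
  have hb : b.1 = b'.1 := by
    rw [← h2 b.1 i.1 i.2, h1, h2 b'.1 i'.1 i'.2]
  rw [hb] at h1
  exact Prod.ext (Fin.ext hb) (Fin.ext (by simpa using h1))

/-- The real matrix underlying the hashed partial circulant matrix. -/
def hashedMat {m B d : ℕ} [NeZero d] (Ω : Fin (m * B) ↪ Fin d)
    (s : (Fin d → Bool) × (Fin m × Fin B → Bool)) : Matrix (Fin m) (Fin d) ℝ :=
  fun b j => ∑ i, sgn (s.2 (b, i)) * sgn (s.1 (Ω (hIdx m B b i) - j))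

lemma hashedMat_mulVec {m B d : ℕ} [NeZero d] (Ω : Fin (m * B) ↪ Fin d)
    (s : (Fin d → Bool) × (Fin m × Fin B → Bool)) (x : Fin d → ℝ) :
    hashedMat Ω s *ᵥ x =
      blockDiag (fun b => circ (fun i => Ω (hIdx m B b i)) (sv s.1)) x *ᵥ sv s.2 := by
  ext b
  rw [blockDiag_mulVec]
  simp only [Matrix.mulVec, dotProduct, hashedMat, circ, sv, sum_mul]
  rw [sum_comm]
  refine sum_congr rfl fun i _ => sum_congr rfl fun j _ => ?_
  ring

lemma Phi_pcMatrix {m B d : ℕ} [NeZero d] (Ω : Fin (m * B) ↪ Fin d)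
    (ε : Fin d → Bool) (σ : Fin m × Fin B → Bool) :
    Phi m B d (pcMatrix (m * B) d Ω ε) (Function.curry σ) =
      fun b j => (hashedMat Ω (ε, σ) b j : ℂ) := by
  ext b j
  simp [Phi, pcMatrix, hashedMat, Function.curry]

end Main

/-- Theorem `circulant`: for the partial circulant ensemble on mB × d matrices
(mB ≤ d), if `B ≥ log²m log²k log²d` and `k ≥ log²m`, then for any
`m ≥ C·ε⁻²·k log d·log²(k log d)` with `m < d/B`, the hashed matrix `Φ` (with the sign
vector defining the circulant and the hashing signs random) satisfies the RIP bound with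
probability ≥ 3/4. -/
theorem stmt2 :
    ∃ C : ℝ, 0 < C ∧
      ∀ (ε : ℝ) (m B k d : ℕ) (Ω : Fin (m * B) ↪ Fin d),
        0 < ε → ε < 1 →
        0 < m → 0 < B → 0 < k → 0 < d →
        m * B ≤ d →
        -- restrictions
        (B : ℝ) ≥ (Real.log m) ^ 2 * (Real.log k) ^ 2 * (Real.log d) ^ 2 →
        (k : ℝ) ≥ (Real.log m) ^ 2 →
        -- m = O(ε⁻² k log d log²(k log d))
        (m : ℝ) ≥ C * ((k : ℝ) * Real.log d * (Real.log ((k : ℝ) * Real.log d)) ^ 2 / ε ^ 2) →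
        -- provided m < d/B
        (m : ℝ) < (d : ℝ) / B →
        -- conclusion: probability over the pair (circulant signs, hashing signs)
        (PMF.uniformOfFintype ((Fin d → Bool) × (Fin m → Fin B → Bool))).toMeasure
            {p | ∀ x ∈ Tset d k,
              |1 / ((m : ℝ) * B) *
                    (l2norm (mvec (Phi m B d (pcMatrix (m * B) d Ω p.1) p.2) x)) ^ 2
                  - (l2norm x) ^ 2| ≤ ε} ≥ 3 / 4 := by
  classical
  obtain ⟨C, hC, hpar⟩ := exists_parameters
  refine ⟨C, hC, fun ε m B k d Ω hε0 hε1 hm hB hk hd _ hBl hkl hml hmd => ?_⟩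
  have hB' : (0 : ℝ) < B := by exact_mod_cast hB
  have hm' : (0 : ℝ) < m := by exact_mod_cast hm
  have hmd' : m * B < d := by
    rw [lt_div_iff₀ hB'] at hmd
    exact_mod_cast hmd
  obtain ⟨p, q, γ, hp, hpk, hq, hpm, hpB, hγ₁, hγ₂, hγ⟩ :=
    hpar ε m B k d hε0 hε1 hm hB hk hBl hkl hml hmd'
  have : NeZero d := ⟨hd.ne'⟩
  have hM : (0 : ℝ) < m * B := by positivity
  have hcard : (Fintype.card (Fin m × Fin B) : ℝ) = m * B := by simp
  have htail := hashed_circ_tail (ω := fun r : Fin m × Fin B => Ω (hIdx m B r.1 r.2))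
    (fun _ _ h => hIdx_injective m B (Ω.injective h)) k p q hp hpk hq (by simpa using hB)
    (by simpa using hm) (by simpa using hpm) (by simpa using hpB) (γ := γ)
    (θ := ε * (m * B) / 2) (by simpa using hγ₁) (by simpa using hγ₂) (by positivity)
    (by rw [hcard]; nlinarith) (by rw [hcard]; exact hγ)
  rw [hcard] at htail
  let e : (Fin d → Bool) × (Fin m × Fin B → Bool) ≃ (Fin d → Bool) × (Fin m → Fin B → Bool) :=
    (Equiv.refl _).prodCongr (Equiv.curry _ _ _)
  let bad : (Fin d → Bool) × (Fin m × Fin B → Bool) → Prop := fun s => ¬ ∀ x, SparseUnit k x →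
    |nsq (blockDiag (fun b => circ (fun i => Ω (hIdx m B b i)) (sv s.1)) x *ᵥ sv s.2) -
      m * B * nsq x| ≤ 2 * (ε * (m * B) / 2)
  have htail' : (16 : ℝ) * #(univ.filter bad) ≤
      3 * Fintype.card ((Fin d → Bool) × (Fin m → Fin B → Bool)) := by
    rw [← Fintype.card_congr e]
    convert htail
  set E : Set ((Fin d → Bool) × (Fin m → Fin B → Bool)) := {p | ∀ x ∈ Tset d k,
    |1 / ((m : ℝ) * B) * (l2norm (mvec (Phi m B d (pcMatrix (m * B) d Ω p.1) p.2) x)) ^ 2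
      - (l2norm x) ^ 2| ≤ ε}
  have hbad : #(univ.filter fun s => s ∉ E) ≤ #(univ.filter bad) := by
    refine card_le_card_of_injOn e.symm (fun s hs => ?_) e.symm.injective.injOn
    rw [coe_filter, Set.mem_ofPred_eq] at hs ⊢
    refine ⟨mem_univ _, fun hgood => hs.2 fun x hx => ?_⟩
    have hs' : s.2 = Function.curry (e.symm s).2 := rfl
    have hs'' : s.1 = (e.symm s).1 := rfl
    rw [hs', hs'', Phi_pcMatrix]
    refine abs_l2norm_mvec_sub_le _ hM hε0.le (fun y hy => ?_) x hx
    rw [hashedMat_mulVec]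
    have := hgood y hy
    linarith
  set N := Fintype.card ((Fin d → Bool) × (Fin m → Fin B → Bool)) with hN
  have hN0 : 0 < N := Fintype.card_pos
  have hsplit : #(univ.filter fun s => s ∈ E) + #(univ.filter fun s => s ∉ E) = N := by
    rw [card_filter_add_card_filter_not, card_univ]
  have hgood : 3 * N ≤ #(univ.filter fun s => s ∈ E) * 4 := by
    have h1 : 16 * #(univ.filter fun s => s ∉ E) ≤ 3 * N := by
      refine le_trans (Nat.mul_le_mul_left _ hbad) ?_
      exact_mod_cast htail'
    omega
  rw [PMF.toMeasure_uniformOfFintype_apply _ (Set.toFinite _).measurableSet, Fintype.card_subtype]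
  change (3 / 4 : ENNReal) ≤ _
  rw [← hN, ENNReal.div_le_iff (by norm_num) (by norm_num), ← ENNReal.mul_div_right_comm,
    ENNReal.le_div_iff_mul_le (Or.inl (by exact_mod_cast hN0.ne')) (Or.inl (by simp))]
  exact_mod_cast hgood

end
end

section
/- Let A be an mB × d complex matrix whose rows a_i all satisfy ‖a_i‖_∞ ≤ 1, and suppose that for every s ≤ 2k, max_{b∈[m]} sup_{x∈T_s} ‖A_b x‖₂ ≤ Q₁√B + Q₂√s, where B ≥ max{Q₂² log² m, Q₁² log m · log k} and k ≥ Q₁² log² m. Then there is an absolute constant C such that for every u > 0, there exists a finite set 𝒩 ⊆ ℂ^d with |𝒩| ≤ (2d+1)^{⌈C·B/u²⌉} such that for every x ∈ T_k/√k there is y ∈ 𝒩 with ‖x − y‖_X ≤ u; that is, 𝒩(T_k/√k, ‖·‖_X, u) ≤ (2d+1)^{O(B/u²)}. -/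
open MeasureTheory Finset

noncomputable section

/-- The bucket matrix A_b, with rows a_{h(b,i)}, i ∈ [B]. -/
def bucket (m B d : ℕ) (A : Fin (m * B) → Fin d → ℂ) (b : Fin m) :
    Fin B → Fin d → ℂ :=
  fun i j => A (hIdx m B b i) j

/-- ‖x‖_X = max_b ‖A_b x‖₂. -/
def Xnorm (m B d : ℕ) (A : Fin (m * B) → Fin d → ℂ) (x : Fin d → ℂ) : ℝ :=
  ⨆ b : Fin m, l2norm (mvec (bucket m B d A b) x)

section Sampling

variable {E : Type*} [NormedAddCommGroup E] [InnerProductSpace ℂ E]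

/-- One-step moment bound for a small centred random increment whose second moments in every fixed
direction are smaller than its squared size by a factor of order `q ^ 2`. -/
lemma sum_weighted_one_add_sq_pow_le {ι : Type*} [Fintype ι] (w : ι → ℝ) (hw0 : ∀ j, 0 ≤ w j)
    (hw1 : ∑ j, w j = 1) (Y : ι → E) (q : ℕ) (hq : 1 ≤ q) (ε : ℝ)
    (hmean : ∑ j, (w j : ℂ) • Y j = 0) (hnorm : ∀ j, ‖Y j‖ ^ 2 ≤ ε)
    (hε : 4 * (q : ℝ) ^ 2 * ε ≤ 1)
    (hweak : ∀ v : E, (q : ℝ) ^ 2 * ∑ j, w j * (inner ℂ v (Y j)).re ^ 2 ≤ 4 * ε * ‖v‖ ^ 2)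
    (S : E) :
    ∑ j, w j * (1 + ‖S + Y j‖ ^ 2) ^ q ≤
      Real.exp (34 * q * ε) * (1 + ‖S‖ ^ 2) ^ q := by
  have hq' : (1 : ℝ) ≤ q := by exact_mod_cast hq
  have hε0 : 0 ≤ ε := by
    by_contra h
    push Not at h
    have : ∀ j : ι, False := fun j => by
      have := hnorm j
      have := sq_nonneg ‖Y j‖
      linarith
    have : ∑ j, w j = 0 := Finset.sum_eq_zero fun j _ => (this j).elim
    linarith
  set H : ℝ := 1 + ‖S‖ ^ 2 with hH
  have hH1 : 1 ≤ H := by have := sq_nonneg ‖S‖; linarith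
  have hH0 : 0 < H := by linarith
  set I : ι → ℝ := fun j => (inner ℂ S (Y j)).re with hI
  set T : ι → ℝ := fun j => (2 * I j + ‖Y j‖ ^ 2) / H with hT
  have hexp : ∀ j, 1 + ‖S + Y j‖ ^ 2 = H * (1 + T j) := by
    intro j
    have := norm_add_sq (𝕜 := ℂ) S (Y j)
    simp only [RCLike.re_to_complex] at this
    rw [this, hT]
    field_simp
    rw [hH]; ring
  have hIle : ∀ j, |I j| ≤ ‖S‖ * ‖Y j‖ := fun j =>
    (Complex.abs_re_le_norm _).trans (norm_inner_le_norm _ _)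
  have hqT : ∀ j, |(q : ℝ) * T j| ≤ 1 := by
    intro j
    have hy : 0 ≤ ‖Y j‖ := norm_nonneg _
    have hqy : (q : ℝ) * ‖Y j‖ ≤ 1 / 2 := by
      have : ((q : ℝ) * ‖Y j‖) ^ 2 ≤ (1 / 2) ^ 2 := by
        have h1 := mul_le_mul_of_nonneg_left (hnorm j) (sq_nonneg (q : ℝ))
        nlinarith
      exact le_of_sq_le_sq this (by norm_num)
    have h2 : |2 * I j + ‖Y j‖ ^ 2| ≤ 2 * (‖S‖ * ‖Y j‖) + ‖Y j‖ ^ 2 := by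
      have := hIle j
      rw [abs_le] at this ⊢
      constructor <;> nlinarith [sq_nonneg ‖Y j‖]
    rw [hT, abs_mul, abs_div, abs_of_pos hH0, abs_of_nonneg (by linarith : (0 : ℝ) ≤ q),
      ← mul_div_assoc, div_le_one hH0]
    have h3 : (q : ℝ) * |2 * I j + ‖Y j‖ ^ 2| ≤ 2 * ‖S‖ * (q * ‖Y j‖) + (q * ‖Y j‖) * ‖Y j‖ := by
      calc _ ≤ (q : ℝ) * (2 * (‖S‖ * ‖Y j‖) + ‖Y j‖ ^ 2) := by gcongr
        _ = _ := by ring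
    have hyh : ‖Y j‖ ≤ 1 / 2 := by nlinarith
    have hs := norm_nonneg S
    have h4 : 2 * ‖S‖ * (q * ‖Y j‖) ≤ ‖S‖ := by nlinarith
    have h5 : (q * ‖Y j‖) * ‖Y j‖ ≤ 1 / 4 := by nlinarith
    nlinarith [sq_nonneg (‖S‖ - 1 / 2)]
  have hpow : ∀ j, (1 + ‖S + Y j‖ ^ 2) ^ q ≤ H ^ q * (1 + q * T j + (q * T j) ^ 2) := by
    intro j
    have h0 : 0 ≤ 1 + T j := by
      have : 0 ≤ H * (1 + T j) := by rw [← hexp]; positivity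
      exact nonneg_of_mul_nonneg_right this hH0
    rw [hexp, mul_pow]
    gcongr
    calc (1 + T j) ^ q ≤ (Real.exp (T j)) ^ q := by
          gcongr
          linarith [Real.add_one_le_exp (T j)]
      _ = Real.exp (q * T j) := by rw [← Real.exp_nat_mul]
      _ ≤ _ := by
          have := Real.abs_exp_sub_one_sub_id_le (hqT j)
          rw [abs_le] at this
          linarith [this.2]
  have hIsum : ∑ j, w j * I j = 0 := by
    have h := congrArg (fun v => (inner ℂ S v).re) hmean
    simp only [inner_sum, inner_smul_right, inner_zero_right, Complex.re_sum, Complex.zero_re,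
      Complex.re_ofReal_mul] at h
    exact h
  have hTsum : ∑ j, w j * T j ≤ ε := by
    have h1 : ∑ j, w j * T j = (2 * ∑ j, w j * I j + ∑ j, w j * ‖Y j‖ ^ 2) / H := by
      rw [Finset.mul_sum, ← Finset.sum_add_distrib, Finset.sum_div]
      refine Finset.sum_congr rfl fun j _ => ?_
      simp only [hT]; ring
    have h2 : ∑ j, w j * ‖Y j‖ ^ 2 ≤ ε := by
      calc _ ≤ ∑ j, w j * ε := Finset.sum_le_sum fun j _ =>
            mul_le_mul_of_nonneg_left (hnorm j) (hw0 j)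
        _ = ε := by rw [← Finset.sum_mul, hw1, one_mul]
    rw [h1, hIsum, div_le_iff₀ hH0]
    nlinarith
  have hT2 : ∀ j, (q * T j) ^ 2 ≤ 8 * (q : ℝ) ^ 2 * I j ^ 2 / H ^ 2 + ε / 2 := by
    intro j
    have h1 : (2 * I j + ‖Y j‖ ^ 2) ^ 2 ≤ 8 * I j ^ 2 + 2 * ε ^ 2 := by
      have h2 : (‖Y j‖ ^ 2) ^ 2 ≤ ε ^ 2 := by
        have := hnorm j
        gcongr
      nlinarith [sq_nonneg (2 * I j - ‖Y j‖ ^ 2)]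
    have h3 : (q * T j) ^ 2 = (q : ℝ) ^ 2 * (2 * I j + ‖Y j‖ ^ 2) ^ 2 / H ^ 2 := by
      simp only [hT]
      rw [mul_pow, div_pow, mul_div_assoc]
    rw [h3]
    have h4 : (q : ℝ) ^ 2 * (2 * I j + ‖Y j‖ ^ 2) ^ 2 / H ^ 2
        ≤ (q : ℝ) ^ 2 * (8 * I j ^ 2 + 2 * ε ^ 2) / H ^ 2 := by gcongr
    have h5 : (q : ℝ) ^ 2 * (2 * ε ^ 2) / H ^ 2 ≤ ε / 2 := by
      calc _ ≤ (q : ℝ) ^ 2 * (2 * ε ^ 2) := div_le_self (by positivity) (by nlinarith)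
        _ ≤ _ := by nlinarith
    calc _ ≤ _ := h4
      _ = 8 * (q : ℝ) ^ 2 * I j ^ 2 / H ^ 2 + (q : ℝ) ^ 2 * (2 * ε ^ 2) / H ^ 2 := by ring
      _ ≤ _ := by linarith
  have hT2sum : ∑ j, w j * (q * T j) ^ 2 ≤ 33 * ε := by
    have h1 : ∑ j, w j * (q * T j) ^ 2 ≤
        8 * ((q : ℝ) ^ 2 * ∑ j, w j * I j ^ 2) / H ^ 2 + ε / 2 := by
      calc _ ≤ ∑ j, w j * (8 * (q : ℝ) ^ 2 * I j ^ 2 / H ^ 2 + ε / 2) :=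
            Finset.sum_le_sum fun j _ => mul_le_mul_of_nonneg_left (hT2 j) (hw0 j)
        _ = ∑ j, (8 * (q : ℝ) ^ 2 / H ^ 2 * (w j * I j ^ 2) + w j * (ε / 2)) :=
            Finset.sum_congr rfl fun j _ => by ring
        _ = _ := by
            rw [Finset.sum_add_distrib, ← Finset.mul_sum, ← Finset.sum_mul, hw1]; ring
    have h2 : 8 * ((q : ℝ) ^ 2 * ∑ j, w j * I j ^ 2) / H ^ 2 ≤ 32 * ε := by
      rw [div_le_iff₀ (by positivity)]
      have h3 := hweak S
      have h4 : ‖S‖ ^ 2 ≤ H ^ 2 := by nlinarith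
      have h5 : 4 * ε * ‖S‖ ^ 2 ≤ 4 * ε * H ^ 2 := by gcongr
      linarith
    linarith
  calc _ ≤ ∑ j, w j * (H ^ q * (1 + q * T j + (q * T j) ^ 2)) :=
        Finset.sum_le_sum fun j _ => mul_le_mul_of_nonneg_left (hpow j) (hw0 j)
    _ = H ^ q * (∑ j, w j + q * ∑ j, w j * T j + ∑ j, w j * (q * T j) ^ 2) := by
        rw [Finset.mul_sum, ← Finset.sum_add_distrib, ← Finset.sum_add_distrib, Finset.mul_sum]
        exact Finset.sum_congr rfl fun j _ => by ring
    _ ≤ H ^ q * Real.exp (34 * q * ε) := by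
        gcongr
        have := Real.add_one_le_exp (34 * q * ε)
        have : (q : ℝ) * ∑ j, w j * T j ≤ q * ε := by gcongr
        nlinarith
    _ = _ := mul_comm _ _

/-- Derandomised sampling: one can choose `n` increments, one at a time, keeping the potential
`∑ b, (1 + ‖S b‖ ^ 2) ^ q` under control. -/
lemma exists_seq_sum_one_add_sq_pow_le {ι β : Type*} [Fintype ι] [Fintype β] (w : ι → ℝ)
    (hw0 : ∀ j, 0 ≤ w j) (hw1 : ∑ j, w j = 1) (Y : β → ι → E) (q : ℕ) (hq : 1 ≤ q) (ε : ℝ)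
    (hmean : ∀ b, ∑ j, (w j : ℂ) • Y b j = 0) (hnorm : ∀ b j, ‖Y b j‖ ^ 2 ≤ ε)
    (hε : 4 * (q : ℝ) ^ 2 * ε ≤ 1)
    (hweak : ∀ b, ∀ v : E,
      (q : ℝ) ^ 2 * ∑ j, w j * (inner ℂ v (Y b j)).re ^ 2 ≤ 4 * ε * ‖v‖ ^ 2) (n : ℕ) :
    ∃ f : Fin n → ι, ∑ b, (1 + ‖∑ l, Y b (f l)‖ ^ 2) ^ q ≤
      Real.exp (34 * q * ε) ^ n * Fintype.card β := by
  induction n with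
  | zero => exact ⟨Fin.elim0, by simp⟩
  | succ n ih =>
    obtain ⟨f, hf⟩ := ih
    set S : β → E := fun b => ∑ l, Y b (f l) with hS
    have havg : ∑ j, w j * ∑ b, (1 + ‖S b + Y b j‖ ^ 2) ^ q ≤
        Real.exp (34 * q * ε) * ∑ b, (1 + ‖S b‖ ^ 2) ^ q := by
      simp_rw [Finset.mul_sum]
      rw [Finset.sum_comm]
      exact Finset.sum_le_sum fun b _ => sum_weighted_one_add_sq_pow_le w hw0 hw1 (Y b) q hq ε
        (hmean b) (hnorm b) hε (hweak b) (S b)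
    obtain ⟨j, hj⟩ : ∃ j, ∑ b, (1 + ‖S b + Y b j‖ ^ 2) ^ q ≤
        Real.exp (34 * q * ε) * ∑ b, (1 + ‖S b‖ ^ 2) ^ q := by
      by_contra! h
      obtain ⟨i, hi⟩ : ∃ i, 0 < w i := by
        by_contra! h0
        linarith [Finset.sum_nonpos fun j (_ : j ∈ Finset.univ) => h0 j]
      have h1 : ∑ j, w j * (Real.exp (34 * q * ε) * ∑ b, (1 + ‖S b‖ ^ 2) ^ q) <
          ∑ j, w j * ∑ b, (1 + ‖S b + Y b j‖ ^ 2) ^ q :=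
        Finset.sum_lt_sum (fun j _ => mul_le_mul_of_nonneg_left (h j).le (hw0 j))
          ⟨i, Finset.mem_univ _, mul_lt_mul_of_pos_left (h i) hi⟩
      rw [← Finset.sum_mul, hw1, one_mul] at h1
      linarith
    refine ⟨Fin.snoc f j, ?_⟩
    simp only [Fin.sum_univ_castSucc, Fin.snoc_castSucc, Fin.snoc_last]
    calc _ ≤ _ := hj
      _ ≤ Real.exp (34 * q * ε) * (Real.exp (34 * q * ε) ^ n * Fintype.card β) := by gcongr
      _ = _ := by ring

end Sampling

/-- Duality: a bound for the synthesis map on vectors supported in `s` bounds the analysis map. -/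
lemma sum_norm_inner_sq_le {E : Type*} [NormedAddCommGroup E] [InnerProductSpace ℂ E] {d : ℕ}
    (a : Fin d → E) (s : Finset (Fin d)) (D : ℝ)
    (hD : ∀ y : Fin d → ℂ, (∀ j ∉ s, y j = 0) →
      ‖∑ j, y j • a j‖ ≤ D * Real.sqrt (∑ j, ‖y j‖ ^ 2)) (v : E) :
    ∑ j ∈ s, ‖inner ℂ v (a j)‖ ^ 2 ≤ D ^ 2 * ‖v‖ ^ 2 := by
  classical
  set P := ∑ j ∈ s, ‖inner ℂ v (a j)‖ ^ 2 with hP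
  have hP0 : 0 ≤ P := Finset.sum_nonneg fun j _ => sq_nonneg _
  set y : Fin d → ℂ := fun j => if j ∈ s then (starRingEnd ℂ) (inner ℂ v (a j)) else 0 with hy
  have hyP : ∑ j, ‖y j‖ ^ 2 = P := by
    rw [hP, ← Finset.sum_subset (Finset.subset_univ s) fun j _ hj => by simp [hy, hj]]
    exact Finset.sum_congr rfl fun j hj => by
      simp only [hy, if_pos hj, RCLike.norm_conj]
  have hinner : inner ℂ v (∑ j, y j • a j) = (P : ℂ) := by
    rw [inner_sum, ← hyP, Complex.ofReal_sum]
    refine Finset.sum_congr rfl fun j _ => ?_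
    by_cases h : j ∈ s
    · simp only [hy, if_pos h, inner_smul_right, RCLike.norm_conj]
      rw [Complex.conj_mul', Complex.ofReal_pow]
    · simp [hy, h]
  have h1 : P ≤ ‖v‖ * (D * Real.sqrt P) := by
    calc P = ‖inner ℂ v (∑ j, y j • a j)‖ := by
          rw [hinner, Complex.norm_real, Real.norm_of_nonneg hP0]
      _ ≤ ‖v‖ * ‖∑ j, y j • a j‖ := norm_inner_le_norm _ _
      _ ≤ ‖v‖ * (D * Real.sqrt P) := by
          gcongr
          rw [← hyP]
          exact hD y fun j hj => by simp [hy, hj]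
  rcases hP0.eq_or_lt with h0 | h0
  · rw [← h0]; positivity
  · have hs : 0 < Real.sqrt P := Real.sqrt_pos.2 h0
    have hss : Real.sqrt P * Real.sqrt P = P := Real.mul_self_sqrt hP0
    have h2 : Real.sqrt P ≤ ‖v‖ * D := by
      by_contra! h
      nlinarith
    calc P = Real.sqrt P ^ 2 := by rw [sq, hss]
      _ ≤ (‖v‖ * D) ^ 2 := by gcongr
      _ = _ := by ring

/-- The variance is at most the second moment. -/
lemma sum_weighted_sub_mean_sq_le {ι : Type*} [Fintype ι] (w R : ι → ℝ) (hw1 : ∑ j, w j = 1) :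
    ∑ j, w j * (R j - ∑ i, w i * R i) ^ 2 ≤ ∑ j, w j * R j ^ 2 := by
  set μ := ∑ i, w i * R i with hμ
  have : ∑ j, w j * (R j - μ) ^ 2 =
      ∑ j, w j * R j ^ 2 - 2 * μ * ∑ j, w j * R j + μ ^ 2 * ∑ j, w j := by
    rw [Finset.mul_sum _ _ (2 * μ), Finset.mul_sum _ _ (μ ^ 2), ← Finset.sum_sub_distrib,
      ← Finset.sum_add_distrib]
    exact Finset.sum_congr rfl fun j _ => by ring
  rw [this, ← hμ, hw1]
  nlinarith [sq_nonneg μ]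

/-- Importance sampling weights adapted to both the `ℓ¹` and the `ℓ²` norm of `x`. -/
lemma exists_sampling_weights {d k : ℕ} (hk : 0 < k) (x : Fin d → ℂ) (hx0 : x ≠ 0)
    (hx1 : ∑ j, ‖x j‖ ≤ 1) (hx2 : k * ∑ j, ‖x j‖ ^ 2 ≤ 1) :
    ∃ (w : Fin d → ℝ) (z : Fin d → ℂ), (∀ j, 0 ≤ w j) ∧ ∑ j, w j = 1 ∧
      (∀ j, (w j : ℂ) * z j = x j) ∧ (∀ j, ‖z j‖ ≤ 2) ∧ (∀ j, w j * ‖z j‖ ^ 2 ≤ 2 / k) := by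
  have hk' : (0 : ℝ) < k := by exact_mod_cast hk
  set p : Fin d → ℝ := fun j => k * ‖x j‖ ^ 2 + ‖x j‖ with hp
  have hp0 : ∀ j, 0 ≤ p j := fun j => by positivity
  set Z := ∑ j, p j with hZ
  have hZ2 : Z ≤ 2 := by
    rw [hZ, hp, Finset.sum_add_distrib, ← Finset.mul_sum]
    linarith
  have hZ0 : 0 < Z := by
    obtain ⟨j, hj⟩ := Function.ne_iff.1 hx0
    refine Finset.sum_pos' (fun j _ => hp0 j) ⟨j, Finset.mem_univ _, ?_⟩
    have : 0 < ‖x j‖ := norm_pos_iff.2 hj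
    simp only [hp]
    positivity
  refine ⟨fun j => p j / Z, fun j => x j / ((p j / Z : ℝ) : ℂ), fun j => div_nonneg (hp0 j) hZ0.le,
    ?_, fun j => ?_, fun j => ?_, fun j => ?_⟩
  · rw [← Finset.sum_div, ← hZ, div_self hZ0.ne']
  · by_cases h : x j = 0
    · simp [h]
    · have : 0 < ‖x j‖ := norm_pos_iff.2 h
      have hpj : 0 < p j / Z := by simp only [hp]; positivity
      exact mul_div_cancel₀ _ (by exact_mod_cast hpj.ne')
  · by_cases h : x j = 0
    · simp [h]
    · have hx : 0 < ‖x j‖ := norm_pos_iff.2 h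
      have hpj : 0 < p j := by simp only [hp]; positivity
      rw [norm_div, Complex.norm_real, Real.norm_of_nonneg (by positivity),
        div_le_iff₀ (by positivity),
        ← mul_div_assoc, le_div_iff₀ hZ0]
      have : ‖x j‖ ≤ p j := by simp only [hp]; nlinarith [mul_pos hk' (pow_pos hx 2)]
      nlinarith
  · by_cases h : x j = 0
    · simp [h]; positivity
    · have hx : 0 < ‖x j‖ := norm_pos_iff.2 h
      have hpj : 0 < p j := by simp only [hp]; positivity
      have h1 : k * ‖x j‖ ^ 2 ≤ p j := by simp only [hp]; linarith
      rw [norm_div, Complex.norm_real, Real.norm_of_nonneg (by positivity)]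
      have : p j / Z * (‖x j‖ / (p j / Z)) ^ 2 = Z * ‖x j‖ ^ 2 / p j := by
        field_simp
      rw [this, div_le_div_iff₀ hpj hk']
      nlinarith [mul_nonneg hk'.le (sq_nonneg ‖x j‖)]

/-- A sparse vector `x` of small `ℓ¹` and `ℓ²` norm is approximated, simultaneously in all buckets,
by an average of `L` multiples of coordinate vectors. -/
lemma exists_average_approx {E : Type*} [NormedAddCommGroup E] [InnerProductSpace ℂ E]
    {m B d k q L : ℕ} (a : Fin m → Fin d → E) (ha : ∀ b j, ‖a b j‖ ≤ Real.sqrt B)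
    (hB : 0 < B) (hk : 0 < k) (hq : 1 ≤ q) (hm : (m : ℝ) ≤ Real.exp q)
    (hL : 36 * (q : ℝ) ^ 2 ≤ L)
    (hD : ∀ b, ∀ y : Fin d → ℂ, (Finset.univ.filter fun i => y i ≠ 0).card ≤ k →
      ‖∑ j, y j • a b j‖ ≤ 4 * Real.sqrt (B * k) / q * Real.sqrt (∑ j, ‖y j‖ ^ 2))
    (x : Fin d → ℂ) (hxs : (Finset.univ.filter fun i => x i ≠ 0).card ≤ k) (hx0 : x ≠ 0)
    (hx1 : ∑ j, ‖x j‖ ≤ 1) (hx2 : k * ∑ j, ‖x j‖ ^ 2 ≤ 1) :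
    ∃ (f : Fin L → Fin d) (c : Fin L → ℂ), (∀ l, ‖c l‖ ≤ 2) ∧
      ∀ b, ‖∑ j, x j • a b j - ∑ l, (c l / L) • a b (f l)‖ ^ 2 ≤ Real.exp 307 * B / L := by
  obtain ⟨w, z, hw0, hw1, hwz, hz2, hwz2⟩ := exists_sampling_weights hk x hx0 hx1 hx2
  have hB' : (0 : ℝ) < B := by exact_mod_cast hB
  have hk' : (0 : ℝ) < k := by exact_mod_cast hk
  have hq' : (1 : ℝ) ≤ q := by exact_mod_cast hq
  have hL' : (0 : ℝ) < L := by nlinarith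
  set s : ℝ := 1 / Real.sqrt (B * L) with hs
  have hs0 : 0 < s := by positivity
  have hs2 : s ^ 2 = 1 / (B * L) := by
    rw [hs, div_pow, Real.sq_sqrt (by positivity), one_pow]
  have hsqB : Real.sqrt B ^ 2 = B := Real.sq_sqrt hB'.le
  set X : Fin m → E := fun b => ∑ j, x j • a b j with hX
  set Y : Fin m → Fin d → E := fun b j => (s : ℂ) • (z j • a b j - X b) with hY
  have hXn : ∀ b, ‖X b‖ ≤ Real.sqrt B := by
    intro b
    calc ‖X b‖ ≤ ∑ j, ‖x j • a b j‖ := norm_sum_le _ _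
      _ ≤ ∑ j, ‖x j‖ * Real.sqrt B := Finset.sum_le_sum fun j _ => by
          rw [norm_smul]; gcongr; exact ha b j
      _ = (∑ j, ‖x j‖) * Real.sqrt B := by rw [Finset.sum_mul]
      _ ≤ 1 * Real.sqrt B := by gcongr
      _ = _ := one_mul _
  have hmeanX : ∀ b, ∑ j, (w j : ℂ) • (z j • a b j) = X b := fun b => by
    simp only [hX, smul_smul, hwz]
  have hw1C : ∑ j, (w j : ℂ) = 1 := by exact_mod_cast congrArg (fun t : ℝ => (t : ℂ)) hw1
  have hmean : ∀ b, ∑ j, (w j : ℂ) • Y b j = 0 := by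
    intro b
    simp only [hY, smul_comm _ (s : ℂ), ← Finset.smul_sum, smul_sub, Finset.sum_sub_distrib,
      ← Finset.sum_smul]
    rw [hmeanX, hw1C, one_smul, sub_self]
  have hnorm : ∀ b j, ‖Y b j‖ ^ 2 ≤ 9 / L := by
    intro b j
    have h1 : ‖z j • a b j - X b‖ ≤ 3 * Real.sqrt B := by
      calc _ ≤ ‖z j • a b j‖ + ‖X b‖ := norm_sub_le _ _
        _ ≤ 2 * Real.sqrt B + Real.sqrt B := by
            rw [norm_smul]
            gcongr
            · exact hz2 j
            · exact ha b j
            · exact hXn b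
        _ = _ := by ring
    simp only [hY]
    rw [norm_smul, Complex.norm_real, Real.norm_of_nonneg hs0.le, mul_pow, hs2]
    calc _ ≤ 1 / ((B : ℝ) * L) * (3 * Real.sqrt B) ^ 2 := by gcongr
      _ = _ := by rw [mul_pow, hsqB]; field_simp; norm_num
  have hweak : ∀ b, ∀ v : E,
      (q : ℝ) ^ 2 * ∑ j, w j * (inner ℂ v (Y b j)).re ^ 2 ≤ 4 * (9 / L) * ‖v‖ ^ 2 := by
    intro b v
    set R : Fin d → ℝ := fun j => (inner ℂ v (z j • a b j)).re with hR
    have hμ : (inner ℂ v (X b)).re = ∑ j, w j * R j := by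
      rw [← hmeanX b, inner_sum, Complex.re_sum]
      refine Finset.sum_congr rfl fun j _ => ?_
      rw [inner_smul_right, Complex.re_ofReal_mul]
    have h1 : ∑ j, w j * (inner ℂ v (Y b j)).re ^ 2 =
        s ^ 2 * ∑ j, w j * (R j - ∑ i, w i * R i) ^ 2 := by
      rw [Finset.mul_sum]
      refine Finset.sum_congr rfl fun j _ => ?_
      simp only [hY]
      rw [inner_smul_right, Complex.re_ofReal_mul, inner_sub_right, Complex.sub_re, hμ]
      ring
    have h2 : ∑ j, w j * R j ^ 2 ≤
        2 / k * ∑ j ∈ Finset.univ.filter (fun i => x i ≠ 0), ‖inner ℂ v (a b j)‖ ^ 2 := by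
      rw [Finset.mul_sum, Finset.sum_filter]
      refine Finset.sum_le_sum fun j _ => ?_
      have hRj : R j ^ 2 ≤ ‖z j‖ ^ 2 * ‖inner ℂ v (a b j)‖ ^ 2 := by
        rw [← mul_pow, ← norm_mul, ← inner_smul_right, ← sq_abs]
        gcongr
        exact Complex.abs_re_le_norm _
      have hRw : w j * R j ^ 2 ≤ (w j * ‖z j‖ ^ 2) * ‖inner ℂ v (a b j)‖ ^ 2 := by
        rw [mul_assoc]
        exact mul_le_mul_of_nonneg_left hRj (hw0 j)
      split_ifs with hj
      · exact hRw.trans (by gcongr; exact hwz2 j)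
      · push Not at hj
        have hzero : w j * ‖z j‖ ^ 2 = 0 := by
          have h := congrArg norm (hwz j)
          rw [hj, norm_mul, norm_zero, Complex.norm_real, Real.norm_of_nonneg (hw0 j)] at h
          rw [sq, ← mul_assoc, h, zero_mul]
        rw [hzero, zero_mul] at hRw
        exact hRw
    have h3 := sum_norm_inner_sq_le (a b) (Finset.univ.filter fun i => x i ≠ 0)
      (4 * Real.sqrt (B * k) / q) (fun y hy => hD b y (le_trans (Finset.card_le_card fun j hj => by
        simp only [Finset.mem_filter, Finset.mem_univ, true_and] at hj ⊢
        intro h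
        exact hj (hy j (by simp [h]))) hxs)) v
    have h4 : (4 * Real.sqrt (B * k) / q) ^ 2 = 16 * (B * k) / q ^ 2 := by
      rw [div_pow, mul_pow, Real.sq_sqrt (by positivity)]; norm_num
    rw [h4] at h3
    rw [h1, hs2]
    calc (q : ℝ) ^ 2 * (1 / (B * L) * ∑ j, w j * (R j - ∑ i, w i * R i) ^ 2)
        ≤ (q : ℝ) ^ 2 * (1 / (B * L) * (2 / k * (16 * (B * k) / q ^ 2 * ‖v‖ ^ 2))) := by
          gcongr
          exact (sum_weighted_sub_mean_sq_le w R hw1).trans (h2.trans (by gcongr))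
      _ = 32 / L * ‖v‖ ^ 2 := by field_simp; ring
      _ ≤ 4 * (9 / L) * ‖v‖ ^ 2 := by
          rw [← mul_div_assoc]; gcongr; norm_num
  have hε : 4 * (q : ℝ) ^ 2 * (9 / L) ≤ 1 := by
    rw [← mul_div_assoc, div_le_one hL']; linarith
  obtain ⟨f, hf⟩ := exists_seq_sum_one_add_sq_pow_le w hw0 hw1 Y q hq (9 / L) hmean hnorm hε hweak L
  refine ⟨f, fun l => z (f l), fun l => hz2 _, fun b => ?_⟩
  have h1 : (1 + ‖∑ l, Y b (f l)‖ ^ 2) ^ q ≤ Real.exp 307 ^ q := by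
    calc _ ≤ ∑ b, (1 + ‖∑ l, Y b (f l)‖ ^ 2) ^ q :=
          Finset.single_le_sum (f := fun b => (1 + ‖∑ l, Y b (f l)‖ ^ 2) ^ q)
            (fun b _ => by positivity) (Finset.mem_univ b)
      _ ≤ _ := hf
      _ ≤ Real.exp (34 * q * (9 / L)) ^ L * Real.exp q := by
          rw [Fintype.card_fin]; gcongr
      _ = _ := by
          rw [← Real.exp_nat_mul, ← Real.exp_nat_mul, ← Real.exp_add]
          congr 1
          field_simp
          ring
  have h2 : 1 + ‖∑ l, Y b (f l)‖ ^ 2 ≤ Real.exp 307 :=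
    le_of_pow_le_pow_left₀ (by omega) (Real.exp_pos _).le h1
  have h3 : ∑ l, Y b (f l) =
      (-(s * L : ℝ) : ℂ) • (∑ j, x j • a b j - ∑ l, (z (f l) / L) • a b (f l)) := by
    have hLC : (L : ℂ) ≠ 0 := by exact_mod_cast hL'.ne'
    simp only [hY, ← Finset.smul_sum, Finset.sum_sub_distrib, Finset.sum_const, Finset.card_univ,
      Fintype.card_fin]
    have h4 : ∑ l, z (f l) • a b (f l) = (L : ℂ) • ∑ l, (z (f l) / L) • a b (f l) := by
      rw [Finset.smul_sum]
      refine Finset.sum_congr rfl fun l _ => ?_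
      rw [smul_smul, mul_div_cancel₀ _ hLC]
    rw [h4, ← Nat.cast_smul_eq_nsmul ℂ]
    push_cast
    module
  rw [h3, norm_smul, norm_neg, Complex.norm_real, Real.norm_of_nonneg (by positivity), mul_pow,
    mul_pow, hs2] at h2
  rw [le_div_iff₀ hL']
  have h5 : 1 / ((B : ℝ) * L) * (L : ℝ) ^ 2 = L / B := by field_simp
  rw [h5, div_mul_eq_mul_div] at h2
  have h6 : (L : ℝ) * ‖∑ j, x j • a b j - ∑ l, (z (f l) / L) • a b (f l)‖ ^ 2 / B ≤
    Real.exp 307 := by linarith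
  rw [div_le_iff₀ hB'] at h6
  linarith

/-- A finite square grid approximating the disc of radius `2` to within `2 / n`. -/
lemma exists_grid (n : ℕ) (hn : 0 < n) :
    ∃ G : Finset ℂ, G.card ≤ (4 * n + 1) ^ 2 ∧ ∀ z : ℂ, ‖z‖ ≤ 2 → ∃ g ∈ G, ‖z - g‖ ≤ 2 / n := by
  classical
  have hn' : (0 : ℝ) < n := by exact_mod_cast hn
  set J : Finset ℤ := Finset.Icc (-(2 * n : ℤ)) (2 * n) with hJ
  have hJc : J.card = 4 * n + 1 := by rw [hJ, Int.card_Icc]; omega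
  refine ⟨(J ×ˢ J).image fun p => (⟨p.1 / n, p.2 / n⟩ : ℂ), ?_, fun z hz => ?_⟩
  · refine Finset.card_image_le.trans ?_
    rw [Finset.card_product, hJc, sq]
  · have hfl : ∀ t : ℝ, |t| ≤ 2 → ⌊n * t⌋ ∈ J ∧ |t - ⌊n * t⌋ / n| ≤ 1 / n := by
      intro t ht
      rw [abs_le] at ht
      have h1 := Int.floor_le (n * t)
      have h2 := Int.lt_floor_add_one (n * t)
      refine ⟨?_, ?_⟩
      · rw [hJ, Finset.mem_Icc]
        constructor
        · rw [Int.le_floor]; push_cast; nlinarith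
        · have : (⌊n * t⌋ : ℝ) ≤ ((2 * n : ℤ) : ℝ) := by push_cast; nlinarith
          exact_mod_cast this
      · have h3 : t - ⌊n * t⌋ / n = (n * t - ⌊n * t⌋) / n := by field_simp
        rw [h3, abs_div, abs_of_pos hn', abs_of_nonneg (by linarith)]
        gcongr
        linarith
    have hre := hfl z.re ((Complex.abs_re_le_norm z).trans hz)
    have him := hfl z.im ((Complex.abs_im_le_norm z).trans hz)
    refine ⟨_, Finset.mem_image.2 ⟨(⌊n * z.re⌋, ⌊n * z.im⌋),
      Finset.mem_product.2 ⟨hre.1, him.1⟩, rfl⟩, ?_⟩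
    refine (Complex.norm_le_abs_re_add_abs_im _).trans ?_
    simp only [Complex.sub_re, Complex.sub_im]
    calc _ ≤ (1 : ℝ) / n + 1 / n := add_le_add hre.2 him.2
      _ = 2 / n := by ring

/-- A net for averages of `L ≤ d` multiples of coordinate vectors. -/
lemma exists_net_of_averages {E : Type*} [NormedAddCommGroup E] [NormedSpace ℂ E]
    {m B d L : ℕ} (a : Fin m → Fin d → E) (ha : ∀ b j, ‖a b j‖ ≤ Real.sqrt B)
    (hL : 0 < L) (hLd : L ≤ d) :
    ∃ N : Finset (Fin d → ℂ), N.card ≤ (2 * d + 1) ^ (10 * L) ∧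
      ∀ (f : Fin L → Fin d) (c : Fin L → ℂ), (∀ l, ‖c l‖ ≤ 2) → ∃ y ∈ N, ∀ b,
        ‖∑ l, (c l / L) • a b (f l) - ∑ j, y j • a b j‖ ≤ Real.sqrt B / L := by
  classical
  have hL' : (0 : ℝ) < L := by exact_mod_cast hL
  obtain ⟨G, hGc, hG⟩ := exists_grid (2 * L) (by omega)
  refine ⟨(Fintype.piFinset fun _ : Fin L => (Finset.univ : Finset (Fin d)) ×ˢ G).image
    fun p => ∑ l, Pi.single (p l).1 ((p l).2 / L), ?_, fun f c hc => ?_⟩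
  · refine Finset.card_image_le.trans ?_
    rw [Fintype.card_piFinset_const, Finset.card_product, Finset.card_univ, Fintype.card_fin,
      pow_mul]
    refine Nat.pow_le_pow_left ?_ _
    have h1 : 4 * (2 * L) + 1 ≤ (2 * d + 1) ^ 3 := by
      have h0 : (2 * d + 1) ^ 3 = 8 * d ^ 3 + 12 * d ^ 2 + 6 * d + 1 := by ring
      have := Nat.le_self_pow (n := 2) (by norm_num) d
      omega
    calc d * G.card ≤ (2 * d + 1) * ((2 * d + 1) ^ 3) ^ 2 :=
          Nat.mul_le_mul (by omega) (hGc.trans (Nat.pow_le_pow_left h1 2))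
      _ = (2 * d + 1) ^ 7 := by ring
      _ ≤ _ := Nat.pow_le_pow_right (by omega) (by norm_num)
  · choose g hgG hg using fun l => hG (c l) (hc l)
    refine ⟨_, Finset.mem_image.2 ⟨fun l => (f l, g l), ?_, rfl⟩, fun b => ?_⟩
    · simp [hgG]
    · have h1 : ∑ j, (∑ l, Pi.single (f l) (g l / L) : Fin d → ℂ) j • a b j =
          ∑ l, (g l / L) • a b (f l) := by
        simp only [Finset.sum_apply, Finset.sum_smul]
        rw [Finset.sum_comm]
        refine Finset.sum_congr rfl fun l _ => ?_
        rw [Finset.sum_eq_single (f l)]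
        · simp
        · intro j _ hj
          simp [Pi.single_eq_of_ne hj]
        · simp
      rw [h1, ← Finset.sum_sub_distrib]
      calc _ ≤ ∑ l, ‖(c l / L) • a b (f l) - (g l / L) • a b (f l)‖ := norm_sum_le _ _
        _ ≤ ∑ _l : Fin L, (1 / L : ℝ) / L * Real.sqrt B := by
            refine Finset.sum_le_sum fun l _ => ?_
            rw [← sub_smul, ← sub_div, norm_smul, norm_div, Complex.norm_natCast]
            gcongr
            · refine (hg l).trans (le_of_eq ?_)
              push_cast
              field_simp
            · exact ha b (f l)
        _ = _ := by
            rw [Finset.sum_const, Finset.card_univ, Fintype.card_fin, nsmul_eq_mul]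
            field_simp

lemma pow_le_pow_mul_three_pow (d L : ℕ) : L ^ d ≤ d ^ d * 3 ^ L := by
  have h1 := Real.pow_div_factorial_le_exp (L : ℝ) (Nat.cast_nonneg L) d
  have h2 : Real.exp L ≤ 3 ^ L := by
    rw [← mul_one (L : ℝ), Real.exp_nat_mul]
    gcongr
    exact Real.exp_one_lt_three.le
  have h3 : (d.factorial : ℝ) ≤ (d : ℝ) ^ d := by exact_mod_cast Nat.factorial_le_pow d
  rw [div_le_iff₀ (by positivity)] at h1
  have : (L : ℝ) ^ d ≤ (d : ℝ) ^ d * 3 ^ L := by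
    calc _ ≤ _ := h1
      _ ≤ 3 ^ L * (d : ℝ) ^ d := by gcongr
      _ = _ := mul_comm _ _
  exact_mod_cast this

/-- A net for the polydisc of radius `2` in dimension `d ≤ L`. -/
lemma exists_net_of_polydisc {E : Type*} [NormedAddCommGroup E] [NormedSpace ℂ E]
    {m B d L : ℕ} (a : Fin m → Fin d → E) (ha : ∀ b j, ‖a b j‖ ≤ Real.sqrt B)
    (hL : 0 < L) (hdL : d ≤ L) :
    ∃ N : Finset (Fin d → ℂ), N.card ≤ (2 * d + 1) ^ (10 * L) ∧
      ∀ x : Fin d → ℂ, (∀ j, ‖x j‖ ≤ 2) → ∃ y ∈ N, ∀ b,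
        ‖∑ j, x j • a b j - ∑ j, y j • a b j‖ ≤ Real.sqrt B / L := by
  classical
  have hL' : (0 : ℝ) < L := by exact_mod_cast hL
  obtain ⟨G, hGc, hG⟩ := exists_grid (2 * (d + 1) * L) (by positivity)
  refine ⟨Fintype.piFinset fun _ : Fin d => G, ?_, fun x hx => ?_⟩
  · rw [Fintype.card_piFinset_const]
    rcases Nat.eq_zero_or_pos d with rfl | hd
    · simp
    · have h1 : 4 * (2 * (d + 1) * L) + 1 ≤ (2 * d + 1) ^ 3 * L := by
        have h0 : 8 * (d + 1) + 1 ≤ (2 * d + 1) ^ 3 := by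
          have h2 : (2 * d + 1) ^ 3 = 8 * d ^ 3 + 12 * d ^ 2 + 6 * d + 1 := by ring
          have := Nat.le_self_pow (n := 2) (by norm_num) d
          have := Nat.le_self_pow (n := 3) (by norm_num) d
          omega
        nlinarith
      have h3 : 3 ^ L ≤ (2 * d + 1) ^ L := Nat.pow_le_pow_left (by omega) L
      have h4 : d ^ d ≤ (2 * d + 1) ^ L :=
        (Nat.pow_le_pow_left (by omega : d ≤ 2 * d + 1) d).trans
          (Nat.pow_le_pow_right (by omega) hdL)
      have h5 : L ^ d ≤ (2 * d + 1) ^ (2 * L) := by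
        calc _ ≤ _ := pow_le_pow_mul_three_pow d L
          _ ≤ (2 * d + 1) ^ L * (2 * d + 1) ^ L := Nat.mul_le_mul h4 h3
          _ = _ := by ring
      calc G.card ^ d ≤ (((2 * d + 1) ^ 3 * L) ^ 2) ^ d :=
            Nat.pow_le_pow_left (hGc.trans (Nat.pow_le_pow_left h1 2)) d
        _ = (2 * d + 1) ^ (6 * d) * (L ^ d) ^ 2 := by
            rw [mul_pow, mul_pow, ← pow_mul, ← pow_mul, ← pow_mul, ← pow_mul, mul_comm d 2,
              show 3 * (2 * d) = 6 * d by ring]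
        _ ≤ (2 * d + 1) ^ (6 * L) * ((2 * d + 1) ^ (2 * L)) ^ 2 :=
            Nat.mul_le_mul (Nat.pow_le_pow_right (by omega) (by omega)) (Nat.pow_le_pow_left h5 2)
        _ = _ := by ring
  · choose g hgG hg using fun j => hG (x j) (hx j)
    refine ⟨g, by simp [hgG], fun b => ?_⟩
    rw [← Finset.sum_sub_distrib]
    calc _ ≤ ∑ j, ‖x j • a b j - g j • a b j‖ := norm_sum_le _ _
      _ ≤ ∑ _j : Fin d, 1 / ((d + 1) * L : ℝ) * Real.sqrt B := by
          refine Finset.sum_le_sum fun j _ => ?_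
          rw [← sub_smul, norm_smul]
          gcongr
          · refine (hg j).trans (le_of_eq ?_)
            push_cast
            field_simp
          · exact ha b j
      _ = d / (d + 1) * (Real.sqrt B / L) := by
          rw [Finset.sum_const, Finset.card_univ, Fintype.card_fin, nsmul_eq_mul]
          field_simp
      _ ≤ 1 * (Real.sqrt B / L) := by
          gcongr
          rw [div_le_one (by positivity)]
          linarith
      _ = _ := one_mul _

/-- The columns of the bucket matrix `A_b`, as vectors of the Euclidean space `ℂ^B`. -/
def bucketCol (m B d : ℕ) (A : Fin (m * B) → Fin d → ℂ) (b : Fin m) (j : Fin d) :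
    EuclideanSpace ℂ (Fin B) :=
  WithLp.toLp 2 fun i => A (hIdx m B b i) j

lemma l2norm_eq_norm {n : ℕ} (v : Fin n → ℂ) : l2norm v = ‖WithLp.toLp 2 v‖ := by
  rw [EuclideanSpace.norm_eq, l2norm]

lemma l2norm_mvec_bucket (m B d : ℕ) (A : Fin (m * B) → Fin d → ℂ) (b : Fin m) (x : Fin d → ℂ) :
    l2norm (mvec (bucket m B d A b) x) = ‖∑ j, x j • bucketCol m B d A b j‖ := by
  rw [l2norm_eq_norm]
  congr 1
  ext i
  simp [mvec, bucket, bucketCol, mul_comm]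

lemma norm_bucketCol_le {m B d : ℕ} {A : Fin (m * B) → Fin d → ℂ} (hA : ∀ r j, ‖A r j‖ ≤ 1)
    (b : Fin m) (j : Fin d) : ‖bucketCol m B d A b j‖ ≤ Real.sqrt B := by
  rw [EuclideanSpace.norm_eq]
  apply Real.sqrt_le_sqrt
  calc ∑ i, ‖(bucketCol m B d A b j) i‖ ^ 2 ≤ ∑ _i : Fin B, (1 : ℝ) :=
        Finset.sum_le_sum fun i _ => pow_le_one₀ (norm_nonneg _) (hA _ j)
    _ = B := by simp

lemma Xnorm_sub_le {m B d : ℕ} {A : Fin (m * B) → Fin d → ℂ} {x y : Fin d → ℂ} {u : ℝ}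
    (hu : 0 ≤ u) (h : ∀ b, ‖∑ j, x j • bucketCol m B d A b j -
      ∑ j, y j • bucketCol m B d A b j‖ ≤ u) : Xnorm m B d A (x - y) ≤ u := by
  refine Real.iSup_le (fun b => ?_) hu
  rw [l2norm_mvec_bucket]
  simpa only [Pi.sub_apply, sub_smul, Finset.sum_sub_distrib] using h b

/-- Cauchy–Schwarz on the support. -/
lemma sum_norm_le_sqrt_mul_sqrt {d k : ℕ} (y : Fin d → ℂ)
    (hy : (Finset.univ.filter fun i => y i ≠ 0).card ≤ k) :
    ∑ j, ‖y j‖ ≤ Real.sqrt k * Real.sqrt (∑ j, ‖y j‖ ^ 2) := by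
  set s := Finset.univ.filter fun i => y i ≠ 0 with hs
  have h0 : ∑ j, ‖y j‖ = ∑ j ∈ s, ‖y j‖ :=
    (Finset.sum_subset (Finset.subset_univ s) fun j _ hj => by simpa [hs] using hj).symm
  rw [← Real.sqrt_mul (Nat.cast_nonneg k)]
  apply Real.le_sqrt_of_sq_le
  calc (∑ j, ‖y j‖) ^ 2 ≤ s.card * ∑ j ∈ s, ‖y j‖ ^ 2 := by
        rw [h0]; exact sq_sum_le_card_mul_sum_sq
    _ ≤ k * ∑ j, ‖y j‖ ^ 2 := by
        gcongr
        exact Finset.subset_univ s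

/-- The restricted-norm hypothesis in homogeneous form, with `q` of the order of `log m`. -/
lemma exists_log_scale {m B d k : ℕ} {Q₁ Q₂ : ℝ} {A : Fin (m * B) → Fin d → ℂ}
    (hA : ∀ r j, ‖A r j‖ ≤ 1)
    (hQ : ∀ b : Fin m, ∀ x ∈ Tset d k,
      l2norm (mvec (bucket m B d A b) x) ≤ Q₁ * Real.sqrt B + Q₂ * Real.sqrt k)
    (hBQ : Q₂ ^ 2 * (Real.log m) ^ 2 ≤ B) (hkQ : Q₁ ^ 2 * (Real.log m) ^ 2 ≤ k) :
    ∃ q : ℕ, 1 ≤ q ∧ (m : ℝ) ≤ Real.exp q ∧ ∀ b, ∀ y : Fin d → ℂ,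
      (Finset.univ.filter fun i => y i ≠ 0).card ≤ k →
        ‖∑ j, y j • bucketCol m B d A b j‖ ≤
          4 * Real.sqrt (B * k) / q * Real.sqrt (∑ j, ‖y j‖ ^ 2) := by
  have hm : (m : ℝ) ≤ Real.exp (Real.log m) := by
    rcases Nat.eq_zero_or_pos m with h | h
    · rw [h]; simp
    · rw [Real.exp_log (by exact_mod_cast h)]
  rcases lt_or_ge (Real.log m) 1 with hlog | hlog
  · refine ⟨1, le_rfl, hm.trans (Real.exp_le_exp.2 (by simpa using hlog.le)), fun b y hy => ?_⟩
    calc _ ≤ ∑ j, ‖y j • bucketCol m B d A b j‖ := norm_sum_le _ _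
      _ ≤ ∑ j, ‖y j‖ * Real.sqrt B := Finset.sum_le_sum fun j _ => by
          rw [norm_smul]; gcongr; exact norm_bucketCol_le hA b j
      _ = (∑ j, ‖y j‖) * Real.sqrt B := by rw [Finset.sum_mul]
      _ ≤ (Real.sqrt k * Real.sqrt (∑ j, ‖y j‖ ^ 2)) * Real.sqrt B := by
          gcongr; exact sum_norm_le_sqrt_mul_sqrt y hy
      _ = 1 * (Real.sqrt (B * k) * Real.sqrt (∑ j, ‖y j‖ ^ 2)) := by
          rw [Real.sqrt_mul (Nat.cast_nonneg B)]; ring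
      _ ≤ 4 * (Real.sqrt (B * k) * Real.sqrt (∑ j, ‖y j‖ ^ 2)) := by gcongr; norm_num
      _ = _ := by simp [mul_assoc]
  · set q := ⌈Real.log m⌉₊ with hq
    have hq0 : 0 < q := Nat.ceil_pos.2 (by linarith)
    have hq' : (0 : ℝ) < q := by exact_mod_cast hq0
    have hqlog : (q : ℝ) ≤ 2 * Real.log m := by
      have := Nat.ceil_lt_add_one (a := Real.log m) (by linarith)
      linarith
    refine ⟨q, hq0, hm.trans (Real.exp_le_exp.2 (Nat.le_ceil _)), fun b y hy => ?_⟩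
    have hQ₁ : |Q₁| * Real.log m ≤ Real.sqrt k := by
      apply Real.le_sqrt_of_sq_le
      rwa [mul_pow, sq_abs]
    have hQ₂ : |Q₂| * Real.log m ≤ Real.sqrt B := by
      apply Real.le_sqrt_of_sq_le
      rwa [mul_pow, sq_abs]
    have hsum : Q₁ * Real.sqrt B + Q₂ * Real.sqrt k ≤ 4 * Real.sqrt (B * k) / q := by
      have hB0 := Real.sqrt_nonneg (B : ℝ)
      have hk0 := Real.sqrt_nonneg (k : ℝ)
      rw [le_div_iff₀ hq', Real.sqrt_mul (Nat.cast_nonneg B)]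
      calc (Q₁ * Real.sqrt B + Q₂ * Real.sqrt k) * q
          ≤ (|Q₁| * Real.sqrt B + |Q₂| * Real.sqrt k) * (2 * Real.log m) := by
            gcongr
            · exact le_abs_self _
            · exact le_abs_self _
        _ = 2 * ((|Q₁| * Real.log m) * Real.sqrt B + (|Q₂| * Real.log m) * Real.sqrt k) := by ring
        _ ≤ 2 * (Real.sqrt k * Real.sqrt B + Real.sqrt B * Real.sqrt k) := by gcongr
        _ = _ := by ring
    set t := Real.sqrt (∑ j, ‖y j‖ ^ 2)
    rcases (Real.sqrt_nonneg (∑ j, ‖y j‖ ^ 2)).eq_or_lt with h0 | h0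
    · have hy0 : ∀ j, y j = 0 := by
        have h1 : ∑ j, ‖y j‖ ^ 2 = 0 :=
          (Real.sqrt_eq_zero (Finset.sum_nonneg fun j _ => sq_nonneg _)).1 h0.symm
        rw [Finset.sum_eq_zero_iff_of_nonneg fun j _ => sq_nonneg _] at h1
        intro j
        simpa using h1 j (Finset.mem_univ j)
      simp only [hy0, zero_smul, Finset.sum_const_zero, norm_zero]
      positivity
    · have htC : (t : ℂ) ≠ 0 := by exact_mod_cast h0.ne'
      have hmem : ((t : ℂ)⁻¹ • y) ∈ Tset d k := by
        refine ⟨le_trans (Finset.card_le_card fun j hj => ?_) hy, ?_⟩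
        · simp only [Finset.mem_filter, Finset.mem_univ, true_and, Pi.smul_apply] at hj ⊢
          intro h
          exact hj (by simp [h])
        · rw [l2norm_eq_norm, WithLp.toLp_smul, norm_smul, ← l2norm_eq_norm, norm_inv,
            Complex.norm_real, Real.norm_of_nonneg h0.le]
          exact (inv_mul_cancel₀ h0.ne').le
      have h1 := (hQ b _ hmem).trans hsum
      rw [l2norm_mvec_bucket] at h1
      have h2 : ∑ j, ((t : ℂ)⁻¹ • y) j • bucketCol m B d A b j =
          (t : ℂ)⁻¹ • ∑ j, y j • bucketCol m B d A b j := by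
        rw [Finset.smul_sum]
        exact Finset.sum_congr rfl fun j _ => by rw [Pi.smul_apply, smul_assoc]
      rw [h2, norm_smul, norm_inv, Complex.norm_real, Real.norm_of_nonneg h0.le,
        inv_mul_le_iff₀ h0] at h1
      linarith

/-- A net for the sparse vectors of `ℓ²` norm at most `1 / √k` at scales below the trivial one. -/
lemma exists_net_of_small_scale {E : Type*} [NormedAddCommGroup E] [InnerProductSpace ℂ E]
    {m B d k q : ℕ} (a : Fin m → Fin d → E) (ha : ∀ b j, ‖a b j‖ ≤ Real.sqrt B)
    (hk : 0 < k) (hq : 1 ≤ q) (hm : (m : ℝ) ≤ Real.exp q)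
    (hD : ∀ b, ∀ y : Fin d → ℂ, (Finset.univ.filter fun i => y i ≠ 0).card ≤ k →
      ‖∑ j, y j • a b j‖ ≤ 4 * Real.sqrt (B * k) / q * Real.sqrt (∑ j, ‖y j‖ ^ 2))
    (u : ℝ) (hu : 0 < u) (huq : u * q < 4 * Real.sqrt B) :
    ∃ N : Finset (Fin d → ℂ),
      N.card ≤ (2 * d + 1) ^ ⌈10 * (576 * Real.exp 307 + 16) * B / u ^ 2⌉₊ ∧
      ∀ x : Fin d → ℂ, (Finset.univ.filter fun i => x i ≠ 0).card ≤ k →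
        k * ∑ j, ‖x j‖ ^ 2 ≤ 1 → ∃ y ∈ N, ∀ b,
          ‖∑ j, x j • a b j - ∑ j, y j • a b j‖ ≤ u := by
  have hk' : (0 : ℝ) < k := by exact_mod_cast hk
  have hq' : (1 : ℝ) ≤ q := by exact_mod_cast hq
  have hsB : 0 < Real.sqrt B := by nlinarith
  have hB' : (0 : ℝ) < B := Real.sqrt_pos.1 hsB
  have hB : 0 < B := by exact_mod_cast hB'
  have hsqB : Real.sqrt B ^ 2 = B := Real.sq_sqrt hB'.le
  have hK : 1 ≤ Real.exp 307 := Real.one_le_exp (by norm_num)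
  set K := Real.exp 307
  set ρ := B / u ^ 2 with hρ
  have hρu : ρ * u ^ 2 = B := by rw [hρ]; field_simp
  have hρq : (q : ℝ) ^ 2 ≤ 16 * ρ := by
    rw [hρ, ← mul_div_assoc, le_div_iff₀ (by positivity), ← mul_pow, ← hsqB]
    calc ((q : ℝ) * u) ^ 2 ≤ (4 * Real.sqrt B) ^ 2 :=
          pow_le_pow_left₀ (by positivity) (by linarith) 2
      _ = _ := by ring
  have hρ1 : 1 ≤ 16 * ρ := by nlinarith
  have hρ0 : 0 < ρ := by linarith
  set L := ⌈576 * K * ρ⌉₊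
  have hL1 : 576 * K * ρ ≤ L := Nat.le_ceil _
  have hL2 : (L : ℝ) < 576 * K * ρ + 1 := Nat.ceil_lt_add_one (by positivity)
  have hρK : ρ ≤ K * ρ := by nlinarith
  have hL0' : (0 : ℝ) < L := by nlinarith
  have hL0 : 0 < L := by exact_mod_cast hL0'
  have hL1' : (1 : ℝ) ≤ L := by exact_mod_cast hL0
  have hexp : 10 * L ≤ ⌈10 * (576 * K + 16) * B / u ^ 2⌉₊ := by
    have h1 : 10 * (576 * K + 16) * B / u ^ 2 = 10 * (576 * K + 16) * ρ := by rw [hρ]; ring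
    have h2 : ((10 * L : ℕ) : ℝ) ≤ (⌈10 * (576 * K + 16) * B / u ^ 2⌉₊ : ℝ) := by
      refine le_trans ?_ (Nat.le_ceil _)
      rw [h1]
      push_cast
      nlinarith
    exact_mod_cast h2
  have hLq : 36 * (q : ℝ) ^ 2 ≤ L := by nlinarith
  have hgrid : Real.sqrt B / L ≤ u / 2 := by
    rw [div_le_div_iff₀ hL0' two_pos]
    apply le_of_sq_le_sq _ (by positivity)
    rw [mul_pow, mul_pow, hsqB, ← hρu]
    have : ρ * 4 ≤ (L : ℝ) ^ 2 := by nlinarith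
    nlinarith [sq_nonneg u]
  have hsamp : K * B / L ≤ (u / 2) ^ 2 := by
    rw [div_le_iff₀ hL0', ← hρu]
    have : K * ρ * 4 ≤ L := by nlinarith
    nlinarith [sq_nonneg u]
  have hbase : 0 < 2 * d + 1 := by omega
  have hx1 : ∀ x : Fin d → ℂ, (Finset.univ.filter fun i => x i ≠ 0).card ≤ k →
      k * ∑ j, ‖x j‖ ^ 2 ≤ 1 → ∑ j, ‖x j‖ ≤ 1 := by
    intro x hxs hx2
    refine (sum_norm_le_sqrt_mul_sqrt x hxs).trans ?_
    rw [← Real.sqrt_mul hk'.le]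
    exact Real.sqrt_le_one.2 hx2
  rcases le_total L d with hLd | hdL
  · obtain ⟨N, hNc, hN⟩ := exists_net_of_averages a ha hL0 hLd
    refine ⟨N, hNc.trans (Nat.pow_le_pow_right hbase hexp), fun x hxs hx2 => ?_⟩
    obtain ⟨f, c, hc, hfc⟩ : ∃ (f : Fin L → Fin d) (c : Fin L → ℂ), (∀ l, ‖c l‖ ≤ 2) ∧
        ∀ b, ‖∑ j, x j • a b j - ∑ l, (c l / L) • a b (f l)‖ ≤ u / 2 := by
      by_cases hx0 : x = 0
      · exact ⟨fun l => Fin.castLE hLd l, fun _ => 0, by simp, fun b => by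
          simp [hx0]; positivity⟩
      · obtain ⟨f, c, hc, hfc⟩ := exists_average_approx a ha hB hk hq hm hLq hD x hxs hx0
          (hx1 x hxs hx2) hx2
        exact ⟨f, c, hc, fun b => le_of_sq_le_sq ((hfc b).trans hsamp) (by positivity)⟩
    obtain ⟨y, hyN, hy⟩ := hN f c hc
    refine ⟨y, hyN, fun b => ?_⟩
    calc _ ≤ _ := norm_sub_le_norm_sub_add_norm_sub _ (∑ l, (c l / L) • a b (f l)) _
      _ ≤ u / 2 + u / 2 := add_le_add (hfc b) ((hy b).trans hgrid)
      _ = u := by ring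
  · obtain ⟨N, hNc, hN⟩ := exists_net_of_polydisc a ha hL0 hdL
    refine ⟨N, hNc.trans (Nat.pow_le_pow_right hbase hexp), fun x hxs hx2 => ?_⟩
    obtain ⟨y, hyN, hy⟩ := hN x fun j =>
      (Finset.single_le_sum (f := fun j => ‖x j‖) (fun i _ => norm_nonneg _)
        (Finset.mem_univ j)).trans ((hx1 x hxs hx2).trans one_le_two)
    exact ⟨y, hyN, fun b => (hy b).trans (hgrid.trans (by linarith))⟩

/-- Lemma `covering`: under the hypotheses of Theorem `covering`, for every
`u > 0` there is a `u`-net (in the `‖·‖_X` seminorm) of `T_k/√k` of cardinality at most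
`(2d+1)^{O(B/u²)}`. -/
theorem stmt5 :
    ∃ C : ℝ, 0 < C ∧
      ∀ (m B d k : ℕ) (Q₁ Q₂ : ℝ) (A : Fin (m * B) → Fin d → ℂ),
        (∀ r j, ‖A r j‖ ≤ 1) →
        (∀ s ≤ 2 * k, ∀ b : Fin m, ∀ x ∈ Tset d s,
          l2norm (mvec (bucket m B d A b) x) ≤ Q₁ * Real.sqrt B + Q₂ * Real.sqrt s) →
        (B : ℝ) ≥ max (Q₂ ^ 2 * (Real.log m) ^ 2) (Q₁ ^ 2 * Real.log m * Real.log k) →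
        (k : ℝ) ≥ Q₁ ^ 2 * (Real.log m) ^ 2 →
        ∀ u : ℝ, 0 < u →
          ∃ N : Finset (Fin d → ℂ),
            (N.card : ℝ) ≤ ((2 * d + 1 : ℕ) : ℝ) ^ (⌈C * B / u ^ 2⌉₊) ∧
            ∀ x ∈ (fun z => (((Real.sqrt k : ℝ) : ℂ))⁻¹ • z) '' Tset d k,
              ∃ y ∈ N, Xnorm m B d A (x - y) ≤ u := by
  refine ⟨10 * (576 * Real.exp 307 + 16), by positivity, ?_⟩
  intro m B d k Q₁ Q₂ A hA hQ hBQ hkQ u hu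
  have hbase : (1 : ℝ) ≤ ((2 * d + 1 : ℕ) : ℝ) := by exact_mod_cast Nat.le_add_left 1 (2 * d)
  have hsmul : ∀ z ∈ Tset d k,
      (Finset.univ.filter fun i => ((((Real.sqrt k : ℝ) : ℂ))⁻¹ • z) i ≠ 0).card ≤ k ∧
        k * ∑ j, ‖((((Real.sqrt k : ℝ) : ℂ))⁻¹ • z) j‖ ^ 2 ≤ 1 := by
    rintro z ⟨hzs, hz1⟩
    refine ⟨le_trans (Finset.card_le_card fun j hj => ?_) hzs, ?_⟩
    · simp only [Finset.mem_filter, Finset.mem_univ, true_and, Pi.smul_apply] at hj ⊢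
      intro h
      exact hj (by simp [h])
    · have hz2 : ∑ j, ‖z j‖ ^ 2 ≤ 1 := Real.sqrt_le_one.1 hz1
      have h1 : ∑ j, ‖((((Real.sqrt k : ℝ) : ℂ))⁻¹ • z) j‖ ^ 2 = (k : ℝ)⁻¹ * ∑ j, ‖z j‖ ^ 2 := by
        rw [Finset.mul_sum]
        refine Finset.sum_congr rfl fun j _ => ?_
        rw [Pi.smul_apply, norm_smul, norm_inv, Complex.norm_real,
          Real.norm_of_nonneg (Real.sqrt_nonneg _), mul_pow, inv_pow,
          Real.sq_sqrt (Nat.cast_nonneg k)]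
      rw [h1, ← mul_assoc]
      exact mul_le_one₀ mul_inv_le_one (Finset.sum_nonneg fun j _ => sq_nonneg _) hz2
  obtain ⟨q, hq, hm, hD⟩ := exists_log_scale hA (hQ k (by omega)) ((le_max_left _ _).trans hBQ) hkQ
  have hq' : (0 : ℝ) < q := by exact_mod_cast hq
  rcases le_or_gt (4 * Real.sqrt B) (u * q) with huq | huq
  · refine ⟨{0}, by simpa using one_le_pow₀ hbase, ?_⟩
    rintro _ ⟨z, hz, rfl⟩
    refine ⟨0, Finset.mem_singleton_self 0, Xnorm_sub_le hu.le fun b => ?_⟩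
    obtain ⟨hxs, hx2⟩ := hsmul z hz
    simp only [Pi.zero_apply, zero_smul, Finset.sum_const_zero, sub_zero]
    refine (hD b _ hxs).trans ?_
    rw [Real.sqrt_mul (Nat.cast_nonneg B), div_mul_eq_mul_div, div_le_iff₀ hq']
    calc _ = 4 * Real.sqrt B * Real.sqrt (k * ∑ j, ‖((((Real.sqrt k : ℝ) : ℂ))⁻¹ • z) j‖ ^ 2) := by
          rw [Real.sqrt_mul (Nat.cast_nonneg k)]; ring
      _ ≤ 4 * Real.sqrt B * 1 := by
          gcongr
          exact Real.sqrt_le_one.2 hx2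
      _ ≤ u * q := by rwa [mul_one]
  · rcases Nat.eq_zero_or_pos k with rfl | hk
    · refine ⟨{0}, by simpa using one_le_pow₀ hbase, ?_⟩
      rintro _ ⟨z, -, rfl⟩
      exact ⟨0, Finset.mem_singleton_self 0, Xnorm_sub_le hu.le fun b => by simpa using hu.le⟩
    · obtain ⟨N, hNc, hN⟩ := exists_net_of_small_scale (bucketCol m B d A)
        (norm_bucketCol_le hA) hk hq hm hD u hu huq
      refine ⟨N, by exact_mod_cast hNc, ?_⟩
      rintro _ ⟨z, hz, rfl⟩
      obtain ⟨hxs, hx2⟩ := hsmul z hz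
      obtain ⟨y, hyN, hy⟩ := hN _ hxs hx2
      exact ⟨y, hyN, Xnorm_sub_le hu.le hy⟩

end
end
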